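/- Let 𝒞 be a circle decomposition of the annulus A and let C ∈ 𝒞 be contained in the interior {p : A | 0 < p.2 ∧ p.2 < 1} of A. Then A \ C has exactly two connected components, and the closure in A of each of these components is homeomorphic to the annulus Circle × Set.Icc (0:ℝ) 1. -/

import Mathlib

open Topology Set

/-- A circle in a topological space `X`: a subset homeomorphic to the unit circle. -/
def IsCircle {X : Type*} [TopologicalSpace X] (C : Set X) : Prop :=
  Nonempty (C ≃ₜ Circle)

/-- A circle decomposition of `X`: a set of pairwise disjoint circles whose union is `X`. -/
def IsCircleDecomposition {X : Type*} [TopologicalSpace X] (𝒞 : Set (Set X)) : Prop :=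
  (∀ C ∈ 𝒞, IsCircle C) ∧
  (∀ C ∈ 𝒞, ∀ D ∈ 𝒞, C ≠ D → Disjoint C D) ∧
  ⋃₀ 𝒞 = Set.univ

/-- `f` has a continuous logarithm on `K`. -/
def HasLogOn {X : Type*} [TopologicalSpace X] (f : X → ℂ) (K : Set X) : Prop :=
  ∃ g : X → ℂ, ContinuousOn g K ∧ ∀ z ∈ K, Complex.exp (g z) = f z

namespace HasLogOn

variable {X Y : Type*} [TopologicalSpace X] [TopologicalSpace Y] {f h : X → ℂ} {K L : Set X}

theorem mul (hf : HasLogOn f K) (hh : HasLogOn h K) : HasLogOn (fun z => f z * h z) K := by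
  obtain ⟨g, hg, hge⟩ := hf
  obtain ⟨k, hk, hke⟩ := hh
  exact ⟨fun z => g z + k z, hg.add hk, fun z hz => by rw [Complex.exp_add, hge z hz, hke z hz]⟩

theorem zpow (hf : HasLogOn f K) (m : ℤ) : HasLogOn (fun z => f z ^ m) K := by
  obtain ⟨g, hg, hge⟩ := hf
  exact ⟨fun z => m * g z, continuousOn_const.mul hg,
    fun z hz => by rw [Complex.exp_int_mul, hge z hz]⟩

theorem inv (hf : HasLogOn f K) : HasLogOn (fun z => (f z)⁻¹) K := by
  simpa using hf.zpow (-1)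

theorem div (hf : HasLogOn f K) (hh : HasLogOn h K) : HasLogOn (fun z => f z / h z) K := by
  simpa only [div_eq_mul_inv] using hf.mul hh.inv

theorem mono (hf : HasLogOn f K) (hLK : L ⊆ K) : HasLogOn f L := by
  obtain ⟨g, hg, hge⟩ := hf
  exact ⟨g, hg.mono hLK, fun z hz => hge z (hLK hz)⟩

theorem congr (hf : HasLogOn f K) (hfh : ∀ z ∈ K, f z = h z) : HasLogOn h K := by
  obtain ⟨g, hg, hge⟩ := hf
  exact ⟨g, hg, fun z hz => by rw [hge z hz, hfh z hz]⟩

theorem comp {k : Y → X} {M : Set Y} (hf : HasLogOn f K) (hk : ContinuousOn k M)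
    (hm : MapsTo k M K) : HasLogOn (fun y => f (k y)) M := by
  obtain ⟨g, hg, hge⟩ := hf
  exact ⟨fun y => g (k y), hg.comp hk hm, fun z hz => hge _ (hm hz)⟩

theorem const {c : ℂ} (hc : c ≠ 0) : HasLogOn (fun _ : X => c) K :=
  ⟨fun _ => Complex.log c, continuousOn_const, fun _ _ => Complex.exp_log hc⟩

theorem of_slitPlane (hf : ContinuousOn f K) (h : ∀ z ∈ K, f z ∈ Complex.slitPlane) :
    HasLogOn f K :=
  ⟨fun z => Complex.log (f z), hf.clog h,
    fun z hz => Complex.exp_log (Complex.slitPlane_ne_zero (h z hz))⟩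

theorem of_norm_sub_lt {c : ℂ} (hf : ContinuousOn f K) (h : ∀ z ∈ K, ‖f z - c‖ < ‖c‖) :
    HasLogOn f K := by
  rcases eq_or_ne c 0 with rfl | hc
  · refine ⟨f, hf, fun z hz => ?_⟩
    have := h z hz
    simp at this
    exact absurd this (not_lt.mpr (norm_nonneg _))
  have h1 : HasLogOn (fun z => f z / c) K := by
    refine of_slitPlane (hf.div_const c) fun z hz => ?_
    refine Complex.mem_slitPlane_of_norm_lt_one (z := f z / c - 1) ?_ |> fun h => by simpa using h
    rw [div_sub_one hc, norm_div, div_lt_one (norm_pos_iff.mpr hc)]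
    exact h z hz
  exact (h1.mul (const hc)).congr fun z _ => div_mul_cancel₀ _ hc

/-- If `h` is nonvanishing and `f` is relatively close to `h`, logarithms of `h` give
logarithms of `f`. -/
theorem of_close (hh : HasLogOn h K) (hf : ContinuousOn f K)
    (hc : ∀ z ∈ K, ‖f z - h z‖ < ‖h z‖) : HasLogOn f K := by
  have hhc : ContinuousOn h K := by
    obtain ⟨g, hg, hge⟩ := hh
    exact hg.cexp.congr fun z hz => (hge z hz).symm
  have h0 : ∀ z ∈ K, h z ≠ 0 := fun z hz h0 => by
    have := hc z hz
    rw [h0, norm_zero] at this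
    exact absurd this (not_lt.mpr (norm_nonneg _))
  have h1 : HasLogOn (fun z => f z / h z) K := by
    refine of_norm_sub_lt (c := 1) (hf.div hhc h0) fun z hz => ?_
    rw [div_sub_one (h0 z hz), norm_div, norm_one, div_lt_one (norm_pos_iff.mpr (h0 z hz))]
    exact hc z hz
  exact (h1.mul hh).congr fun z hz => div_mul_cancel₀ _ (h0 z hz)

theorem ne_zero (hf : HasLogOn f K) {z : X} (hz : z ∈ K) : f z ≠ 0 := by
  obtain ⟨g, -, hge⟩ := hf
  rw [← hge z hz]
  exact Complex.exp_ne_zero _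

end HasLogOn

/-- Two continuous logarithms of the same function on a preconnected set differ by a constant. -/
theorem exists_int_of_exp_eq {X : Type*} [TopologicalSpace X] {S : Set X} (hS : IsPreconnected S)
    {g k : X → ℂ} (hg : ContinuousOn g S) (hk : ContinuousOn k S)
    (h : ∀ z ∈ S, Complex.exp (g z) = Complex.exp (k z)) :
    ∃ n : ℤ, ∀ z ∈ S, g z = k z + n * (2 * Real.pi * Complex.I) := by
  rcases S.eq_empty_or_nonempty with rfl | ⟨x, hx⟩
  · exact ⟨0, by simp⟩
  have hpi : (2 * Real.pi * Complex.I : ℂ) ≠ 0 := Complex.two_pi_I_ne_zero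
  choose! n hn using fun z hz => Complex.exp_eq_exp_iff_exists_int.mp (h z hz)
  have hcont : ContinuousOn (fun z => ((n z : ℤ) : ℝ)) S := by
    have : ContinuousOn (fun z => ((g z - k z) / (2 * Real.pi * Complex.I)).re) S :=
      Complex.continuous_re.comp_continuousOn ((hg.sub hk).div_const _)
    refine this.congr fun z hz => ?_
    have := hn z hz
    simp only [this, add_sub_cancel_left, mul_div_cancel_right₀ _ hpi]
    simp
  have hcont' : ContinuousOn n S := by
    rwa [Int.isClosedEmbedding_coe_real.isEmbedding.continuousOn_iff]
  refine ⟨n x, fun z hz => ?_⟩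
  rw [hn z hz, hS.constant hcont' hz hx]

/-- A nonzero power of `z - a` has no continuous logarithm on a circle around `a`. -/
theorem not_hasLogOn_zpow_sphere {a : ℂ} {R : ℝ} (hR : 0 < R) {m : ℤ}
    (h : HasLogOn (fun z => (z - a) ^ m) (Metric.sphere a R)) : m = 0 := by
  obtain ⟨g, hg, hge⟩ := h
  have hmem : ∀ θ : ℝ, a + R * Complex.exp (θ * Complex.I) ∈ Metric.sphere a R := fun θ => by
    simp [Complex.norm_exp_ofReal_mul_I, abs_of_pos hR]
  have hR0 : (R : ℂ) ≠ 0 := by exact_mod_cast hR.ne'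
  have hc1 : ContinuousOn (fun θ : ℝ => g (a + R * Complex.exp (θ * Complex.I))) univ :=
    hg.comp (by fun_prop) fun θ _ => hmem θ
  have hc2 : ContinuousOn (fun θ : ℝ => (m : ℂ) * (Complex.log R + θ * Complex.I)) univ := by
    fun_prop
  obtain ⟨n, hn⟩ := exists_int_of_exp_eq isPreconnected_univ hc1 hc2 fun θ _ => by
    rw [hge _ (hmem θ)]
    simp only
    rw [add_sub_cancel_left, Complex.exp_int_mul, Complex.exp_add,
      Complex.exp_log hR0]
  have h0 := hn 0 trivial
  have h1 := hn (2 * Real.pi) trivial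
  simp only [Complex.ofReal_mul, Complex.ofReal_ofNat, Complex.exp_two_pi_mul_I, Complex.ofReal_zero, zero_mul,
    Complex.exp_zero] at h0 h1
  rw [h0] at h1
  have : (m : ℂ) * (2 * Real.pi * Complex.I) = 0 := by linear_combination -h1
  simpa [Complex.two_pi_I_ne_zero] using this

theorem hasLogOn_univ {f : ℂ → ℂ} (hf : Continuous f) (h0 : ∀ z, f z ≠ 0) :
    HasLogOn f univ := by
  have hs : IsSimplyConnected (univ : Set ℂ) := by
    have : ContractibleSpace (univ : Set ℂ) :=
      (Homeomorph.Set.univ ℂ).contractibleSpace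
    exact (inferInstance : SimplyConnectedSpace (univ : Set ℂ))
  obtain ⟨g, hg, hge⟩ := Complex.exists_continuousOn_eqOn_exp_comp hs isOpen_univ
    hf.continuousOn (by rintro ⟨z, -, hz⟩; exact h0 z hz)
  exact ⟨g, hg, fun z hz => hge hz⟩

theorem hasLogOn_closedBall {f : ℂ → ℂ} {R : ℝ} (hR : 0 < R)
    (hf : ContinuousOn f (Metric.closedBall 0 R)) (h0 : ∀ z ∈ Metric.closedBall 0 R, f z ≠ 0) :
    HasLogOn f (Metric.closedBall 0 R) := by
  set p : ℂ → ℂ := fun z => z / (max 1 (‖z‖ / R) : ℝ) with hp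
  have hpos : ∀ z : ℂ, 0 < max 1 (‖z‖ / R) := fun z => lt_max_of_lt_left one_pos
  have hpc : Continuous p := by
    refine continuous_id.div (by fun_prop) fun z => ?_
    exact_mod_cast (hpos z).ne'
  have hpm : ∀ z, p z ∈ Metric.closedBall (0 : ℂ) R := fun z => by
    rw [mem_closedBall_zero_iff, hp]
    simp only [norm_div, Complex.norm_real, Real.norm_eq_abs, abs_of_pos (hpos z)]
    rw [div_le_iff₀ (hpos z)]
    have := le_max_right 1 (‖z‖ / R)
    rwa [div_le_iff₀ hR, mul_comm] at this
  have h1 : HasLogOn (fun z => f (p z)) univ :=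
    hasLogOn_univ (hf.comp_continuous hpc hpm) fun z => h0 _ (hpm z)
  refine (h1.mono (subset_univ _)).congr fun z hz => ?_
  rw [mem_closedBall_zero_iff] at hz
  have : max 1 (‖z‖ / R) = 1 := max_eq_left (by rwa [div_le_one hR])
  simp [hp, this]

theorem exists_continuous_eqOn_of_isClosed {K : Set ℂ} (hK : IsClosed K) {g : ℂ → ℂ}
    (hg : ContinuousOn g K) : ∃ G : ℂ → ℂ, Continuous G ∧ EqOn G g K := by
  obtain ⟨G, hG⟩ := ContinuousMap.exists_restrict_eq hK
    (⟨K.domRestrict g, hg.domRestrict⟩ : C(K, ℂ))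
  refine ⟨G, G.continuous, fun z hz => ?_⟩
  have := DFunLike.congr_fun hG ⟨z, hz⟩
  exact this

theorem closure_connectedComponentIn_subset {K : Set ℂ} (hK : IsClosed K) (a : ℂ) :
    closure (connectedComponentIn Kᶜ a) ⊆ connectedComponentIn Kᶜ a ∪ K := by
  intro z hz
  by_cases hzK : z ∈ K
  · exact Or.inr hzK
  left
  have ho : IsOpen (connectedComponentIn Kᶜ z) := hK.isOpen_compl.connectedComponentIn
  obtain ⟨w, hwz, hwa⟩ := mem_closure_iff.mp hz _ ho (mem_connectedComponentIn hzK)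
  rw [connectedComponentIn_eq hwa, ← connectedComponentIn_eq hwz]
  exact mem_connectedComponentIn hzK

theorem continuous_piecewise_of_isClosed {A B : Set ℂ} {f g : ℂ → ℂ} (hA : IsClosed A)
    (hB : IsClosed B) (hAB : A ∪ B = univ) (hf : ContinuousOn f A) (hg : ContinuousOn g B)
    (h : ∀ z ∈ A ∩ B, f z = g z) [DecidablePred (· ∈ A)] :
    Continuous (fun z => if z ∈ A then f z else g z) := by
  rw [← continuousOn_univ, ← hAB]
  refine ContinuousOn.union_of_isClosed (hf.congr fun z hz => if_pos hz)
    (hg.congr fun z hz => ?_) hA hB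
  by_cases hzA : z ∈ A
  · simp only [if_pos hzA]
    exact h z ⟨hzA, hz⟩
  · simp only [if_neg hzA]

theorem eq_zero_of_hasLogOn_of_bounded {K : Set ℂ} (hK : IsClosed K) {a : ℂ} (ha : a ∉ K)
    (hb : Bornology.IsBounded (connectedComponentIn Kᶜ a)) {q : ℂ → ℂ}
    (hq : ContinuousOn q (closure (connectedComponentIn Kᶜ a)))
    (hq0 : ∀ z ∈ closure (connectedComponentIn Kᶜ a), q z ≠ 0) {m : ℤ}
    (h : HasLogOn (fun z => (z - a) ^ m * q z) K) : m = 0 := by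
  classical
  set U := connectedComponentIn Kᶜ a with hU
  have hUo : IsOpen U := hK.isOpen_compl.connectedComponentIn
  have haU : a ∈ U := mem_connectedComponentIn ha
  obtain ⟨g, hg, hge⟩ := h
  obtain ⟨G, hG, hGg⟩ := exists_continuous_eqOn_of_isClosed hK hg
  have hcl : closure U ∩ Uᶜ ⊆ K := fun z hz =>
    (closure_connectedComponentIn_subset hK a hz.1).resolve_left hz.2
  have hcont : Continuous (fun z => if z ∈ closure U then Complex.exp (G z) / q z
      else (z - a) ^ m) := by
    refine continuous_piecewise_of_isClosed isClosed_closure hUo.isClosed_compl ?_ ?_ ?_ ?_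
    · exact eq_univ_of_forall fun z => (em (z ∈ U)).imp (fun h => subset_closure h) id
    · exact hG.cexp.continuousOn.div hq hq0
    · refine ContinuousOn.zpow₀ (by fun_prop) m fun z hz => Or.inl ?_
      rw [sub_ne_zero]
      rintro rfl
      exact hz haU
    · intro z hz
      rw [hGg (hcl hz), hge z (hcl hz), mul_div_cancel_right₀ _ (hq0 z hz.1)]
  have hlog := hasLogOn_univ hcont fun z => by
    split_ifs with hz
    · exact div_ne_zero (Complex.exp_ne_zero _) (hq0 z hz)
    · refine zpow_ne_zero _ (sub_ne_zero.mpr ?_)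
      rintro rfl
      exact hz (subset_closure haU)
  obtain ⟨R, hR⟩ := hb.closure.subset_ball a
  have hRpos : 0 < R := by
    have := hR (subset_closure haU)
    simpa using this
  refine not_hasLogOn_zpow_sphere hRpos ((hlog.mono (subset_univ (Metric.sphere a R))).congr ?_)
  intro z hz
  rw [if_neg]
  intro hzU
  have := hR hzU
  rw [Metric.mem_sphere] at hz
  rw [Metric.mem_ball, hz] at this
  exact lt_irrefl _ this

theorem isPreconnected_norm_gt (R : ℝ) : IsPreconnected {z : ℂ | R < ‖z‖} := by
  have h : IsPreconnected ((fun p : ℝ × ℝ => (p.1 : ℂ) * Complex.exp (p.2 * Complex.I)) ''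
      (Ioi R ×ˢ univ)) :=
    (isPreconnected_Ioi.prod isPreconnected_univ).image _ (by fun_prop)
  convert h using 1
  ext z
  constructor
  · intro hz
    exact ⟨(‖z‖, z.arg), ⟨hz, trivial⟩, Complex.norm_mul_exp_arg_mul_I z⟩
  · rintro ⟨⟨r, θ⟩, ⟨hr, -⟩, rfl⟩
    have hr' : R < r := hr
    simp only [mem_ofPred_eq, norm_mul, Complex.norm_real, Complex.norm_exp_ofReal_mul_I, mul_one]
    exact hr'.trans_le (le_abs_self r)

/-- `a` and `b` lie in the same component of the complement of `K`, in terms of logarithms. -/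
theorem hasLogOn_sub_div_sub {K : Set ℂ} (hK : IsClosed K) {a b : ℂ} (ha : a ∉ K)
    (hb : b ∈ connectedComponentIn Kᶜ a) : HasLogOn (fun z => (z - a) / (z - b)) K := by
  have hsub : connectedComponentIn Kᶜ a ⊆ Kᶜ := connectedComponentIn_subset _ _
  refine isPreconnected_connectedComponentIn.induction₂
    (fun a b => HasLogOn (fun z => (z - a) / (z - b)) K) ?_ ?_ ?_
    (mem_connectedComponentIn ha) hb
  · intro c hc
    obtain ⟨ε, hε, hball⟩ := Metric.isOpen_iff.mp hK.isOpen_compl c (hsub hc)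
    refine Filter.Eventually.filter_mono nhdsWithin_le_nhds ?_
    filter_upwards [Metric.ball_mem_nhds c (half_pos hε)] with d hd
    have hd' : ‖d - c‖ < ε / 2 := by rwa [← dist_eq_norm]
    have hz : ∀ z ∈ K, ε / 2 < ‖z - d‖ := fun z hz => by
      have h1 : ε ≤ ‖z - c‖ := by
        by_contra! h
        exact hball (by rwa [Metric.mem_ball, dist_eq_norm]) hz
      have h2 : ‖z - c‖ ≤ ‖z - d‖ + ‖d - c‖ := by
        simpa using norm_add_le (z - d) (d - c)
      linarith
    have hz0 : ∀ z ∈ K, z - d ≠ 0 := fun z hzK => norm_pos_iff.mp ((half_pos hε).trans (hz z hzK))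
    refine HasLogOn.of_norm_sub_lt (c := 1) (ContinuousOn.div (by fun_prop) (by fun_prop) hz0) ?_
    intro z hzK
    rw [div_sub_one (hz0 z hzK), norm_div, norm_one, div_lt_one (norm_pos_iff.mpr (hz0 z hzK)),
      sub_sub_sub_cancel_left]
    exact hd'.trans (hz z hzK)
  · intro x y z _ hy _ h1 h2
    refine (h1.mul h2).congr fun w hw => div_mul_div_cancel₀ ?_
    rw [sub_ne_zero]
    rintro rfl
    exact hsub hy hw
  · intro x y _ _ h
    exact h.inv.congr fun w _ => inv_div _ _

theorem connectedComponentIn_eq_of_not_isBounded {K : Set ℂ} (hK : IsCompact K) {a b : ℂ}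
    (ha : ¬ Bornology.IsBounded (connectedComponentIn Kᶜ a))
    (hb : ¬ Bornology.IsBounded (connectedComponentIn Kᶜ b)) :
    connectedComponentIn Kᶜ a = connectedComponentIn Kᶜ b := by
  obtain ⟨R, hR⟩ := hK.isBounded.subset_closedBall 0
  have key : ∀ c, ¬ Bornology.IsBounded (connectedComponentIn Kᶜ c) →
      ∃ d, R < ‖d‖ ∧ connectedComponentIn Kᶜ c = connectedComponentIn Kᶜ d := by
    intro c hc
    by_contra! h
    refine hc ((Metric.isBounded_closedBall (x := (0 : ℂ)) (r := R)).subset fun d hd => ?_)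
    by_contra hd'
    rw [mem_closedBall_zero_iff, not_le] at hd'
    exact h d hd' (connectedComponentIn_eq hd)
  obtain ⟨d, hd, hdc⟩ := key a ha
  obtain ⟨e, he, hec⟩ := key b hb
  rw [hdc, hec]
  have hsub : {z : ℂ | R < ‖z‖} ⊆ Kᶜ := fun z hz hzK => by
    have := hR hzK
    rw [mem_closedBall_zero_iff] at this
    exact absurd hz (not_lt.mpr this)
  exact connectedComponentIn_eq
    ((isPreconnected_norm_gt R).subset_connectedComponentIn hd hsub he)

theorem connectedComponentIn_eq_of_hasLogOn {K : Set ℂ} (hK : IsCompact K) {a b : ℂ} (ha : a ∉ K)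
    (hb : b ∉ K) (h : HasLogOn (fun z => (z - a) / (z - b)) K) :
    connectedComponentIn Kᶜ a = connectedComponentIn Kᶜ b := by
  have key : ∀ a b : ℂ, a ∉ K → b ∉ K → HasLogOn (fun z => (z - a) / (z - b)) K →
      Bornology.IsBounded (connectedComponentIn Kᶜ a) →
      connectedComponentIn Kᶜ a = connectedComponentIn Kᶜ b := by
    intro a b ha hb h hbd
    by_contra hne
    have hbU : b ∉ closure (connectedComponentIn Kᶜ a) := fun hmem =>
      (closure_connectedComponentIn_subset hK.isClosed a hmem).elim
        (fun h => hne (connectedComponentIn_eq h)) hb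
    have h0 : ∀ z ∈ closure (connectedComponentIn Kᶜ a), z - b ≠ 0 := fun z hz => by
      rw [sub_ne_zero]
      rintro rfl
      exact hbU hz
    have := eq_zero_of_hasLogOn_of_bounded hK.isClosed ha hbd (q := fun z => (z - b)⁻¹) (m := 1)
      (ContinuousOn.inv₀ (by fun_prop) h0) (fun z hz => inv_ne_zero (h0 z hz))
      (h.congr fun z _ => by rw [zpow_one, div_eq_mul_inv])
    exact one_ne_zero this
  by_cases h1 : Bornology.IsBounded (connectedComponentIn Kᶜ a)
  · exact key a b ha hb h h1
  by_cases h2 : Bornology.IsBounded (connectedComponentIn Kᶜ b)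
  · exact (key b a hb ha (h.inv.congr fun w _ => inv_div _ _) h2).symm
  exact connectedComponentIn_eq_of_not_isBounded hK h1 h2

theorem hasLogOn_sub_of_closedBall {K : Set ℂ} {c b : ℂ} {R : ℝ}
    (hK : K ⊆ Metric.closedBall c R) (hb : b ∉ Metric.closedBall c R) :
    HasLogOn (fun z => z - b) K := by
  rw [Metric.mem_closedBall, not_le] at hb
  refine HasLogOn.of_norm_sub_lt (c := c - b) (by fun_prop) fun z hz => ?_
  rw [sub_sub_sub_cancel_right, ← dist_eq_norm, ← dist_eq_norm, dist_comm c b]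
  exact (Metric.mem_closedBall.mp (hK hz)).trans_lt hb

theorem hasLogOn_sub_iff {K : Set ℂ} (hK : IsCompact K) {a : ℂ} (ha : a ∉ K) :
    HasLogOn (fun z => z - a) K ↔ ¬ Bornology.IsBounded (connectedComponentIn Kᶜ a) := by
  constructor
  · intro h hb
    have := eq_zero_of_hasLogOn_of_bounded hK.isClosed ha hb (q := fun _ => 1) (m := 1)
      continuousOn_const (fun _ _ => one_ne_zero) (h.congr fun z _ => by simp)
    exact one_ne_zero this
  · intro h
    obtain ⟨R, hR⟩ := hK.isBounded.subset_closedBall 0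
    have : ∃ b ∈ connectedComponentIn Kᶜ a, b ∉ Metric.closedBall (0 : ℂ) R := by
      by_contra! h'
      exact h (Metric.isBounded_closedBall.subset h')
    obtain ⟨b, hba, hb⟩ := this
    refine ((hasLogOn_sub_div_sub hK.isClosed ha hba).mul
      (hasLogOn_sub_of_closedBall hR hb)).congr fun z hz => div_mul_cancel₀ _ ?_
    rw [sub_ne_zero]
    rintro rfl
    exact connectedComponentIn_subset _ _ hba hz

theorem HasLogOn.union {f : ℂ → ℂ} {K L : Set ℂ} (hK : IsClosed K) (hL : IsClosed L)
    (hc : IsPreconnected (K ∩ L)) (h1 : HasLogOn f K) (h2 : HasLogOn f L) :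
    HasLogOn f (K ∪ L) := by
  classical
  obtain ⟨g, hg, hge⟩ := h1
  obtain ⟨k, hk, hke⟩ := h2
  obtain ⟨n, hn⟩ := exists_int_of_exp_eq hc (hg.mono inter_subset_left)
    (hk.mono inter_subset_right) fun z hz => by rw [hge z hz.1, hke z hz.2]
  refine ⟨fun z => if z ∈ K then g z else k z + n * (2 * Real.pi * Complex.I), ?_, ?_⟩
  · have hk' : ContinuousOn (fun z => k z + n * (2 * Real.pi * Complex.I)) L :=
      hk.add continuousOn_const
    refine ContinuousOn.union_of_isClosed (hg.congr fun z hz => if_pos hz)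
      (hk'.congr fun z hz => ?_) hK hL
    by_cases hzK : z ∈ K
    · simp only [if_pos hzK]
      exact hn z ⟨hzK, hz⟩
    · simp only [if_neg hzK]
  · intro z hz
    by_cases hzK : z ∈ K
    · simp only [if_pos hzK, hge z hzK]
    · simp only [if_neg hzK, Complex.exp_add, Complex.exp_int_mul_two_pi_mul_I, mul_one]
      exact hke z (hz.resolve_left hzK)

/-- Janiszewski's theorem. -/
theorem connectedComponentIn_union_eq {K L : Set ℂ} (hK : IsCompact K) (hL : IsCompact L)
    (hc : IsPreconnected (K ∩ L)) {a b : ℂ} (ha : a ∉ K ∪ L) (hb : b ∉ K ∪ L)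
    (h1 : HasLogOn (fun z => (z - a) / (z - b)) K)
    (h2 : HasLogOn (fun z => (z - a) / (z - b)) L) :
    connectedComponentIn (K ∪ L)ᶜ a = connectedComponentIn (K ∪ L)ᶜ b :=
  connectedComponentIn_eq_of_hasLogOn (hK.union hL) ha hb
    (HasLogOn.union hK.isClosed hL.isClosed hc h1 h2)

/-- Up to an integer power of `z - a`, the function `H` has a logarithm near `a`. -/
def HasLocalIndex (H : ℂ → ℂ) (a : ℂ) : Prop :=
  ∃ m : ℤ, ∃ r > 0, HasLogOn (fun z => H z * (z - a) ^ m) (Metric.ball a r \ {a})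

theorem clm_eq_mul_add_mul_conj (L : ℂ →L[ℝ] ℂ) (w : ℂ) :
    L w = (L 1 - Complex.I * L Complex.I) / 2 * w
      + (L 1 + Complex.I * L Complex.I) / 2 * (starRingEnd ℂ) w := by
  have h1 : L w = w.re * L 1 + w.im * L Complex.I := by
    conv_lhs => rw [show w = w.re • (1 : ℂ) + w.im • Complex.I by
      simp [Complex.re_add_im]]
    rw [map_add, map_smul, map_smul, Complex.real_smul, Complex.real_smul]
  have h2 : w + (starRingEnd ℂ) w = 2 * w.re := by
    rw [Complex.add_conj]; push_cast; ring
  have h3 : w - (starRingEnd ℂ) w = 2 * w.im * Complex.I := by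
    rw [Complex.sub_conj]; push_cast; ring
  rw [h1]
  linear_combination (-(L 1) / 2) * h2 + (Complex.I * L Complex.I / 2) * h3
    + (w.im * L Complex.I) * Complex.I_mul_I

theorem clm_det_eq (L : ℂ →L[ℝ] ℂ) :
    L.det = ‖(L 1 - Complex.I * L Complex.I) / 2‖ ^ 2
      - ‖(L 1 + Complex.I * L Complex.I) / 2‖ ^ 2 := by
  have h : L.det = (L 1).re * (L Complex.I).im - (L Complex.I).re * (L 1).im := by
    rw [ContinuousLinearMap.det, ← LinearMap.det_toMatrix Complex.basisOneI, Matrix.det_fin_two]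
    simp [LinearMap.toMatrix_apply]
  rw [h, ← Complex.normSq_eq_norm_sq, ← Complex.normSq_eq_norm_sq]
  simp [Complex.normSq_apply]
  ring

theorem hasLocalIndex_of_det_ne_zero {H : ℂ → ℂ} (hH : Continuous H) {L : ℂ →L[ℝ] ℂ} {a : ℂ}
    (hL : HasFDerivAt H L a) (h0 : H a = 0) (hdet : L.det ≠ 0) :
    HasLocalIndex H a ∧ ∀ᶠ z in 𝓝[≠] a, H z ≠ 0 := by
  set α := (L 1 - Complex.I * L Complex.I) / 2 with hα
  set β := (L 1 + Complex.I * L Complex.I) / 2 with hβ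
  have hαβ : ‖α‖ ≠ ‖β‖ := fun h => hdet (by rw [clm_det_eq, ← hα, ← hβ, h, sub_self])
  have hε : 0 < |‖α‖ - ‖β‖| := abs_pos.mpr (sub_ne_zero.mpr hαβ)
  have hev : ∀ᶠ z in 𝓝 a, ‖H z - (α * (z - a) + β * (starRingEnd ℂ) (z - a))‖
      ≤ |‖α‖ - ‖β‖| / 2 * ‖z - a‖ := by
    filter_upwards [hL.isLittleO.def (half_pos hε)] with z hz
    rwa [h0, sub_zero, clm_eq_mul_add_mul_conj L (z - a)] at hz
  obtain ⟨r, hr, hball⟩ := Metric.eventually_nhds_iff_ball.mp hev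
  have hsub : ∀ z ∈ Metric.ball a r \ {a}, 0 < ‖z - a‖ := fun z hz =>
    norm_pos_iff.mpr (sub_ne_zero.mpr hz.2)
  have hlog : ∃ m : ℤ, HasLogOn (fun z => H z * (z - a) ^ m) (Metric.ball a r \ {a}) := by
    rcases lt_or_gt_of_ne hαβ with hlt | hlt
    · refine ⟨1, HasLogOn.of_close (h := fun z => β * ((‖z - a‖ ^ 2 : ℝ) : ℂ))
        ((HasLogOn.const ?_).mul (HasLogOn.of_slitPlane (by fun_prop) fun z hz => ?_))
        (by simp only [zpow_one]; fun_prop) fun z hz => ?_⟩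
      · exact norm_pos_iff.mp ((norm_nonneg _).trans_lt hlt)
      · exact Complex.ofReal_mem_slitPlane.mpr (pow_pos (hsub z hz) 2)
      · have h1 := hball z hz.1
        rw [abs_sub_comm, abs_of_pos (sub_pos.mpr hlt)] at h1
        have h2 : H z * (z - a) ^ (1 : ℤ) - β * ((‖z - a‖ ^ 2 : ℝ) : ℂ)
            = ((H z - (α * (z - a) + β * (starRingEnd ℂ) (z - a))) + α * (z - a)) * (z - a) := by
          have : ((‖z - a‖ ^ 2 : ℝ) : ℂ) = (starRingEnd ℂ) (z - a) * (z - a) := by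
            rw [mul_comm, Complex.mul_conj, Complex.normSq_eq_norm_sq]
          rw [this, zpow_one]
          ring
        have h3 := norm_add_le (H z - (α * (z - a) + β * (starRingEnd ℂ) (z - a))) (α * (z - a))
        rw [norm_mul α] at h3
        have hp := hsub z hz
        rw [h2, norm_mul, norm_mul, Complex.norm_real, Real.norm_of_nonneg (by positivity), sq,
          ← mul_assoc]
        refine mul_lt_mul_of_pos_right ?_ hp
        nlinarith
    · refine ⟨-1, HasLogOn.of_norm_sub_lt (c := α) ?_ fun z hz => ?_⟩
      · simp only [zpow_neg_one]
        exact hH.continuousOn.mul (ContinuousOn.inv₀ (by fun_prop)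
          fun z hz => norm_pos_iff.mp (hsub z hz))
      · have h1 := hball z hz.1
        rw [abs_of_pos (sub_pos.mpr hlt)] at h1
        have hp := hsub z hz
        have hz0 : z - a ≠ 0 := norm_pos_iff.mp hp
        have h2 : H z * (z - a) ^ (-1 : ℤ) - α
            = ((H z - (α * (z - a) + β * (starRingEnd ℂ) (z - a)))
              + β * (starRingEnd ℂ) (z - a)) / (z - a) := by
          rw [zpow_neg_one]
          field_simp
          ring
        have h3 := norm_add_le (H z - (α * (z - a) + β * (starRingEnd ℂ) (z - a)))
          (β * (starRingEnd ℂ) (z - a))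
        rw [norm_mul β, Complex.norm_conj] at h3
        rw [h2, norm_div, div_lt_iff₀ hp]
        nlinarith
  obtain ⟨m, hm⟩ := hlog
  refine ⟨⟨m, r, hr, hm⟩, ?_⟩
  rw [eventually_nhdsWithin_iff]
  filter_upwards [Metric.ball_mem_nhds a hr] with z hz hza
  exact left_ne_zero_of_mul (hm.ne_zero ⟨hz, hza⟩)

theorem hasLogOn_of_finite_zeros {K : Set ℂ} (hK : IsCompact K) {R : ℝ} (hR : 0 < R)
    (hKR : K ⊆ Metric.closedBall 0 R) (hKlog : ∀ a ∉ K, HasLogOn (fun z => z - a) K)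
    (Z : Finset ℂ) : ∀ H : ℂ → ℂ, Continuous H → (∀ z ∈ Metric.closedBall 0 R, H z = 0 → z ∈ Z) →
    (∀ a ∈ Z, a ∉ K) → (∀ a ∈ Z, HasLocalIndex H a) → HasLogOn H K := by
  classical
  induction Z using Finset.induction_on with
  | empty =>
    intro H hH hz _ _
    exact (hasLogOn_closedBall hR hH.continuousOn fun z hzR h0 => by simpa using hz z hzR h0).mono
      hKR
  | insert a Z haZ ih =>
    intro H hH hz hZK hloc
    have haK : a ∉ K := hZK a (Finset.mem_insert_self a Z)
    obtain ⟨m, r, hr, hlog⟩ := hloc a (Finset.mem_insert_self a Z)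
    obtain ⟨s, hs, hsr, hsK⟩ : ∃ s > 0, s < r ∧ Metric.closedBall a s ⊆ (K ∪ Z)ᶜ := by
      have ho : IsOpen ((K ∪ Z)ᶜ : Set ℂ) :=
        (hK.isClosed.union Z.finite_toSet.isClosed).isOpen_compl
      obtain ⟨s, hs, hsub⟩ := Metric.nhds_basis_closedBall.mem_iff.mp
        (ho.mem_nhds (x := a) (by simp [haK, haZ]))
      exact ⟨min s (r / 2), lt_min hs (half_pos hr), (min_le_right _ _).trans_lt (half_lt_self hr),
        (Metric.closedBall_subset_closedBall (min_le_left _ _)).trans hsub⟩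
    have hsphere : Metric.sphere a s ⊆ Metric.ball a r \ {a} := by
      intro z hz
      rw [Metric.mem_sphere] at hz
      refine ⟨by rw [Metric.mem_ball, hz]; exact hsr, ?_⟩
      rintro rfl
      rw [dist_self] at hz
      exact hs.ne hz
    obtain ⟨g, hg, hge⟩ := hlog
    obtain ⟨G, hG, hGg⟩ := exists_continuous_eqOn_of_isClosed Metric.isClosed_sphere
      (hg.mono hsphere)
    set H' : ℂ → ℂ := fun z => if z ∈ Metric.closedBall a s then Complex.exp (G z)
      else H z * (z - a) ^ m with hH'
    have hne : ∀ z ∉ Metric.closedBall a s, z - a ≠ 0 := fun z hz => by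
      rw [sub_ne_zero]
      rintro rfl
      exact hz (Metric.mem_closedBall_self hs.le)
    have hcont : Continuous H' := by
      refine continuous_piecewise_of_isClosed Metric.isClosed_closedBall
        (B := (Metric.ball a s)ᶜ) Metric.isOpen_ball.isClosed_compl ?_ hG.cexp.continuousOn
        (hH.continuousOn.mul (ContinuousOn.zpow₀ (by fun_prop) m fun z hz => Or.inl ?_)) ?_
      · exact eq_univ_of_forall fun z =>
          (em (z ∈ Metric.ball a s)).imp (fun h => Metric.ball_subset_closedBall h) id
      · rw [sub_ne_zero]
        rintro rfl
        exact hz (Metric.mem_ball_self hs)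
      · intro z hz
        have hzs : z ∈ Metric.sphere a s :=
          le_antisymm (Metric.mem_closedBall.mp hz.1) (not_lt.mp hz.2)
        rw [hGg hzs, hge z (hsphere hzs)]
        rfl
    have hfin := ih H' hcont ?_ (fun b hb => hZK b (Finset.mem_insert_of_mem hb)) ?_
    · have h2 : HasLogOn (fun z => H' z * ((z - a) ^ m)⁻¹) K :=
        hfin.mul ((hKlog a haK).zpow m).inv
      refine h2.congr fun z hzK => ?_
      have hzs : z ∉ Metric.closedBall a s := fun h => hsK h (Or.inl hzK)
      simp only [hH', if_neg hzs]
      exact mul_inv_cancel_right₀ (zpow_ne_zero _ (hne z hzs)) _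
    · intro z hzR h0
      by_cases hzs : z ∈ Metric.closedBall a s
      · simp only [hH', if_pos hzs] at h0
        exact absurd h0 (Complex.exp_ne_zero _)
      · simp only [hH', if_neg hzs] at h0
        have h1 := (mul_eq_zero.mp h0).resolve_right (zpow_ne_zero _ (hne z hzs))
        refine (Finset.mem_insert.mp (hz z hzR h1)).resolve_left ?_
        exact sub_ne_zero.mp (hne z hzs)
    · intro b hb
      obtain ⟨k, t, ht, hk⟩ := hloc b (Finset.mem_insert_of_mem hb)
      have hbs : s < dist b a := by
        by_contra! h
        exact hsK (Metric.mem_closedBall.mpr h) (Or.inr hb)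
      have hδ : 0 < (dist b a - s) / 2 := half_pos (sub_pos.mpr hbs)
      have hsub : Metric.ball b (min t ((dist b a - s) / 2)) \ {b} ⊆ Metric.ball b t \ {b} :=
        sdiff_subset_sdiff_left (Metric.ball_subset_ball (min_le_left _ _))
      have hsub2 : Metric.ball b (min t ((dist b a - s) / 2)) \ {b} ⊆
          Metric.closedBall b ((dist b a - s) / 2) :=
        sdiff_subset.trans ((Metric.ball_subset_ball (min_le_right _ _)).trans
          Metric.ball_subset_closedBall)
      have ha' : a ∉ Metric.closedBall b ((dist b a - s) / 2) := by
        rw [Metric.mem_closedBall, not_le, dist_comm]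
        have := dist_comm a b
        linarith
      refine ⟨k, _, lt_min ht hδ, ((hk.mono hsub).mul
        ((hasLogOn_sub_of_closedBall hsub2 ha').zpow m)).congr fun z hz => ?_⟩
      have hzs : z ∉ Metric.closedBall a s := by
        have h1 := Metric.mem_closedBall.mp (hsub2 hz)
        have h2 := dist_triangle b z a
        rw [Metric.mem_closedBall, not_le]
        rw [dist_comm b z] at h2
        linarith
      simp only [hH', if_neg hzs]
      ring

/-- Borsuk's theorem: if each `z - a` with `a ∉ K` has a logarithm on the compact set `K`, then so
does each nonvanishing continuous function. -/
theorem hasLogOn_of_compact {K : Set ℂ} (hK : IsCompact K)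
    (hKlog : ∀ a ∉ K, HasLogOn (fun z => z - a) K) {f : ℂ → ℂ} (hf : ContinuousOn f K)
    (h0 : ∀ z ∈ K, f z ≠ 0) : HasLogOn f K := by
  rcases K.eq_empty_or_nonempty with rfl | hne
  · exact ⟨f, hf, by simp⟩
  obtain ⟨z₀, hz₀, hmin⟩ := hK.exists_isMinOn hne hf.norm
  set δ := ‖f z₀‖ with hδ
  have hδ0 : 0 < δ := norm_pos_iff.mpr (h0 z₀ hz₀)
  have hle : ∀ z ∈ K, δ ≤ ‖f z‖ := fun z hz => hmin hz
  obtain ⟨F, hF, hFf⟩ := exists_continuous_eqOn_of_isClosed hK.isClosed hf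
  obtain ⟨G, hGs, hGF, -⟩ := hF.exists_contDiff_approx (F := ℂ) ⊤ (ε := fun _ => δ / 4)
    continuous_const (fun _ => by positivity)
  have hGd : Differentiable ℝ G := hGs.differentiable (by simp)
  have hsard : MeasureTheory.volume (G '' {z | (fderiv ℝ G z).det = 0}) = 0 :=
    MeasureTheory.addHaar_image_eq_zero_of_det_fderivWithin_eq_zero _
      (fun z _ => (hGd z).hasFDerivAt.hasFDerivWithinAt) fun z hz => hz
  obtain ⟨c, hcball, hc⟩ : ∃ c ∈ Metric.ball (0 : ℂ) (δ / 4),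
      c ∉ G '' {z | (fderiv ℝ G z).det = 0} := by
    by_contra! h
    have h1 := MeasureTheory.measure_mono_null h hsard
    exact (Metric.measure_ball_pos MeasureTheory.volume (0 : ℂ) (by positivity : 0 < δ / 4)).ne' h1
  have hc' : ‖c‖ < δ / 4 := mem_ball_zero_iff.mp hcball
  set H : ℂ → ℂ := fun z => G z - c with hH
  have hHc : Continuous H := hGd.continuous.sub continuous_const
  have hclose : ∀ z ∈ K, ‖f z - H z‖ < δ / 2 := fun z hz => by
    have h1 := hGF z
    rw [hFf hz, dist_comm, dist_eq_norm] at h1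
    have h2 : f z - H z = (f z - G z) + c := by simp only [hH]; ring
    have h3 := norm_add_le (f z - G z) c
    rw [h2]
    linarith
  have hHK : ∀ z ∈ K, δ / 2 < ‖H z‖ := fun z hz => by
    have h1 := hclose z hz
    have h2 := norm_sub_norm_le (f z) (H z)
    have h3 := hle z hz
    linarith
  suffices HasLogOn H K from this.of_close hf fun z hz => (hclose z hz).trans (hHK z hz)
  obtain ⟨R, hR0, hR⟩ := hK.isBounded.subset_closedBall_lt 0 0
  have hloc : ∀ a, H a = 0 → HasLocalIndex H a ∧ ∀ᶠ z in 𝓝[≠] a, H z ≠ 0 := fun a ha => by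
    refine hasLocalIndex_of_det_ne_zero hHc ((hGd a).hasFDerivAt.sub_const c) ha fun hdet => ?_
    exact hc ⟨a, hdet, sub_eq_zero.mp ha⟩
  have hZ : (Metric.closedBall (0 : ℂ) R ∩ H ⁻¹' {0}).Finite := by
    refine IsCompact.finite ((isCompact_closedBall 0 R).inter_right
      (isClosed_singleton.preimage hHc)) ?_
    refine IsDiscrete.of_nhdsWithin fun x hx => ?_
    rw [Filter.le_pure_iff, mem_nhdsWithin_iff_eventually]
    filter_upwards [eventually_nhdsWithin_iff.mp (hloc x hx.2).2] with z hz hzZ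
    by_contra hne
    exact hz hne hzZ.2
  refine hasLogOn_of_finite_zeros hK hR0 hR hKlog hZ.toFinset H hHc ?_ ?_ ?_
  · intro z hz h
    simpa using ⟨by simpa using hz, h⟩
  · intro a ha haK
    have h1 : H a = 0 := by simp at ha; exact ha.2
    have := hHK a haK
    rw [h1, norm_zero] at this
    linarith
  · intro a ha
    have h1 : H a = 0 := by simp at ha; exact ha.2
    exact (hloc a h1).1

/-- A nonvanishing continuous function on the circle is an integer power times an exponential. -/
theorem exists_hasLogOn_mul_zpow {F : Circle → ℂ} (hF : Continuous F) (h0 : ∀ u, F u ≠ 0) :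
    ∃ d : ℤ, HasLogOn (fun u : Circle => F u * (u : ℂ) ^ d) univ := by
  obtain ⟨g, hg, hge⟩ := hasLogOn_univ (f := fun z : ℂ => F (Circle.exp z.re))
    (by fun_prop) fun z => h0 _
  have hgc : Continuous g := continuousOn_univ.mp hg
  have hexp : ∀ t : ℝ, Complex.exp (g t) = F (Circle.exp t) := fun t => by
    simpa using hge t trivial
  obtain ⟨n, hn⟩ := exists_int_of_exp_eq (S := (univ : Set ℝ)) isPreconnected_univ
    (g := fun t : ℝ => g ((t + 2 * Real.pi : ℝ) : ℂ)) (k := fun t : ℝ => g t)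
    (by fun_prop) (by fun_prop) fun t _ => by
      rw [hexp, hexp, Circle.periodic_exp t]
  set k : ℝ → ℂ := fun t => g t - n * t * Complex.I with hk
  have hper : Function.Periodic k (2 * Real.pi) := fun t => by
    simp only [hk, hn t trivial]
    push_cast
    ring
  have hdesc : ∀ t : ℝ, k (Complex.arg (Circle.exp t)) = k t := fun t => by
    have : Circle.exp (Complex.arg (Circle.exp t)) = Circle.exp t := Circle.exp_arg _
    obtain ⟨m, hm⟩ := Circle.exp_eq_exp.mp this
    rw [hm]
    exact hper.int_mul m t
  refine ⟨-n, fun u => k (Complex.arg u), ?_, fun u _ => ?_⟩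
  · rw [continuousOn_univ, (Circle.isCoveringMap_exp.isQuotientMap
      fun u => ⟨Complex.arg u, Circle.exp_arg u⟩).continuous_iff]
    have : (fun u : Circle => k (Complex.arg u)) ∘ Circle.exp = k := funext hdesc
    rw [this]
    fun_prop
  · simp only [hk]
    rw [sub_eq_add_neg, Complex.exp_add, hexp, Circle.exp_arg]
    congr 1
    have h2 : (u : ℂ) = Complex.exp (Complex.arg u * Complex.I) := by
      rw [← Circle.coe_exp, Circle.exp_arg]
    conv_rhs => rw [h2, ← Complex.exp_int_mul]
    congr 1
    push_cast
    ring

theorem exists_zpow_mul_zpow_hasLogOn {f h : Circle → ℂ} (hf : Continuous f) (hh : Continuous h)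
    (hf0 : ∀ u, f u ≠ 0) (hh0 : ∀ u, h u ≠ 0) :
    ∃ m n : ℤ, (m ≠ 0 ∨ n ≠ 0) ∧ HasLogOn (fun u => f u ^ m * h u ^ n) univ := by
  obtain ⟨d, hd⟩ := exists_hasLogOn_mul_zpow hf hf0
  obtain ⟨d', hd'⟩ := exists_hasLogOn_mul_zpow hh hh0
  by_cases h0 : d = 0
  · subst h0
    exact ⟨1, 0, Or.inl one_ne_zero, hd.congr fun u _ => by simp⟩
  · refine ⟨d', -d, Or.inr (neg_ne_zero.mpr h0), ((hd.zpow d').mul (hd'.zpow (-d))).congr ?_⟩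
    intro u _
    have hu : (u : ℂ) ≠ 0 := Circle.coe_ne_zero u
    simp only [mul_zpow, ← zpow_mul]
    have : ((u : ℂ) ^ (d * d')) * (u : ℂ) ^ (d' * -d) = 1 := by
      rw [← zpow_add₀ hu, show d * d' + d' * -d = 0 by ring, zpow_zero]
    linear_combination (f u ^ d' * h u ^ (-d)) * this

theorem not_hasLogOn_circle_coe : ¬ HasLogOn (fun u : Circle => (u : ℂ)) univ := by
  intro h
  obtain ⟨g, hg, hge⟩ := h
  have hc : IsClosedEmbedding (fun u : Circle => (u : ℂ)) :=
    Continuous.isClosedEmbedding (by fun_prop) Circle.coe_injective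
  obtain ⟨G, hG⟩ := ContinuousMap.exists_extension hc ⟨g, continuousOn_univ.mp hg⟩
  have : HasLogOn (fun z : ℂ => (z - 0) ^ (1 : ℤ)) (Metric.sphere 0 1) := by
    refine ⟨G, G.continuous.continuousOn, fun z hz => ?_⟩
    have hz1 : ‖z‖ = 1 := by simpa using hz
    obtain ⟨u, rfl⟩ : ∃ u : Circle, (u : ℂ) = z := ⟨⟨z, mem_sphere_zero_iff_norm.mpr hz1⟩, rfl⟩
    have h1 : G u = g u := DFunLike.congr_fun hG u
    rw [h1, hge _ trivial]
    simp
  exact one_ne_zero (not_hasLogOn_zpow_sphere one_pos this)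

/-- The union of the bounded components of the complement of `J`. -/
def inside (J : Set ℂ) : Set ℂ := {z | z ∉ J ∧ Bornology.IsBounded (connectedComponentIn Jᶜ z)}

/-- The union of the unbounded components of the complement of `J`. -/
def outside (J : Set ℂ) : Set ℂ := {z | z ∉ J ∧ ¬ Bornology.IsBounded (connectedComponentIn Jᶜ z)}

/-- `J` is a Jordan curve. -/
def IsJordanCurve (J : Set ℂ) : Prop :=
  ∃ e : Circle → ℂ, Continuous e ∧ Function.Injective e ∧ range e = J

namespace IsJordanCurve

variable {J : Set ℂ}

theorem isCompact (hJ : IsJordanCurve J) : IsCompact J := by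
  obtain ⟨e, he, -, rfl⟩ := hJ
  exact isCompact_range he

theorem isConnected (hJ : IsJordanCurve J) : IsConnected J := by
  obtain ⟨e, he, -, rfl⟩ := hJ
  have : IsConnected (univ : Set Circle) := by
    have h := (isConnected_univ (α := ℝ)).image Circle.exp (by fun_prop)
    rwa [image_univ, Function.Surjective.range_eq
      fun u : Circle => ⟨Complex.arg u, Circle.exp_arg u⟩] at h
  rw [← image_univ]
  exact this.image _ he.continuousOn

theorem inside_nonempty (hJ : IsJordanCurve J) : (inside J).Nonempty := by
  by_contra hne
  rw [not_nonempty_iff_eq_empty, eq_empty_iff_forall_notMem] at hne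
  have hc := hJ.isCompact
  obtain ⟨e, he, hinj, rfl⟩ := hJ
  obtain ⟨G, hG⟩ := ContinuousMap.exists_extension (he.isClosedEmbedding hinj)
    ⟨fun u : Circle => (u : ℂ), by fun_prop⟩
  have hGe : ∀ u : Circle, G (e u) = u := fun u => DFunLike.congr_fun hG u
  have hlog := hasLogOn_of_compact hc
    (fun a ha => (hasLogOn_sub_iff hc ha).mpr fun h => hne a ⟨ha, h⟩)
    (f := G) G.continuous.continuousOn (by
      rintro _ ⟨u, rfl⟩
      rw [hGe]
      exact Circle.coe_ne_zero u)
  exact not_hasLogOn_circle_coe ((hlog.comp he.continuousOn (M := univ)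
    fun u _ => mem_range_self u).congr fun u _ => hGe u)

theorem connectedComponentIn_eq_of_mem_inside (hJ : IsJordanCurve J) {a b : ℂ} (ha : a ∈ inside J)
    (hb : b ∈ inside J) : connectedComponentIn Jᶜ a = connectedComponentIn Jᶜ b := by
  by_contra hne
  have hcl := hJ.isCompact.isClosed
  obtain ⟨e, he, hinj, rfl⟩ := hJ
  obtain ⟨m, n, hmn, g, hg, hge⟩ := exists_zpow_mul_zpow_hasLogOn (f := fun u => e u - a)
    (h := fun u => e u - b) (by fun_prop) (by fun_prop)
    (fun u h => ha.1 ⟨u, sub_eq_zero.mp h⟩) (fun u h => hb.1 ⟨u, sub_eq_zero.mp h⟩)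
  obtain ⟨G, hG⟩ := ContinuousMap.exists_extension (he.isClosedEmbedding hinj)
    ⟨g, continuousOn_univ.mp hg⟩
  have hlog : HasLogOn (fun z => (z - a) ^ m * (z - b) ^ n) (range e) := by
    refine ⟨G, G.continuous.continuousOn, ?_⟩
    rintro _ ⟨u, rfl⟩
    have h1 : G (e u) = g u := DFunLike.congr_fun hG u
    rw [h1, hge u trivial]
  have key : ∀ a b : ℂ, a ∈ inside (range e) → b ∈ inside (range e) →
      connectedComponentIn (range e)ᶜ a ≠ connectedComponentIn (range e)ᶜ b →
      ∀ m n : ℤ, HasLogOn (fun z => (z - a) ^ m * (z - b) ^ n) (range e) → m = 0 := by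
    intro a b ha hb hne m n hlog
    have h0 : ∀ z ∈ closure (connectedComponentIn (range e)ᶜ a), z - b ≠ 0 := fun z hz => by
      rw [sub_ne_zero]
      rintro rfl
      exact (closure_connectedComponentIn_subset hcl a hz).elim
        (fun h => hne (connectedComponentIn_eq h)) hb.1
    exact eq_zero_of_hasLogOn_of_bounded hcl ha.1 ha.2 (q := fun z => (z - b) ^ n)
      (ContinuousOn.zpow₀ (by fun_prop) n fun z hz => Or.inl (h0 z hz))
      (fun z hz => zpow_ne_zero _ (h0 z hz)) hlog
  rcases hmn with h | h
  · exact h (key a b ha hb hne m n hlog)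
  · exact h (key b a hb ha (Ne.symm hne) n m (hlog.congr fun z _ => mul_comm _ _))

theorem inside_eq (hJ : IsJordanCurve J) {a : ℂ} (ha : a ∈ inside J) :
    connectedComponentIn Jᶜ a = inside J := by
  ext z
  constructor
  · intro hz
    refine ⟨connectedComponentIn_subset _ _ hz, ?_⟩
    rw [← connectedComponentIn_eq hz]
    exact ha.2
  · intro hz
    rw [hJ.connectedComponentIn_eq_of_mem_inside ha hz]
    exact mem_connectedComponentIn hz.1

theorem outside_eq (hJ : IsJordanCurve J) {a : ℂ} (ha : a ∈ outside J) :
    connectedComponentIn Jᶜ a = outside J := by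
  ext z
  constructor
  · intro hz
    refine ⟨connectedComponentIn_subset _ _ hz, ?_⟩
    rw [← connectedComponentIn_eq hz]
    exact ha.2
  · intro hz
    rw [connectedComponentIn_eq_of_not_isBounded hJ.isCompact ha.2 hz.2]
    exact mem_connectedComponentIn hz.1

theorem mem_outside_of_closedBall (hJ : IsJordanCurve J) {c a : ℂ} {R : ℝ}
    (hR : J ⊆ Metric.closedBall c R) (ha : a ∉ Metric.closedBall c R) : a ∈ outside J :=
  ⟨fun h => ha (hR h), (hasLogOn_sub_iff hJ.isCompact fun h => ha (hR h)).mp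
    (hasLogOn_sub_of_closedBall hR ha)⟩

theorem exists_mem_outside (hJ : IsJordanCurve J) : (outside J).Nonempty := by
  obtain ⟨R, hR⟩ := hJ.isCompact.isBounded.subset_closedBall 0
  obtain ⟨a, ha⟩ := NormedSpace.exists_lt_norm ℝ ℂ R
  exact ⟨a, hJ.mem_outside_of_closedBall hR (by simpa using ha)⟩

theorem isOpen_inside (hJ : IsJordanCurve J) : IsOpen (inside J) := by
  obtain ⟨a, ha⟩ := hJ.inside_nonempty
  rw [← hJ.inside_eq ha]
  exact hJ.isCompact.isClosed.isOpen_compl.connectedComponentIn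

theorem isOpen_outside (hJ : IsJordanCurve J) : IsOpen (outside J) := by
  obtain ⟨a, ha⟩ := hJ.exists_mem_outside
  rw [← hJ.outside_eq ha]
  exact hJ.isCompact.isClosed.isOpen_compl.connectedComponentIn

theorem isPreconnected_inside (hJ : IsJordanCurve J) : IsPreconnected (inside J) := by
  obtain ⟨a, ha⟩ := hJ.inside_nonempty
  rw [← hJ.inside_eq ha]
  exact isPreconnected_connectedComponentIn

theorem isPreconnected_outside (hJ : IsJordanCurve J) : IsPreconnected (outside J) := by
  obtain ⟨a, ha⟩ := hJ.exists_mem_outside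
  rw [← hJ.outside_eq ha]
  exact isPreconnected_connectedComponentIn

theorem isBounded_inside (hJ : IsJordanCurve J) : Bornology.IsBounded (inside J) := by
  obtain ⟨a, ha⟩ := hJ.inside_nonempty
  rw [← hJ.inside_eq ha]
  exact ha.2

theorem not_isBounded_outside (hJ : IsJordanCurve J) : ¬ Bornology.IsBounded (outside J) := by
  obtain ⟨a, ha⟩ := hJ.exists_mem_outside
  rw [← hJ.outside_eq ha]
  exact ha.2

theorem disjoint_inside_outside : Disjoint (inside J) (outside J) :=
  disjoint_left.mpr fun _ h1 h2 => h2.2 h1.2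

theorem inside_union_outside : inside J ∪ outside J = Jᶜ := by
  ext z
  simp only [inside, outside, mem_union, mem_ofPred_eq, mem_compl_iff]
  tauto

theorem closure_inside_subset (hJ : IsJordanCurve J) : closure (inside J) ⊆ inside J ∪ J := by
  obtain ⟨a, ha⟩ := hJ.inside_nonempty
  rw [← hJ.inside_eq ha]
  exact closure_connectedComponentIn_subset hJ.isCompact.isClosed a

theorem closure_outside_subset (hJ : IsJordanCurve J) : closure (outside J) ⊆ outside J ∪ J := by
  obtain ⟨a, ha⟩ := hJ.exists_mem_outside
  rw [← hJ.outside_eq ha]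
  exact closure_connectedComponentIn_subset hJ.isCompact.isClosed a

theorem exists_mem_closure_outside (hJ : IsJordanCurve J) : (closure (outside J) ∩ J).Nonempty := by
  by_contra hne
  rw [not_nonempty_iff_eq_empty] at hne
  have hcl : IsClosed (outside J) := by
    refine isClosed_of_closure_subset fun z hz => (hJ.closure_outside_subset hz).resolve_right ?_
    exact fun h => eq_empty_iff_forall_notMem.mp hne z ⟨hz, h⟩
  have h1 := IsClopen.eq_univ ⟨hcl, hJ.isOpen_outside⟩ hJ.exists_mem_outside
  obtain ⟨z, hz⟩ := hJ.isConnected.nonempty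
  exact (h1 ▸ mem_univ z : z ∈ outside J).1 hz

theorem compl_inside (hJ : IsJordanCurve J) : (inside J)ᶜ = closure (outside J) ∪ J := by
  ext z
  constructor
  · intro hz
    by_cases hzJ : z ∈ J
    · exact Or.inr hzJ
    · exact Or.inl (subset_closure ⟨hzJ, fun h => hz ⟨hzJ, h⟩⟩)
  · rintro (h | h) hz
    · exact (hJ.closure_outside_subset h).elim (fun h => h.2 hz.2) hz.1
    · exact hz.1 h

theorem isPreconnected_compl_inside (hJ : IsJordanCurve J) : IsPreconnected (inside J)ᶜ := by
  rw [hJ.compl_inside]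
  obtain ⟨z, h1, h2⟩ := hJ.exists_mem_closure_outside
  exact IsPreconnected.union z h1 h2 hJ.isPreconnected_outside.closure
    hJ.isConnected.isPreconnected

theorem hasLogOn_of_isCompact_subset_inside (hJ : IsJordanCurve J) {f : ℂ → ℂ}
    (hf : ContinuousOn f (inside J)) (h0 : ∀ z ∈ inside J, f z ≠ 0) {K : Set ℂ}
    (hK : IsCompact K) (hKJ : K ⊆ inside J) : HasLogOn f K := by
  obtain ⟨v, hv⟩ := hJ.exists_mem_outside
  have hvi : v ∈ (inside J)ᶜ := fun h => hv.2 h.2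
  set W := connectedComponentIn Kᶜ v with hW
  have hsub : (inside J)ᶜ ⊆ W := hJ.isPreconnected_compl_inside.subset_connectedComponentIn hvi
    (compl_subset_compl.mpr hKJ)
  have hWo : IsOpen W := hK.isClosed.isOpen_compl.connectedComponentIn
  have hWi : Wᶜ ⊆ inside J := compl_subset_comm.mp hsub
  have hWc : IsCompact Wᶜ :=
    Metric.isCompact_of_isClosed_isBounded hWo.isClosed_compl (hJ.isBounded_inside.subset hWi)
  have hWb : ¬ Bornology.IsBounded W := fun h =>
    hJ.not_isBounded_outside (h.subset fun z hz => hsub fun h => hz.2 h.2)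
  refine (hasLogOn_of_compact hWc (fun a ha => ?_) (hf.mono hWi) fun z hz => h0 z (hWi hz)).mono
    fun z hz hzW => connectedComponentIn_subset _ _ hzW hz
  rw [hasLogOn_sub_iff hWc ha, compl_compl]
  rw [mem_compl_iff, not_not] at ha
  rwa [isPreconnected_connectedComponentIn.connectedComponentIn ha]

end IsJordanCurve

theorem hasLogOn_of_forall_isCompact {Ω : Set ℂ} (hΩ : IsOpen Ω) (hc : IsConnected Ω) {f : ℂ → ℂ}
    (h : ∀ K ⊆ Ω, IsCompact K → HasLogOn f K) : HasLogOn f Ω := by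
  obtain ⟨z₀, hz₀⟩ := hc.nonempty
  have hpc : IsPathConnected Ω := hΩ.isConnected_iff_isPathConnected.mp hc
  have hf0 : f z₀ ≠ 0 :=
    (h {z₀} (singleton_subset_iff.mpr hz₀) isCompact_singleton).ne_zero (mem_singleton z₀)
  set c := Complex.log (f z₀) with hc'
  have hce : Complex.exp c = f z₀ := Complex.exp_log hf0
  have hnorm : ∀ K ⊆ Ω, IsCompact K → z₀ ∈ K → ∃ g : ℂ → ℂ, ContinuousOn g K ∧
      (∀ z ∈ K, Complex.exp (g z) = f z) ∧ g z₀ = c := by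
    intro K hK hKc hzK
    obtain ⟨g, hg, hge⟩ := h K hK hKc
    refine ⟨fun z => g z + (c - g z₀), hg.add continuousOn_const, fun z hz => ?_, by ring⟩
    rw [Complex.exp_add, Complex.exp_sub, hce, hge _ hzK, hge z hz, div_self hf0, mul_one]
  have huniq : ∀ K : Set ℂ, IsPreconnected K → z₀ ∈ K → ∀ g k : ℂ → ℂ, ContinuousOn g K →
      ContinuousOn k K → (∀ z ∈ K, Complex.exp (g z) = f z) →
      (∀ z ∈ K, Complex.exp (k z) = f z) → g z₀ = c → k z₀ = c → ∀ z ∈ K, g z = k z := by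
    intro K hK hzK g k hg hk hge hke hgc hkc z hz
    obtain ⟨n, hn⟩ := exists_int_of_exp_eq hK hg hk fun z hz => by rw [hge z hz, hke z hz]
    have h1 := hn z₀ hzK
    rw [hgc, hkc, left_eq_add, mul_eq_zero, or_iff_left Complex.two_pi_I_ne_zero] at h1
    rw [hn z hz, h1, zero_mul, add_zero]
  have hex : ∀ z ∈ Ω, ∃ K ⊆ Ω, IsCompact K ∧ IsPreconnected K ∧ z₀ ∈ K ∧ z ∈ K := by
    intro z hz
    obtain ⟨γ, hγ⟩ := hpc.joinedIn z₀ hz₀ z hz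
    exact ⟨range γ, range_subset_iff.mpr hγ, isCompact_range γ.continuous,
      isPreconnected_range γ.continuous, ⟨0, γ.source⟩, ⟨1, γ.target⟩⟩
  choose! K hKΩ hKc hKp hKz₀ hKz using hex
  choose! g hg hge hgc using fun z hz => hnorm (K z) (hKΩ z hz) (hKc z hz) (hKz₀ z hz)
  have hloc : ∀ z ∈ Ω, ∃ ε > 0, ∃ G : ℂ → ℂ, ContinuousOn G (Metric.closedBall z ε) ∧
      ∀ w ∈ Metric.closedBall z ε, w ∈ Ω ∧ g w w = G w := by
    intro z hz
    obtain ⟨ε, hε, hball⟩ := Metric.nhds_basis_closedBall.mem_iff.mp (hΩ.mem_nhds hz)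
    have hKB : IsPreconnected (K z ∪ Metric.closedBall z ε) :=
      IsPreconnected.union z (hKz z hz) (Metric.mem_closedBall_self hε.le) (hKp z hz)
        (convex_closedBall z ε).isPreconnected
    obtain ⟨G, hG, hGe, hGc⟩ := hnorm (K z ∪ Metric.closedBall z ε)
      (union_subset (hKΩ z hz) hball) ((hKc z hz).union (isCompact_closedBall z ε))
      (Or.inl (hKz₀ z hz))
    refine ⟨ε, hε, G, hG.mono subset_union_right, fun w hw => ⟨hball hw, ?_⟩⟩
    have hwΩ := hball hw
    obtain ⟨G', hG', hGe', hGc'⟩ := hnorm (K w ∪ (K z ∪ Metric.closedBall z ε))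
      (union_subset (hKΩ w hwΩ) (union_subset (hKΩ z hz) hball))
      ((hKc w hwΩ).union ((hKc z hz).union (isCompact_closedBall z ε))) (Or.inl (hKz₀ w hwΩ))
    rw [huniq (K w) (hKp w hwΩ) (hKz₀ w hwΩ) (g w) G' (hg w hwΩ) (hG'.mono subset_union_left)
      (hge w hwΩ) (fun x hx => hGe' x (Or.inl hx)) (hgc w hwΩ) hGc' w (hKz w hwΩ)]
    exact huniq _ hKB (Or.inl (hKz₀ z hz)) G' G (hG'.mono subset_union_right) hG
      (fun x hx => hGe' x (Or.inr hx)) hGe hGc' hGc w (Or.inr hw)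
  refine ⟨fun z => g z z, fun z hz => ?_, fun z hz => hge z hz z (hKz z hz)⟩
  obtain ⟨ε, hε, G, hG, hGw⟩ := hloc z hz
  have hmem : Metric.closedBall z ε ∈ 𝓝 z := Metric.closedBall_mem_nhds z hε
  refine ContinuousAt.continuousWithinAt ?_
  refine (hG.continuousAt hmem).congr ?_
  filter_upwards [hmem] with w hw using (hGw w hw).2.symm

theorem IsJordanCurve.hasLogOn_inside {J : Set ℂ} (hJ : IsJordanCurve J) {f : ℂ → ℂ}
    (hf : ContinuousOn f (inside J)) (h0 : ∀ z ∈ inside J, f z ≠ 0) : HasLogOn f (inside J) :=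
  hasLogOn_of_forall_isCompact hJ.isOpen_inside ⟨hJ.inside_nonempty, hJ.isPreconnected_inside⟩
    fun _ hK hKc => hJ.hasLogOn_of_isCompact_subset_inside hf h0 hKc hK

theorem dist_le_of_mapsTo_unit_ball {Ω : Set ℂ} {f : ℂ → ℂ} (hf : DifferentiableOn ℂ f Ω)
    (hm : MapsTo f Ω (Metric.ball 0 1)) {z : ℂ} {r : ℝ}
    (hz : Metric.ball z r ⊆ Ω) {w : ℂ} (hw : w ∈ Metric.ball z r) :
    dist (f w) (f z) ≤ 2 / r * dist w z := by
  have hr : 0 < r := Metric.pos_of_mem_ball hw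
  refine Complex.dist_le_div_mul_dist_of_mapsTo_ball (hf.mono hz) (fun x hx => ?_) hw
  have h1 := mem_ball_zero_iff.mp (hm (hz hx))
  have h2 := mem_ball_zero_iff.mp (hm (hz (Metric.mem_ball_self hr)))
  rw [Metric.mem_closedBall, dist_eq_norm]
  linarith [norm_sub_le (f x) (f z)]

/-- Montel's theorem, for a limit along an ultrafilter. -/
theorem exists_tendstoLocallyUniformlyOn {Ω : Set ℂ} (hΩ : IsOpen Ω) {F : ℕ → ℂ → ℂ}
    (hF : ∀ n, DifferentiableOn ℂ (F n) Ω) (hm : ∀ n, MapsTo (F n) Ω (Metric.ball 0 1))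
    (𝒰 : Ultrafilter ℕ) : ∃ f : ℂ → ℂ, TendstoLocallyUniformlyOn F f 𝒰 Ω := by
  have hlim : ∀ z ∈ Ω, ∃ w, Filter.Tendsto (fun n => F n z) 𝒰 (𝓝 w) := by
    intro z hz
    have hle : ((𝒰.map fun n => F n z : Ultrafilter ℂ) : Filter ℂ)
        ≤ Filter.principal (Metric.closedBall 0 1) := by
      rw [Filter.le_principal_iff]
      exact Filter.Eventually.of_forall (f := (𝒰 : Filter ℕ))
        fun n => Metric.ball_subset_closedBall (hm n hz)
    obtain ⟨w, -, hw⟩ := (isCompact_closedBall (0 : ℂ) 1).ultrafilter_le_nhds _ hle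
    exact ⟨w, hw⟩
  choose! f hf using hlim
  refine ⟨f, ?_⟩
  rw [Metric.tendstoLocallyUniformlyOn_iff]
  intro ε hε z hz
  obtain ⟨r, hr, hball⟩ := Metric.isOpen_iff.mp hΩ z hz
  have hfd : ∀ w ∈ Metric.ball z r, dist (f w) (f z) ≤ 2 / r * dist w z := fun w hw =>
    le_of_tendsto ((hf w (hball hw)).dist (hf z hz))
      (Filter.Eventually.of_forall fun n => dist_le_of_mapsTo_unit_ball (hF n) (hm n) hball hw)
  refine ⟨Metric.ball z (min r (ε * r / 6)), mem_nhdsWithin_of_mem_nhds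
    (Metric.ball_mem_nhds z (lt_min hr (by positivity))), ?_⟩
  filter_upwards [Metric.tendsto_nhds.mp (hf z hz) (ε / 3) (by positivity)] with n hn w hw
  have hw1 : w ∈ Metric.ball z r := Metric.ball_subset_ball (min_le_left _ _) hw
  have hw2 : dist w z < ε * r / 6 := (Metric.mem_ball.mp hw).trans_le (min_le_right _ _)
  have h1 := hfd w hw1
  have h2 := dist_le_of_mapsTo_unit_ball (hF n) (hm n) hball hw1
  have h3 : 2 / r * dist w z < ε / 3 := by
    rw [div_mul_eq_mul_div, div_lt_iff₀ hr]
    linarith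
  have h4 := dist_triangle4 (f w) (f z) (F n z) (F n w)
  rw [dist_comm (f z), dist_comm (F n z) (F n w)] at h4
  linarith

/-- Hurwitz's theorem for injective functions. -/
theorem injOn_of_tendstoLocallyUniformlyOn {Ω : Set ℂ} (hΩ : IsOpen Ω) (hc : IsPreconnected Ω)
    {ι : Type*} {φ : Filter ι} [φ.NeBot] {F : ι → ℂ → ℂ} {f : ℂ → ℂ}
    (hF : ∀ n, DifferentiableOn ℂ (F n) Ω) (hinj : ∀ n, InjOn (F n) Ω)
    (hlim : TendstoLocallyUniformlyOn F f φ Ω) {z₀ : ℂ} (hz₀ : z₀ ∈ Ω) (hd : deriv f z₀ ≠ 0) :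
    InjOn f Ω := by
  have hf : DifferentiableOn ℂ f Ω :=
    hlim.differentiableOn (Filter.Eventually.of_forall hF) hΩ
  have hfa : AnalyticOnNhd ℂ f Ω := hf.analyticOnNhd hΩ
  have hiso : ∀ a ∈ Ω, ∀ᶠ z in 𝓝[≠] a, f z ≠ f a := by
    intro a ha
    refine ((hfa a ha).eventually_eq_or_eventually_ne analyticAt_const).resolve_left fun h => hd ?_
    have h1 := hfa.eqOn_of_preconnected_of_eventuallyEq analyticOnNhd_const hc ha h
    have h2 : f =ᶠ[𝓝 z₀] fun _ => f a := by
      filter_upwards [hΩ.mem_nhds hz₀] with z hz using h1 hz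
    rw [h2.deriv_eq, deriv_const]
  have key : ∀ a ∈ Ω, ∀ ρ > 0, ∃ r, 0 < r ∧ r < ρ ∧
      ∀ᶠ n in φ, f a ∈ F n '' Metric.closedBall a r ∧ Metric.closedBall a r ⊆ Ω := by
    intro a ha ρ hρ
    obtain ⟨s, hs, hsub⟩ : ∃ s > 0, ∀ z ∈ Metric.ball a s, z ∈ Ω ∧ (z ≠ a → f z ≠ f a) := by
      have := (hΩ.eventually_mem ha).and (eventually_nhdsWithin_iff.mp (hiso a ha))
      exact Metric.eventually_nhds_iff_ball.mp this
    set r := min s ρ / 2 with hr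
    have hr0 : 0 < r := half_pos (lt_min hs hρ)
    have hrs : r < s := (half_lt_self (lt_min hs hρ)).trans_le (min_le_left _ _)
    have hcb : Metric.closedBall a r ⊆ Metric.ball a s := Metric.closedBall_subset_ball hrs
    have hcbΩ : Metric.closedBall a r ⊆ Ω := fun z hz => (hsub z (hcb hz)).1
    obtain ⟨w, hw, hmin⟩ := (isCompact_sphere a r).exists_isMinOn
      (NormedSpace.sphere_nonempty.mpr hr0.le) (f := fun z => ‖f z - f a‖)
      (((hf.continuousOn.mono (Metric.sphere_subset_closedBall.trans hcbΩ)).sub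
        continuousOn_const).norm)
    set ε := ‖f w - f a‖ with hε
    have hwa : w ≠ a := by
      rintro rfl
      rw [Metric.mem_sphere, dist_self] at hw
      exact hr0.ne hw
    have hε0 : 0 < ε := norm_pos_iff.mpr (sub_ne_zero.mpr
      ((hsub w (hcb (Metric.sphere_subset_closedBall hw))).2 hwa))
    refine ⟨r, hr0, (half_lt_self (lt_min hs hρ)).trans_le (min_le_right _ _), ?_⟩
    have hunif := (tendstoLocallyUniformlyOn_iff_forall_isCompact hΩ).mp hlim _ hcbΩ
      (isCompact_closedBall a r)
    filter_upwards [Metric.tendstoUniformlyOn_iff.mp hunif (ε / 8) (by positivity)] with n hn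
    refine ⟨?_, hcbΩ⟩
    have haB := Metric.mem_closedBall_self (x := a) hr0.le
    refine DiffContOnCl.ball_subset_image_closedBall (ε := ε / 2) (f := F n) (z₀ := a) ?_ hr0
      ?_ ?_ ?_
    · exact ((hF n).mono (closure_minimal Metric.ball_subset_closedBall
        Metric.isClosed_closedBall |>.trans hcbΩ)).diffContOnCl
    · intro z hz
      have h1 : ε ≤ ‖f z - f a‖ := hmin hz
      have h2 := hn z (Metric.sphere_subset_closedBall hz)
      have h3 := hn a haB
      have h4 := dist_triangle4 (f z) (F n z) (F n a) (f a)
      rw [← dist_eq_norm] at h1 ⊢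
      rw [dist_comm] at h3
      linarith
    · refine Filter.Eventually.frequently (f := 𝓝[≠] a) ?_ |>.filter_mono nhdsWithin_le_nhds
      filter_upwards [self_mem_nhdsWithin, nhdsWithin_le_nhds (hΩ.mem_nhds ha)] with z hza hzΩ h
      exact hza (hinj n hzΩ ha h)
    · rw [Metric.mem_ball]
      linarith [hn a haB]
  intro a ha b hb hab
  by_contra hne
  have hpos := dist_pos.mpr hne
  obtain ⟨r, hr, hr2, h1⟩ := key a ha (dist a b / 2) (half_pos hpos)
  obtain ⟨s, hs, hs2, h2⟩ := key b hb (dist a b / 2) (half_pos hpos)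
  obtain ⟨n, ⟨⟨x, hx, hxa⟩, hxΩ⟩, ⟨⟨y, hy, hyb⟩, hyΩ⟩⟩ := (h1.and h2).exists
  have hxy : x = y := hinj n (hxΩ hx) (hyΩ hy) (by rw [hxa, hyb, hab])
  subst hxy
  have h3 := dist_triangle a x b
  rw [Metric.mem_closedBall] at hx hy
  rw [dist_comm] at hx
  linarith

/-- The disc automorphism vanishing at `a`. -/
noncomputable def discAut (a z : ℂ) : ℂ := (z - a) / (1 - (starRingEnd ℂ) a * z)

theorem discAut_denom_ne_zero {a z : ℂ} (ha : ‖a‖ < 1) (hz : ‖z‖ < 1) :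
    1 - (starRingEnd ℂ) a * z ≠ 0 := by
  intro h
  have h1 : ‖(starRingEnd ℂ) a * z‖ = 1 := by rw [← sub_eq_zero.mp h, norm_one]
  rw [norm_mul, Complex.norm_conj] at h1
  nlinarith [norm_nonneg a, norm_nonneg z]

theorem norm_discAut_lt_one {a z : ℂ} (ha : ‖a‖ < 1) (hz : ‖z‖ < 1) : ‖discAut a z‖ < 1 := by
  rw [discAut, norm_div, div_lt_one (norm_pos_iff.mpr (discAut_denom_ne_zero ha hz))]
  have h1 : ‖z - a‖ ^ 2 < ‖1 - (starRingEnd ℂ) a * z‖ ^ 2 := by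
    have ha2 : ‖a‖ ^ 2 < 1 := by nlinarith [norm_nonneg a]
    have hz2 : ‖z‖ ^ 2 < 1 := by nlinarith [norm_nonneg z]
    rw [← Complex.normSq_eq_norm_sq, Complex.normSq_apply] at ha2 hz2 ⊢
    rw [← Complex.normSq_eq_norm_sq, Complex.normSq_apply]
    simp
    nlinarith
  exact lt_of_pow_lt_pow_left₀ 2 (norm_nonneg _) h1

theorem discAut_injOn {a : ℂ} (ha : ‖a‖ < 1) : InjOn (discAut a) (Metric.ball 0 1) := by
  intro z hz w hw h
  rw [mem_ball_zero_iff] at hz hw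
  rw [discAut, discAut, div_eq_div_iff (discAut_denom_ne_zero ha hz)
    (discAut_denom_ne_zero ha hw)] at h
  have h1 : (z - w) * (1 - (starRingEnd ℂ) a * a) = 0 := by linear_combination h
  exact sub_eq_zero.mp ((mul_eq_zero.mp h1).resolve_right (discAut_denom_ne_zero ha ha))

theorem hasDerivAt_discAut {a z : ℂ} (ha : ‖a‖ < 1) (hz : ‖z‖ < 1) :
    HasDerivAt (discAut a) ((1 - ‖a‖ ^ 2) / (1 - (starRingEnd ℂ) a * z) ^ 2) z := by
  have h := ((hasDerivAt_id z).sub_const a).div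
    (((hasDerivAt_id z).const_mul ((starRingEnd ℂ) a)).const_sub 1) (discAut_denom_ne_zero ha hz)
  refine h.congr_deriv ?_
  have h2 : (starRingEnd ℂ) a * a = (‖a‖ : ℂ) ^ 2 := by
    rw [mul_comm, Complex.mul_conj, Complex.normSq_eq_norm_sq]
    push_cast
    rfl
  congr 1
  simp only [id]
  linear_combination -h2

theorem discAut_self (a : ℂ) : discAut a a = 0 := by simp [discAut]

theorem discAut_zero (a : ℂ) : discAut a 0 = -a := by simp [discAut]

theorem HasLogOn.exists_differentiableOn {Ω : Set ℂ} (hΩ : IsOpen Ω) {f : ℂ → ℂ}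
    (hf : DifferentiableOn ℂ f Ω) (h : HasLogOn f Ω) :
    ∃ L : ℂ → ℂ, DifferentiableOn ℂ L Ω ∧ ∀ z ∈ Ω, Complex.exp (L z) = f z := by
  obtain ⟨L, hL, hexp⟩ := h
  refine ⟨L, fun a ha => DifferentiableAt.differentiableWithinAt ?_, hexp⟩
  have hfa : f a ≠ 0 := by rw [← hexp a ha]; exact Complex.exp_ne_zero _
  have hev : ∀ᶠ z in 𝓝 a, L z = L a + Complex.log (f z / f a) := by
    filter_upwards [hΩ.mem_nhds ha, Metric.tendsto_nhds.mp
      (hL.continuousAt (hΩ.mem_nhds ha)) 1 one_pos] with z hz hd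
    have him : |(L z - L a).im| < 1 :=
      (Complex.abs_im_le_norm _).trans_lt (by rwa [← dist_eq_norm])
    have hpi := Real.pi_gt_three
    rw [abs_lt] at him
    rw [← hexp z hz, ← hexp a ha, ← Complex.exp_sub, Complex.log_exp (by linarith) (by linarith)]
    ring
  refine DifferentiableAt.congr_of_eventuallyEq ?_ hev
  refine (differentiableAt_const _).add (DifferentiableAt.clog ?_ ?_)
  · exact (hf.differentiableAt (hΩ.mem_nhds ha)).div_const _
  · rw [div_self hfa]
    exact Complex.one_mem_slitPlane

/-- An injective holomorphic map of `Ω` into the unit disc fixing the origin. -/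
structure IsDiscEmbedding (Ω : Set ℂ) (f : ℂ → ℂ) : Prop where
  differentiableOn : DifferentiableOn ℂ f Ω
  injOn : InjOn f Ω
  mapsTo : MapsTo f Ω (Metric.ball 0 1)
  map_zero : f 0 = 0

theorem IsDiscEmbedding.exists_norm_deriv_lt {Ω : Set ℂ} (hΩ : IsOpen Ω) (h0 : (0 : ℂ) ∈ Ω)
    (hlog : ∀ f : ℂ → ℂ, ContinuousOn f Ω → (∀ z ∈ Ω, f z ≠ 0) → HasLogOn f Ω)
    {f : ℂ → ℂ} (hf : IsDiscEmbedding Ω f) (hd : deriv f 0 ≠ 0) {a : ℂ} (ha : ‖a‖ < 1)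
    (haf : a ∉ f '' Ω) : ∃ F, IsDiscEmbedding Ω F ∧ ‖deriv f 0‖ < ‖deriv F 0‖ := by
  have hlt : ∀ z ∈ Ω, ‖f z‖ < 1 := fun z hz => mem_ball_zero_iff.mp (hf.mapsTo hz)
  set h : ℂ → ℂ := fun z => discAut a (f z) with hh
  have hh_diff : DifferentiableOn ℂ h Ω := fun z hz =>
    ((hasDerivAt_discAut ha (hlt z hz)).differentiableAt.comp z
      (hf.differentiableOn.differentiableAt (hΩ.mem_nhds hz))).differentiableWithinAt
  have hh_ne : ∀ z ∈ Ω, h z ≠ 0 := by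
    intro z hz h1
    rw [← discAut_self a] at h1
    exact haf ⟨z, hz, discAut_injOn ha (hf.mapsTo hz) (mem_ball_zero_iff.mpr ha) h1⟩
  obtain ⟨L, hL, hexp⟩ := (hlog h hh_diff.continuousOn hh_ne).exists_differentiableOn hΩ hh_diff
  set g : ℂ → ℂ := fun z => Complex.exp (L z / 2) with hg
  have hg2 : ∀ z ∈ Ω, g z ^ 2 = h z := by
    intro z hz
    rw [← hexp z hz, hg, ← Complex.exp_nat_mul]
    congr 1
    push_cast
    ring
  have hg_diff : DifferentiableOn ℂ g Ω := (hL.div_const 2).cexp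
  have hg_lt : ∀ z ∈ Ω, ‖g z‖ < 1 := by
    intro z hz
    have h1 : ‖h z‖ < 1 := norm_discAut_lt_one ha (hlt z hz)
    rw [← hg2 z hz, norm_pow] at h1
    exact lt_of_pow_lt_pow_left₀ 2 zero_le_one (by simpa using h1)
  have hb0 : g 0 ≠ 0 := Complex.exp_ne_zero _
  have hb := hg_lt 0 h0
  have hnorm : ‖g 0‖ ^ 2 = ‖a‖ := by
    rw [← norm_pow, hg2 0 h0, hh]
    simp only [hf.map_zero, discAut_zero, norm_neg]
  refine ⟨fun z => discAut (g 0) (g z), ⟨?_, ?_, ?_, discAut_self _⟩, ?_⟩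
  · exact fun z hz => ((hasDerivAt_discAut hb (hg_lt z hz)).differentiableAt.comp z
      (hg_diff.differentiableAt (hΩ.mem_nhds hz))).differentiableWithinAt
  · intro z hz w hw hzw
    have h1 := discAut_injOn hb (mem_ball_zero_iff.mpr (hg_lt z hz))
      (mem_ball_zero_iff.mpr (hg_lt w hw)) hzw
    have h2 : h z = h w := by rw [← hg2 z hz, ← hg2 w hw, h1]
    exact hf.injOn hz hw (discAut_injOn ha (hf.mapsTo hz) (hf.mapsTo hw) h2)
  · exact fun z hz => mem_ball_zero_iff.mpr (norm_discAut_lt_one hb (hg_lt z hz))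
  · have hf' := (hf.differentiableOn.differentiableAt (hΩ.mem_nhds h0)).hasDerivAt
    have hg' := (hg_diff.differentiableAt (hΩ.mem_nhds h0)).hasDerivAt
    have e1 : HasDerivAt h ((1 - ‖a‖ ^ 2) * deriv f 0) 0 := by
      have := (hasDerivAt_discAut ha (hlt 0 h0)).comp 0 hf'
      rw [hf.map_zero] at this
      simpa using! this
    have e2 : HasDerivAt h (2 * g 0 * deriv g 0) 0 := by
      have := hg'.pow 2
      refine (this.congr_deriv (by norm_num)).congr_of_eventuallyEq ?_
      filter_upwards [hΩ.mem_nhds h0] with z hz using (hg2 z hz).symm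
    have e3 := ((hasDerivAt_discAut hb hb).comp 0 hg').deriv
    have e4 := congrArg norm (e1.unique e2)
    change deriv (fun z => discAut (g 0) (g z)) 0 = _ at e3
    rw [e3]
    have e5 : 1 - (starRingEnd ℂ) (g 0) * g 0 = ((1 - ‖g 0‖ ^ 2 : ℝ) : ℂ) := by
      rw [mul_comm, Complex.mul_conj, Complex.normSq_eq_norm_sq]
      push_cast
      rfl
    have e6 : (1 - (‖g 0‖ : ℂ) ^ 2) = ((1 - ‖g 0‖ ^ 2 : ℝ) : ℂ) := by push_cast; rfl
    have e7 : (1 - (‖a‖ : ℂ) ^ 2) = ((1 - ‖a‖ ^ 2 : ℝ) : ℂ) := by push_cast; rfl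
    have hpos : 0 < 1 - ‖g 0‖ ^ 2 := by nlinarith [norm_nonneg (g 0)]
    rw [e7, norm_mul, norm_mul, norm_mul, Complex.norm_real, Complex.norm_two, Real.norm_eq_abs,
      abs_of_pos (by nlinarith [norm_nonneg a]), ← hnorm] at e4
    rw [e5, e6, norm_mul, norm_div, norm_pow, Complex.norm_real, Real.norm_eq_abs,
      abs_of_pos hpos, div_mul_eq_mul_div, lt_div_iff₀ (by positivity)]
    have hbp := norm_pos_iff.mpr hb0
    have hdp := norm_pos_iff.mpr hd
    set x := ‖g 0‖
    set D := ‖deriv f 0‖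
    set G := ‖deriv g 0‖
    have h1 : (1 + x ^ 2) * ((1 - x ^ 2) * D) = 2 * x * G := by linear_combination e4
    have h2 : (1 - x ^ 2) * D < G := by
      have h3 : 0 < (1 - x) ^ 2 * ((1 - x ^ 2) * D) := by
        have : 0 < 1 - x := by linarith
        positivity
      have h4 : 2 * x * ((1 - x ^ 2) * D) < 2 * x * G := by linear_combination h3 + h1
      exact lt_of_mul_lt_mul_left h4 (by positivity)
    linear_combination (1 - x ^ 2) * h2

theorem exists_isDiscEmbedding_isMaxOn {Ω : Set ℂ} (hΩ : IsOpen Ω) (hc : IsPreconnected Ω)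
    (hb : Bornology.IsBounded Ω) (h0 : (0 : ℂ) ∈ Ω) :
    ∃ f, IsDiscEmbedding Ω f ∧ deriv f 0 ≠ 0 ∧
      ∀ F, IsDiscEmbedding Ω F → ‖deriv F 0‖ ≤ ‖deriv f 0‖ := by
  obtain ⟨R, hR, hΩR⟩ := hb.subset_ball_lt 0 0
  obtain ⟨r, hr, hrΩ⟩ := Metric.isOpen_iff.mp hΩ 0 h0
  set 𝒟 : Set ℝ := {d | ∃ F, IsDiscEmbedding Ω F ∧ ‖deriv F 0‖ = d} with h𝒟
  have hbdd : BddAbove 𝒟 := by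
    refine ⟨1 / r, ?_⟩
    rintro _ ⟨F, hF, rfl⟩
    refine Complex.norm_deriv_le_div_of_mapsTo_ball (hF.differentiableOn.mono hrΩ) ?_ hr
    rw [hF.map_zero]
    exact (hF.mapsTo.mono_left hrΩ).mono_right Metric.ball_subset_closedBall
  have hmem : 1 / R ∈ 𝒟 := by
    refine ⟨fun z => z / R, ⟨?_, ?_, ?_, by simp⟩, ?_⟩
    · fun_prop
    · intro z _ w _ h
      have hR' : (R : ℂ) ≠ 0 := by exact_mod_cast hR.ne'
      exact (div_left_inj' hR').mp h
    · intro z hz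
      have h1 := mem_ball_zero_iff.mp (hΩR hz)
      rw [mem_ball_zero_iff, norm_div, Complex.norm_real, Real.norm_eq_abs, abs_of_pos hR,
        div_lt_one hR]
      exact h1
    · simp [abs_of_pos hR]
  set S := sSup 𝒟
  have hS : 0 < S := (by positivity : 0 < 1 / R).trans_le (le_csSup hbdd hmem)
  obtain ⟨u, -, hu, hu𝒟⟩ := exists_seq_tendsto_sSup ⟨_, hmem⟩ hbdd
  choose F hF hFu using hu𝒟
  obtain ⟨f, hf⟩ := exists_tendstoLocallyUniformlyOn hΩ (fun n => (hF n).differentiableOn)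
    (fun n => (hF n).mapsTo) (Filter.hyperfilter ℕ)
  have hle : ((Filter.hyperfilter ℕ : Ultrafilter ℕ) : Filter ℕ) ≤ Filter.atTop := by
    rw [← Nat.cofinite_eq_atTop]
    exact Filter.hyperfilter_le_cofinite
  have hdf : DifferentiableOn ℂ f Ω :=
    hf.differentiableOn (Filter.Eventually.of_forall fun n => (hF n).differentiableOn) hΩ
  have hderiv : ‖deriv f 0‖ = S := by
    have h1 := (hf.deriv (Filter.Eventually.of_forall fun n => (hF n).differentiableOn)
      hΩ).tendsto_at h0
    refine tendsto_nhds_unique h1.norm ((hu.mono_left hle).congr fun n => ?_)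
    exact (hFu n).symm
  have hd : deriv f 0 ≠ 0 := norm_pos_iff.mp (hderiv ▸ hS)
  have hinj : InjOn f Ω := injOn_of_tendstoLocallyUniformlyOn hΩ hc
    (fun n => (hF n).differentiableOn) (fun n => (hF n).injOn) hf h0 hd
  have hclosed : Ω ⊆ f ⁻¹' Metric.closedBall (0 : ℂ) 1 := fun z hz =>
    Metric.isClosed_closedBall.mem_of_tendsto (hf.tendsto_at hz)
      (Filter.Eventually.of_forall fun n => Metric.ball_subset_closedBall ((hF n).mapsTo hz))
  have hopen : IsOpen (f '' Ω) := by
    refine ((hdf.analyticOnNhd hΩ).is_constant_or_isOpen hc).resolve_left ?_ Ω subset_rfl hΩ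
    rintro ⟨w, hw⟩
    refine hd ?_
    have : f =ᶠ[𝓝 0] fun _ => w := by filter_upwards [hΩ.mem_nhds h0] with z hz using hw z hz
    rw [this.deriv_eq, deriv_const]
  refine ⟨f, ⟨hdf, hinj, fun z hz => ?_, ?_⟩, hd, fun F hF => ?_⟩
  · rw [← interior_closedBall _ one_ne_zero]
    exact interior_maximal (image_subset_iff.mpr hclosed) hopen (mem_image_of_mem f hz)
  · refine tendsto_nhds_unique (hf.tendsto_at h0) (tendsto_const_nhds.congr fun n => ?_)
    exact (hF n).map_zero.symm
  · rw [hderiv]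
    exact le_csSup hbdd ⟨F, hF, rfl⟩

/-- The inverse of an injective holomorphic function is holomorphic. -/
theorem differentiableOn_of_rightInverse {Ω U : Set ℂ} (hΩ : IsOpen Ω) (hc : IsPreconnected Ω)
    (hU : IsOpen U) {f g : ℂ → ℂ} (hf : DifferentiableOn ℂ f Ω) (hinj : InjOn f Ω)
    (hg : MapsTo g U Ω) (hfg : ∀ w ∈ U, f (g w) = w) {z₀ : ℂ} (hz₀ : z₀ ∈ Ω)
    (hd : deriv f z₀ ≠ 0) : DifferentiableOn ℂ g U := by
  have hfa := hf.analyticOnNhd hΩ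
  have hopen := (hfa.is_constant_or_isOpen hc).resolve_left (by
    rintro ⟨w, hw⟩
    refine hd ?_
    have : f =ᶠ[𝓝 z₀] fun _ => w := by filter_upwards [hΩ.mem_nhds hz₀] with z hz using hw z hz
    rw [this.deriv_eq, deriv_const])
  have hcont : ∀ w ∈ U, ContinuousAt g w := by
    intro w hw
    rw [ContinuousAt, Filter.tendsto_def]
    intro N hN
    obtain ⟨V, hVN, hV, hgV⟩ := mem_nhds_iff.mp hN
    have h1 : f '' (V ∩ Ω) ∈ 𝓝 w :=
      (hopen _ inter_subset_right (hV.inter hΩ)).mem_nhds ⟨g w, ⟨hgV, hg hw⟩, hfg w hw⟩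
    filter_upwards [h1, hU.mem_nhds hw] with x hx hxU
    obtain ⟨z, ⟨hzV, hzΩ⟩, rfl⟩ := hx
    have : g (f z) = z := hinj (hg hxU) hzΩ (hfg _ hxU)
    rw [mem_preimage, this]
    exact hVN hzV
  have hreg : ∀ w ∈ U, deriv f (g w) ≠ 0 → DifferentiableAt ℂ g w := by
    intro w hw hne
    refine (HasDerivAt.of_local_left_inverse (hcont w hw)
      (hf.differentiableAt (hΩ.mem_nhds (hg hw))).hasDerivAt hne ?_).differentiableAt
    filter_upwards [hU.mem_nhds hw] with x hx using hfg x hx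
  intro w hw
  refine DifferentiableAt.differentiableWithinAt ?_
  refine (Complex.analyticAt_of_differentiable_on_punctured_nhds_of_continuousAt ?_
    (hcont w hw)).differentiableAt
  have hda : AnalyticOnNhd ℂ (deriv f) Ω := hfa.deriv
  have h1 : ∀ᶠ z in 𝓝[≠] (g w), deriv f z ≠ 0 := by
    refine ((hda (g w) (hg hw)).eventually_eq_or_eventually_ne
      (analyticAt_const (v := 0))).resolve_left fun h => hd ?_
    exact hda.eqOn_of_preconnected_of_eventuallyEq analyticOnNhd_const hc (hg hw) h hz₀
  have h2 := (hcont w hw).eventually (eventually_nhdsWithin_iff.mp h1)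
  rw [eventually_nhdsWithin_iff]
  filter_upwards [h2, hU.mem_nhds hw] with x hx hxU hxw
  refine hreg x hxU (hx fun h => hxw ?_)
  rw [mem_singleton_iff, ← hfg x hxU, h, hfg w hw]

/-- The Riemann mapping theorem. -/
theorem exists_riemann_map {Ω : Set ℂ} (hΩ : IsOpen Ω) (hc : IsPreconnected Ω)
    (hb : Bornology.IsBounded Ω) (h0 : (0 : ℂ) ∈ Ω)
    (hlog : ∀ f : ℂ → ℂ, ContinuousOn f Ω → (∀ z ∈ Ω, f z ≠ 0) → HasLogOn f Ω) :
    ∃ f g : ℂ → ℂ, DifferentiableOn ℂ f Ω ∧ DifferentiableOn ℂ g (Metric.ball 0 1) ∧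
      MapsTo f Ω (Metric.ball 0 1) ∧ MapsTo g (Metric.ball 0 1) Ω ∧
      (∀ z ∈ Ω, g (f z) = z) ∧ (∀ w ∈ Metric.ball 0 1, f (g w) = w) ∧ g 0 = 0 := by
  obtain ⟨f, hf, hd, hmax⟩ := exists_isDiscEmbedding_isMaxOn hΩ hc hb h0
  have hsurj : SurjOn f Ω (Metric.ball 0 1) := by
    intro a ha
    by_contra haf
    obtain ⟨F, hF, hlt⟩ :=
      hf.exists_norm_deriv_lt hΩ h0 hlog hd (mem_ball_zero_iff.mp ha) haf
    exact hlt.not_ge (hmax F hF)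
  have hg : MapsTo (Function.invFunOn f Ω) (Metric.ball 0 1) Ω := fun w hw =>
    Function.invFunOn_mem (hsurj hw)
  have hfg : ∀ w ∈ Metric.ball (0 : ℂ) 1, f (Function.invFunOn f Ω w) = w := fun w hw =>
    Function.invFunOn_eq (hsurj hw)
  have hgf : ∀ z ∈ Ω, Function.invFunOn f Ω (f z) = z := fun z hz =>
    hf.injOn.leftInvOn_invFunOn hz
  refine ⟨f, Function.invFunOn f Ω, hf.differentiableOn, ?_, hf.mapsTo, hg, hgf, hfg, ?_⟩
  · exact differentiableOn_of_rightInverse hΩ hc Metric.isOpen_ball hf.differentiableOn hf.injOn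
      hg hfg h0 hd
  · have := hgf 0 h0
    rwa [hf.map_zero] at this

open MeasureTheory ENNReal in
theorem exists_lt_le_div_of_lintegral_ne_top {a : ℝ → ℝ≥0∞} (ha : ∫⁻ r in Ioi 0, a r ≠ ∞)
    {δ ρ : ℝ} (hδ : 0 < δ) (hρ : 0 < ρ) :
    ∃ r, 0 < r ∧ r < ρ ∧ a r ≤ ENNReal.ofReal (δ * r⁻¹) := by
  by_contra! hcon
  have h1 : ∫⁻ r in Ioo 0 ρ, ENNReal.ofReal (δ * r⁻¹) ≤ ∫⁻ r in Ioi 0, a r :=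
    (setLIntegral_mono' measurableSet_Ioo fun r hr => (hcon r hr.1 hr.2).le).trans
      (lintegral_mono_set Ioo_subset_Ioi_self)
  have h2 : IntegrableOn (fun r : ℝ => δ * r⁻¹) (Ioo 0 ρ) := by
    refine ⟨by fun_prop, ?_⟩
    rw [hasFiniteIntegral_iff_ofReal]
    · exact h1.trans_lt ha.lt_top
    · filter_upwards [ae_restrict_mem measurableSet_Ioo] with r hr
      have := hr.1
      positivity
  have h3 : IntegrableOn (fun r : ℝ => r⁻¹) (Ioo 0 ρ) := by
    simpa only [IntegrableOn, integrable_const_mul_iff hδ.ne'.isUnit] using h2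
  have h4 : IntervalIntegrable (fun r : ℝ => r⁻¹) volume 0 ρ :=
    (intervalIntegrable_iff_integrableOn_Ioo_of_le hρ.le).mpr h3
  rw [intervalIntegrable_inv_iff] at h4
  rcases h4 with h | h
  · exact hρ.ne h
  · exact h left_mem_uIcc

theorem Complex.det_toSpanSingleton (c : ℂ) :
    ((ContinuousLinearMap.toSpanSingleton ℂ c).restrictScalars ℝ : ℂ →L[ℝ] ℂ).det
      = ‖c‖ ^ 2 := by
  rw [← Complex.normSq_eq_norm_sq, ← Algebra.norm_complex_apply, Algebra.norm_apply]
  change LinearMap.det _ = _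
  congr 1
  ext
  simp [mul_comm]

open MeasureTheory ENNReal in
theorem lintegral_norm_deriv_sq {U : Set ℂ} (hU : IsOpen U) {h : ℂ → ℂ}
    (hd : DifferentiableOn ℂ h U) (hinj : InjOn h U) :
    ∫⁻ w in U, ENNReal.ofReal (‖deriv h w‖ ^ 2) = volume (h '' U) := by
  rw [← lintegral_abs_det_fderiv_eq_addHaar_image volume hU.measurableSet
    (f' := fun w => (ContinuousLinearMap.toSpanSingleton ℂ (deriv h w)).restrictScalars ℝ) ?_ hinj]
  · simp only [Complex.det_toSpanSingleton, abs_pow, abs_norm]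
  · intro w hw
    exact ((hd.differentiableAt (hU.mem_nhds hw)).hasDerivAt.hasFDerivAt.restrictScalars
      ℝ).hasFDerivWithinAt

theorem norm_sub_lt_of_lt_cos {r θ : ℝ} :
    (r * (Real.cos θ + Real.sin θ * Complex.I) : ℂ) ∈ Metric.ball (1 : ℂ) 1 ↔
      r * r < r * (2 * Real.cos θ) := by
  rw [Metric.mem_ball, dist_eq_norm, ← sq_lt_one_iff₀ (norm_nonneg _),
    ← Complex.normSq_eq_norm_sq, Complex.normSq_apply]
  simp only [Complex.sub_re, Complex.sub_im, Complex.mul_re, Complex.mul_im, Complex.add_re,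
    Complex.add_im, Complex.ofReal_re, Complex.ofReal_im, Complex.I_re, Complex.I_im,
    Complex.one_re, Complex.one_im]
  ring_nf
  have := Real.sin_sq_add_cos_sq θ
  constructor <;> intro h <;> nlinarith

theorem norm_sub_le_of_integral_sq_le {F F' : ℝ → ℂ} {s t lam B : ℝ} (hst : s ≤ t) (hlam : 0 < lam)
    (hF : ∀ x ∈ Icc s t, HasDerivAt F (F' x) x) (hF' : ContinuousOn F' (Icc s t))
    (hB : ∫ x in s..t, ‖F' x‖ ^ 2 ≤ B) :
    ‖F t - F s‖ ≤ (t - s) / (2 * lam) + lam / 2 * B := by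
  have hu : uIcc s t = Icc s t := uIcc_of_le hst
  have hi : IntervalIntegrable F' MeasureTheory.volume s t :=
    ContinuousOn.intervalIntegrable (hu ▸ hF')
  have hi2 : IntervalIntegrable (fun x => ‖F' x‖ ^ 2) MeasureTheory.volume s t :=
    ContinuousOn.intervalIntegrable (hu ▸ (hF'.norm.pow 2))
  rw [← intervalIntegral.integral_eq_sub_of_hasDerivAt (fun x hx => hF x (hu ▸ hx)) hi]
  calc ‖∫ x in s..t, F' x‖ ≤ ∫ x in s..t, (1 / (2 * lam) + lam / 2 * ‖F' x‖ ^ 2) := by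
        refine intervalIntegral.norm_integral_le_of_norm_le hst
          (Filter.Eventually.of_forall fun x _ => ?_) ?_
        · have h1 : 0 ≤ (lam * ‖F' x‖ - 1) ^ 2 / (2 * lam) := by positivity
          have h2 : (lam * ‖F' x‖ - 1) ^ 2 / (2 * lam)
              = 1 / (2 * lam) + lam / 2 * ‖F' x‖ ^ 2 - ‖F' x‖ := by
            field_simp
            ring
          linarith
        · exact intervalIntegrable_const.add (hi2.const_mul _)
    _ = (t - s) / (2 * lam) + lam / 2 * ∫ x in s..t, ‖F' x‖ ^ 2 := by
        rw [intervalIntegral.integral_add intervalIntegrable_const (hi2.const_mul _),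
          intervalIntegral.integral_const, intervalIntegral.integral_const_mul, smul_eq_mul]
        ring
    _ ≤ _ := by gcongr

open MeasureTheory ENNReal in
/-- The length–area principle. -/
theorem exists_radius_norm_sub_le {h : ℂ → ℂ} (hd : DifferentiableOn ℂ h (Metric.ball 1 1))
    (hinj : InjOn h (Metric.ball 1 1)) (hb : Bornology.IsBounded (h '' Metric.ball 1 1))
    {ε ρ : ℝ} (hε : 0 < ε) (hρ : 0 < ρ) :
    ∃ r, 0 < r ∧ r < ρ ∧ ∀ w ∈ Metric.ball (1 : ℂ) 1, ∀ z ∈ Metric.ball (1 : ℂ) 1,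
      ‖w‖ = r → ‖z‖ = r → ‖h w - h z‖ ≤ ε := by
  set G : ℂ → ℝ≥0∞ := (Metric.ball 1 1).indicator fun w => ENNReal.ofReal (‖deriv h w‖ ^ 2) with hG
  have hGm : Measurable G :=
    (((measurable_deriv h).norm.pow_const 2).ennreal_ofReal).indicator measurableSet_ball
  have hGfin : ∫⁻ w, G w ≠ ∞ := by
    rw [hG, lintegral_indicator measurableSet_ball, lintegral_norm_deriv_sq Metric.isOpen_ball hd
      hinj]
    exact hb.measure_lt_top.ne
  rw [← Complex.lintegral_comp_polarCoord_symm, polarCoord_target, Measure.volume_eq_prod,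
    setLIntegral_prod] at hGfin
  swap
  · refine Measurable.aemeasurable ?_
    simp only [Complex.polarCoord_symm_apply, smul_eq_mul]
    fun_prop
  have hpi := Real.pi_pos
  obtain ⟨r, hr, hrρ, har⟩ := exists_lt_le_div_of_lintegral_ne_top hGfin
    (δ := ε ^ 2 / (2 * Real.pi)) (by positivity) hρ
  simp only [Complex.polarCoord_symm_apply, smul_eq_mul] at har
  refine ⟨r, hr, hrρ, ?_⟩
  set γ : ℝ → ℂ := fun θ => r * (Real.cos θ + Real.sin θ * Complex.I) with hγ
  have hγd : ∀ θ, HasDerivAt γ (γ θ * Complex.I) θ := by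
    intro θ
    have h1 := ((Real.hasDerivAt_cos θ).ofReal_comp.add
      ((Real.hasDerivAt_sin θ).ofReal_comp.mul_const Complex.I)).const_mul (r : ℂ)
    refine h1.congr_deriv ?_
    simp only [hγ]
    push_cast
    linear_combination (-(r : ℂ) * Complex.sin θ) * Complex.I_sq
  have hγn : ∀ θ, ‖γ θ‖ = r := by
    intro θ
    rw [hγ]
    simp only
    rw [Complex.ofReal_cos, Complex.ofReal_sin, Complex.cos_add_sin_I, norm_mul,
      Complex.norm_exp_ofReal_mul_I, Complex.norm_real, Real.norm_eq_abs, abs_of_pos hr, mul_one]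
  have key : ∀ s ∈ Ioo (-Real.pi) Real.pi, ∀ t ∈ Ioo (-Real.pi) Real.pi, s ≤ t →
      γ s ∈ Metric.ball (1 : ℂ) 1 → γ t ∈ Metric.ball (1 : ℂ) 1 → ‖h (γ t) - h (γ s)‖ ≤ ε := by
    intro s hs t ht hst hsb htb
    have hcos : ∀ x ∈ Ioo (-Real.pi) Real.pi, 0 < Real.cos x →
        x ∈ Icc (-(Real.pi / 2)) (Real.pi / 2) := by
      intro x hx hx0
      by_contra hxn
      rw [mem_Icc, not_and_or, not_le, not_le] at hxn
      rcases hxn with h1 | h1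
      · rw [← Real.cos_neg] at hx0
        have := Real.cos_nonpos_of_pi_div_two_le_of_le (x := -x) (by linarith) (by linarith [hx.1])
        linarith
      · have := Real.cos_nonpos_of_pi_div_two_le_of_le (x := x) h1.le (by linarith [hx.2])
        linarith
    have hball : ∀ x ∈ Icc s t, γ x ∈ Metric.ball (1 : ℂ) 1 := by
      intro x hx
      have h1 := lt_of_mul_lt_mul_left (norm_sub_lt_of_lt_cos.mp hsb) hr.le
      have h2 := lt_of_mul_lt_mul_left (norm_sub_lt_of_lt_cos.mp htb) hr.le
      have h3 := strictConcaveOn_cos_Icc.concaveOn.min_le_of_mem_Icc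
        (hcos s hs (by linarith)) (hcos t ht (by linarith)) hx
      refine norm_sub_lt_of_lt_cos.mpr (mul_lt_mul_of_pos_left ?_ hr)
      rcases min_le_iff.mp h3 with h | h <;> linarith
    have hhd : ∀ x ∈ Icc s t, HasDerivAt (fun x => h (γ x))
        (deriv h (γ x) * (γ x * Complex.I)) x := fun x hx =>
      HasDerivAt.comp x (hd.differentiableAt
        (Metric.isOpen_ball.mem_nhds (hball x hx))).hasDerivAt (hγd x)
    have hγc : Continuous γ := continuous_iff_continuousAt.mpr fun x => (hγd x).continuousAt
    have hdc : ContinuousOn (fun x => deriv h (γ x)) (Icc s t) :=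
      (hd.deriv Metric.isOpen_ball).continuousOn.comp hγc.continuousOn hball
    have hcont : ContinuousOn (fun x => deriv h (γ x) * (γ x * Complex.I)) (Icc s t) :=
      hdc.mul (by fun_prop)
    have hnorm : ∀ x, ‖deriv h (γ x) * (γ x * Complex.I)‖ ^ 2 = r * (r * ‖deriv h (γ x)‖ ^ 2) := by
      intro x
      rw [norm_mul, norm_mul, hγn, Complex.norm_I]
      ring
    have hint : ∫ x in s..t, ‖deriv h (γ x) * (γ x * Complex.I)‖ ^ 2 ≤ ε ^ 2 / (2 * Real.pi) := by
      simp only [hnorm]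
      rw [intervalIntegral.integral_const_mul]
      have h1 : ENNReal.ofReal (∫ x in s..t, r * ‖deriv h (γ x)‖ ^ 2)
          ≤ ENNReal.ofReal (ε ^ 2 / (2 * Real.pi) * r⁻¹) := by
        refine le_trans ?_ har
        rw [intervalIntegral.integral_of_le hst, ofReal_integral_eq_lintegral_ofReal]
        · calc ∫⁻ x in Ioc s t, ENNReal.ofReal (r * ‖deriv h (γ x)‖ ^ 2)
              ≤ ∫⁻ x in Ioc s t, ENNReal.ofReal r * G (γ x) := by
                refine setLIntegral_mono' measurableSet_Ioc fun x hx => ?_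
                rw [hG, indicator_of_mem (hball x (Ioc_subset_Icc_self hx)),
                  ENNReal.ofReal_mul hr.le]
            _ ≤ _ := lintegral_mono_set (Ioc_subset_Ioo hs.1.le ht.2)
        · exact (ContinuousOn.integrableOn_Icc
            (continuousOn_const.mul (hdc.norm.pow 2))).mono_set Ioc_subset_Icc_self
        · exact Filter.Eventually.of_forall fun x => by positivity
      rw [ENNReal.ofReal_le_ofReal_iff (by positivity)] at h1
      calc r * ∫ x in s..t, r * ‖deriv h (γ x)‖ ^ 2
          ≤ r * (ε ^ 2 / (2 * Real.pi) * r⁻¹) := by gcongr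
        _ = _ := by field_simp
    have h2 := norm_sub_le_of_integral_sq_le (lam := 2 * Real.pi / ε) hst (by positivity) hhd
      hcont hint
    refine h2.trans ?_
    have h3 : t - s ≤ 2 * Real.pi := by linarith [hs.1, ht.2]
    calc (t - s) / (2 * (2 * Real.pi / ε)) + 2 * Real.pi / ε / 2 * (ε ^ 2 / (2 * Real.pi))
        ≤ (2 * Real.pi) / (2 * (2 * Real.pi / ε))
          + 2 * Real.pi / ε / 2 * (ε ^ 2 / (2 * Real.pi)) := by gcongr
      _ = ε := by
        field_simp
        norm_num
  have hpol : ∀ w ∈ Metric.ball (1 : ℂ) 1, ‖w‖ = r →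
      ∃ θ ∈ Ioo (-Real.pi) Real.pi, γ θ = w := by
    intro w hw hwr
    have h1 : γ w.arg = w := by
      rw [hγ]
      simp only
      rw [← hwr, Complex.ofReal_cos, Complex.ofReal_sin, Complex.norm_mul_cos_add_sin_mul_I]
    refine ⟨w.arg, ⟨Complex.neg_pi_lt_arg w, (Complex.arg_le_pi w).lt_of_ne fun h => ?_⟩, h1⟩
    rw [← h1, norm_sub_lt_of_lt_cos, h, Real.cos_pi] at hw
    nlinarith
  intro w hw z hz hwr hzr
  obtain ⟨s, hs, rfl⟩ := hpol w hw hwr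
  obtain ⟨t, ht, rfl⟩ := hpol z hz hzr
  rcases le_total s t with hst | hst
  · rw [norm_sub_rev]
    exact key s hs t ht hst hw hz
  · exact key t ht s hs hst hz hw

theorem notMem_of_mem_inside {J : Set ℂ} {a : ℂ} (ha : a ∈ inside J) : a ∉ J := ha.1

theorem IsJordanCurve.exists_isPreconnected_of_forall_dist_lt {J : Set ℂ} (hJ : IsJordanCurve J)
    {η : ℝ} (hη : 0 < η) :
    ∃ δ > 0, ∀ T ⊆ J, (∀ x ∈ T, ∀ y ∈ T, dist x y < δ) →
      ∃ L, T ⊆ L ∧ L ⊆ J ∧ IsCompact L ∧ IsPreconnected L ∧ ∀ x ∈ L, ∀ y ∈ L, dist x y ≤ η := by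
  obtain ⟨e, hec, heinj, rfl⟩ := hJ
  have hemb : IsClosedEmbedding e := hec.isClosedEmbedding heinj
  have := ChartedSpace.locallyConnectedSpace (EuclideanSpace ℝ (Fin 1)) Circle
  set W : Circle → Set Circle := fun u =>
    connectedComponentIn (e ⁻¹' Metric.ball (e u) (η / 2)) u with hW
  have hWo : ∀ u, IsOpen (W u) := fun u => (Metric.isOpen_ball.preimage hec).connectedComponentIn
  have hWu : ∀ u, u ∈ W u := fun u =>
    mem_connectedComponentIn (Metric.mem_ball_self (half_pos hη))
  choose O hO hOW using fun u => hemb.isInducing.isOpen_iff.mp (hWo u)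
  obtain ⟨δ, hδ, hleb⟩ := lebesgue_number_lemma_of_metric (isCompact_range hec) hO (by
    rintro _ ⟨u, rfl⟩
    refine mem_iUnion.mpr ⟨u, ?_⟩
    rw [← mem_preimage, hOW]
    exact hWu u)
  refine ⟨δ, hδ, fun T hT hd => ?_⟩
  rcases T.eq_empty_or_nonempty with rfl | ⟨x, hx⟩
  · exact ⟨∅, subset_rfl, empty_subset _, isCompact_empty, isPreconnected_empty, by simp⟩
  obtain ⟨u, hu⟩ := hleb x (hT hx)
  have hcl : e '' closure (W u) ⊆ Metric.closedBall (e u) (η / 2) := by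
    refine (image_closure_subset_closure_image hec).trans
      (closure_minimal ?_ Metric.isClosed_closedBall)
    rintro _ ⟨v, hv, rfl⟩
    have : v ∈ e ⁻¹' Metric.ball (e u) (η / 2) := connectedComponentIn_subset _ _ hv
    exact Metric.ball_subset_closedBall this
  refine ⟨e '' closure (W u), ?_, image_subset_range _ _, isClosed_closure.isCompact.image hec,
    isPreconnected_connectedComponentIn.closure.image e hec.continuousOn, ?_⟩
  · intro y hy
    obtain ⟨v, rfl⟩ := hT hy
    refine ⟨v, subset_closure ?_, rfl⟩
    rw [← hOW]
    exact hu (hd _ hy _ hx)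
  · intro y hy z hz
    have h1 := Metric.mem_closedBall.mp (hcl hy)
    have h2 := Metric.mem_closedBall.mp (hcl hz)
    linarith [dist_triangle_right y z (e u)]

/-- A crosscut of small diameter cuts off a small piece of the inside of a Jordan curve. -/
theorem IsJordanCurve.connectedComponentIn_diff_eq {J : Set ℂ} (hJ : IsJordanCurve J)
    {K : Set ℂ} (hK : IsCompact K) (hKJ : IsPreconnected (K ∩ J)) {a b : ℂ} (ha : a ∈ inside J)
    (hb : b ∈ inside J) (haK : a ∉ K) (hbK : b ∉ K)
    (hlog : HasLogOn (fun z => (z - a) / (z - b)) K) :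
    b ∈ connectedComponentIn (inside J \ K) a := by
  have haJ := notMem_of_mem_inside ha
  have hbJ := notMem_of_mem_inside hb
  have h2 : HasLogOn (fun z => (z - a) / (z - b)) J :=
    hasLogOn_sub_div_sub hJ.isCompact.isClosed haJ (by rw [hJ.inside_eq ha]; exact hb)
  have haU : a ∉ K ∪ J := fun h => h.elim haK haJ
  have hbU : b ∉ K ∪ J := fun h => h.elim hbK hbJ
  have h3 := connectedComponentIn_union_eq hK hJ.isCompact hKJ haU hbU hlog h2
  have h4 : b ∈ connectedComponentIn (K ∪ J)ᶜ a := h3 ▸ mem_connectedComponentIn hbU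
  have h5 : connectedComponentIn (K ∪ J)ᶜ a ⊆ inside J := by
    rw [← hJ.inside_eq ha]
    exact isPreconnected_connectedComponentIn.subset_connectedComponentIn
      (mem_connectedComponentIn haU)
      ((connectedComponentIn_subset _ _).trans (compl_subset_compl.mpr subset_union_right))
  have h6 : connectedComponentIn (K ∪ J)ᶜ a ⊆ inside J \ K := fun z hz =>
    ⟨h5 hz, fun hzK => connectedComponentIn_subset _ _ hz (Or.inl hzK)⟩
  exact isPreconnected_connectedComponentIn.subset_connectedComponentIn
    (mem_connectedComponentIn haU) h6 h4

/-- A homeomorphism, with a holomorphic inverse, of the unit disc onto the inside of a Jordan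
curve. -/
structure IsRiemannMap (J : Set ℂ) (f g : ℂ → ℂ) : Prop where
  continuousOn_inv : ContinuousOn f (inside J)
  differentiableOn : DifferentiableOn ℂ g (Metric.ball 0 1)
  mapsTo_inv : MapsTo f (inside J) (Metric.ball 0 1)
  mapsTo : MapsTo g (Metric.ball 0 1) (inside J)
  right_inv : ∀ z ∈ inside J, g (f z) = z
  left_inv : ∀ w ∈ Metric.ball 0 1, f (g w) = w

theorem IsRiemannMap.injOn {J : Set ℂ} {f g : ℂ → ℂ} (h : IsRiemannMap J f g) :
    InjOn g (Metric.ball 0 1) := fun z hz w hw hzw => by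
  rw [← h.left_inv z hz, hzw, h.left_inv w hw]

/-- A Riemann map has small oscillation near each boundary point. -/
theorem IsRiemannMap.exists_dist_le {J : Set ℂ} (hJ : IsJordanCurve J) {f g : ℂ → ℂ}
    (h : IsRiemannMap J f g) {ζ : ℂ} (hζ : ‖ζ‖ = 1) {η : ℝ} (hη : 0 < η) :
    ∃ r > 0, ∃ c, ∀ z ∈ Metric.ball (0 : ℂ) 1, dist z ζ < r → dist (g z) c ≤ η := by
  have hq : g 0 ≠ g (1 / 2) := by
    intro he
    have := h.injOn (Metric.mem_ball_self one_pos)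
      (by rw [mem_ball_zero_iff]; norm_num) he
    norm_num at this
  wlog hηq : 2 * η < dist (g 0) (g (1 / 2)) generalizing η
  · have hpos := dist_pos.mpr hq
    obtain ⟨r, hr, c, hrc⟩ := this (η := dist (g 0) (g (1 / 2)) / 4) (by positivity) (by linarith)
    exact ⟨r, hr, c, fun z hz hzr => (hrc z hz hzr).trans (by linarith)⟩
  obtain ⟨δ, hδ, hJδ⟩ := hJ.exists_isPreconnected_of_forall_dist_lt (half_pos hη)
  have hζ0 : ζ ≠ 0 := norm_ne_zero_iff.mp (by rw [hζ]; exact one_ne_zero)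
  have hmaps : ∀ w : ℂ, ζ * (1 - w) ∈ Metric.ball (0 : ℂ) 1 ↔ w ∈ Metric.ball (1 : ℂ) 1 := by
    intro w
    rw [mem_ball_zero_iff, norm_mul, hζ, one_mul, Metric.mem_ball', dist_eq_norm]
  set k : ℂ → ℂ := fun w => g (ζ * (1 - w)) with hk
  have hkd : DifferentiableOn ℂ k (Metric.ball 1 1) :=
    h.differentiableOn.comp (by fun_prop) fun w hw => (hmaps w).mpr hw
  have hkinj : InjOn k (Metric.ball 1 1) := by
    intro w hw z hz hwz
    have := mul_left_cancel₀ hζ0 (h.injOn ((hmaps w).mpr hw) ((hmaps z).mpr hz) hwz)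
    exact sub_right_injective this
  have hkb : Bornology.IsBounded (k '' Metric.ball 1 1) :=
    hJ.isBounded_inside.subset (by
      rintro _ ⟨w, hw, rfl⟩
      exact h.mapsTo ((hmaps w).mpr hw))
  obtain ⟨r, hr, hr2, hrk⟩ := exists_radius_norm_sub_le hkd hkinj hkb
    (ε := min (δ / 2) (η / 2)) (ρ := 1 / 2) (by positivity) (by norm_num)
  set α : Set ℂ := {z | z ∈ Metric.ball (0 : ℂ) 1 ∧ dist z ζ = r} with hα
  have hαd : ∀ z ∈ α, ∀ w ∈ α, dist (g z) (g w) ≤ min (δ / 2) (η / 2) := by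
    have hsub : ∀ z, ζ * (1 - (1 - z / ζ)) = z := fun z => by field_simp; ring
    have hn : ∀ z, ‖1 - z / ζ‖ = dist z ζ := by
      intro z
      rw [dist_comm, dist_eq_norm, ← div_self hζ0, ← sub_div, norm_div, hζ, div_one]
    rintro z ⟨hz, hzr⟩ w ⟨hw, hwr⟩
    have := hrk (1 - z / ζ) ((hmaps _).mp (by rwa [hsub])) (1 - w / ζ)
      ((hmaps _).mp (by rwa [hsub])) (by rw [hn, hzr]) (by rw [hn, hwr])
    simpa only [hk, hsub, ← dist_eq_norm] using this
  set E := closure (g '' α) with hE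
  have hEd : ∀ x ∈ E, ∀ y ∈ E, dist x y ≤ min (δ / 2) (η / 2) := by
    have h1 : ∀ x ∈ g '' α, ∀ y ∈ E, dist x y ≤ min (δ / 2) (η / 2) := by
      rintro _ ⟨z, hz, rfl⟩
      refine fun y hy => closure_minimal (t := Metric.closedBall (g z) (min (δ / 2) (η / 2))) ?_
        Metric.isClosed_closedBall hy |> fun h => by rwa [Metric.mem_closedBall'] at h
      rintro _ ⟨w, hw, rfl⟩
      exact Metric.mem_closedBall'.mpr (hαd z hz w hw)
    intro x hx y hy
    exact closure_minimal (t := Metric.closedBall y (min (δ / 2) (η / 2)))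
      (fun z hz => h1 z hz y hy) Metric.isClosed_closedBall hx
  have hEc : IsCompact E := by
    refine (hJ.isBounded_inside.subset ?_).isCompact_closure
    rintro _ ⟨z, hz, rfl⟩
    exact h.mapsTo hz.1
  have hpα : ζ * (1 - r) ∈ α := by
    constructor
    · rw [mem_ball_zero_iff, norm_mul, hζ, one_mul, ← Complex.ofReal_one, ← Complex.ofReal_sub,
        Complex.norm_real, Real.norm_eq_abs, abs_lt]
      constructor <;> linarith
    · rw [dist_eq_norm, show ζ * (1 - r) - ζ = -(ζ * r) by ring, norm_neg, norm_mul, hζ, one_mul,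
        Complex.norm_real, Real.norm_eq_abs, abs_of_pos hr]
  set c := g (ζ * (1 - r)) with hc
  have hcE : c ∈ E := subset_closure ⟨_, hpα, rfl⟩
  have hEcη : ∀ x ∈ E, dist x c ≤ η / 2 := fun x hx => (hEd x hx c hcE).trans (min_le_right _ _)
  obtain ⟨L, hEL, hLJ, hLc, hLp, hLd⟩ : ∃ L, E ∩ J ⊆ L ∧ L ⊆ J ∧ IsCompact L ∧
      IsPreconnected L ∧ ∀ x ∈ L, dist x c ≤ η := by
    rcases (E ∩ J).eq_empty_or_nonempty with he | ⟨y, hy⟩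
    · exact ⟨∅, he.subset, empty_subset _, isCompact_empty, isPreconnected_empty, by simp⟩
    obtain ⟨L, hEL, hLJ, hLc, hLp, hLd⟩ := hJδ (E ∩ J) inter_subset_right fun x hx y hy =>
      (hEd x hx.1 y hy.1).trans_lt ((min_le_left _ _).trans_lt (half_lt_self hδ))
    refine ⟨L, hEL, hLJ, hLc, hLp, fun x hx => ?_⟩
    linarith [dist_triangle x y c, hLd x hx y (hEL hy), hEcη y hy.1]
  have hK : E ∪ L ⊆ Metric.closedBall c η := by
    rintro x (hx | hx)
    · exact Metric.mem_closedBall.mpr ((hEcη x hx).trans (by linarith))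
    · exact Metric.mem_closedBall.mpr (hLd x hx)
  have hKJ : IsPreconnected ((E ∪ L) ∩ J) := by
    rwa [union_inter_distrib_right, inter_eq_left.mpr hLJ, union_eq_right.mpr hEL]
  refine ⟨r, hr, c, fun z hz hzr => ?_⟩
  by_contra! hzc
  obtain ⟨q, hqb, hqr, hqc⟩ : ∃ q ∈ Metric.ball (0 : ℂ) 1, r < dist q ζ ∧ η < dist (g q) c := by
    rcases lt_or_ge η (dist (g 0) c) with h0 | h0
    · refine ⟨0, Metric.mem_ball_self one_pos, ?_, h0⟩
      rw [dist_zero_left, hζ]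
      linarith
    · refine ⟨1 / 2, by rw [mem_ball_zero_iff]; norm_num, ?_, ?_⟩
      · have h1 := norm_sub_norm_le ζ (1 / 2)
        rw [← dist_eq_norm, dist_comm, hζ] at h1
        norm_num at h1
        norm_num
        linarith
      · linarith [dist_triangle_right (g 0) (g (1 / 2)) c]
  have ha : g z ∉ Metric.closedBall c η := fun h => hzc.not_ge (Metric.mem_closedBall.mp h)
  have hb : g q ∉ Metric.closedBall c η := fun h => hqc.not_ge (Metric.mem_closedBall.mp h)
  have hmem := hJ.connectedComponentIn_diff_eq (hEc.union hLc) hKJ (h.mapsTo hz) (h.mapsTo hqb)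
    (fun h => ha (hK h)) (fun h => hb (hK h))
    ((hasLogOn_sub_of_closedBall hK ha).div (hasLogOn_sub_of_closedBall hK hb))
  set S := connectedComponentIn (inside J \ (E ∪ L)) (g z) with hS
  have hSsub : S ⊆ inside J \ (E ∪ L) := connectedComponentIn_subset _ _
  have hzS : g z ∈ S := mem_connectedComponentIn ⟨h.mapsTo hz, fun h => ha (hK h)⟩
  have hcont : ContinuousOn (fun w => dist (f w) ζ) S :=
    (continuous_id.dist continuous_const).comp_continuousOn
      (h.continuousOn_inv.mono fun w hw => (hSsub hw).1)
  obtain ⟨w, hwS, hw⟩ := isPreconnected_connectedComponentIn.intermediate_value hzS hmem hcont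
    (show r ∈ Icc (dist (f (g z)) ζ) (dist (f (g q)) ζ) by
      rw [h.left_inv z hz, h.left_inv q hqb]
      exact ⟨hzr.le, hqr.le⟩)
  refine (hSsub hwS).2 (Or.inl (subset_closure ⟨f w, ⟨h.mapsTo_inv (hSsub hwS).1, hw⟩, ?_⟩))
  exact h.right_inv w (hSsub hwS).1

theorem Circle.isPreconnected_compl_singleton (u : Circle) : IsPreconnected ({u}ᶜ : Set Circle) := by
  have h1 : ({u}ᶜ : Set Circle)
      = (fun t : ℝ => u * Circle.exp Real.pi * Circle.exp t) '' Ioo (-Real.pi) Real.pi := by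
    ext v
    have h2 : Circle.exp Real.pi * Circle.exp Real.pi = 1 := by
      rw [← Circle.exp_add, ← two_mul, Circle.exp_two_pi]
    constructor
    · intro hv
      set w := (u * Circle.exp Real.pi)⁻¹ * v with hw
      have hexp : Circle.exp (Complex.arg w) = w := Circle.exp_arg w
      refine ⟨Complex.arg w, ⟨Complex.neg_pi_lt_arg _, (Complex.arg_le_pi _).lt_of_ne ?_⟩, ?_⟩
      · intro h
        rw [h] at hexp
        refine hv ?_
        rw [mem_singleton_iff, ← mul_inv_cancel_left (u * Circle.exp Real.pi) v, ← hw, ← hexp,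
          mul_assoc, h2, mul_one]
      · simp only
        rw [hexp, hw, mul_inv_cancel_left]
    · rintro ⟨t, ht, rfl⟩ h
      have h3 : Circle.exp (Real.pi + t) = 1 := by
        rw [Circle.exp_add]
        exact mul_eq_left.mp ((mul_assoc _ _ _).symm.trans h)
      obtain ⟨n, hn⟩ := Circle.exp_eq_one.mp h3
      have hpi := Real.pi_pos
      have h4 : (0 : ℝ) < n := by
        by_contra! hle
        nlinarith [ht.1]
      have h5 : (n : ℝ) < 1 := by
        by_contra! hle
        nlinarith [ht.2]
      have h6 : 0 < n := by exact_mod_cast h4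
      have h7 : n < 1 := by exact_mod_cast h5
      omega
  rw [h1]
  exact isPreconnected_Ioo.image _ (by fun_prop)

theorem IsJordanCurve.isPreconnected_diff_singleton {J : Set ℂ} (hJ : IsJordanCurve J) {p : ℂ}
    (hp : p ∈ J) : IsPreconnected (J \ {p}) := by
  obtain ⟨e, hec, heinj, rfl⟩ := hJ
  obtain ⟨u, rfl⟩ := hp
  have : range e \ {e u} = e '' {u}ᶜ := by
    rw [compl_eq_univ_sdiff, image_sdiff heinj, image_univ, image_singleton]
  rw [this]
  exact (Circle.isPreconnected_compl_singleton u).image e hec.continuousOn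

theorem IsJordanCurve.exists_mem_closure_outside_ne {J : Set ℂ} (hJ : IsJordanCurve J) {p : ℂ}
    (hp : p ∈ J) : ∃ q ∈ J, q ≠ p ∧ q ∈ closure (outside J) := by
  by_contra! hcon
  obtain ⟨a, ha⟩ := hJ.inside_nonempty
  obtain ⟨b, hb⟩ := hJ.exists_mem_outside
  have hpre : IsPreconnected ({p}ᶜ : Set ℂ) :=
    (isConnected_compl_singleton_of_one_lt_rank
      (by simp) p).isPreconnected
  have hcl : {p}ᶜ ⊆ outside J ∪ (closure (outside J))ᶜ := by
    intro z hz
    by_cases h : z ∈ closure (outside J)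
    · rcases hJ.closure_outside_subset h with h1 | h1
      · exact Or.inl h1
      · exact absurd h (hcon z h1 hz)
    · exact Or.inr h
  have hbp : b ≠ p := fun h => hb.1 (h ▸ hp)
  have hap : a ≠ p := fun h => ha.1 (h ▸ hp)
  have haV : a ∉ closure (outside J) := fun h => by
    rcases hJ.closure_outside_subset h with h1 | h1
    · exact disjoint_left.mp disjoint_inside_outside ha h1
    · exact ha.1 h1
  obtain ⟨z, -, hz1, hz2⟩ := hpre _ _ hJ.isOpen_outside isClosed_closure.isOpen_compl hcl
    ⟨b, hbp, hb⟩ ⟨a, hap, haV⟩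
  exact hz2 (subset_closure hz1)

/-- The inside and one point of a Jordan curve do not separate the rest of the curve from
infinity. -/
theorem IsJordanCurve.notMem_of_isBounded {J Γ : Set ℂ} (hJ : IsJordanCurve J) {p a q : ℂ}
    (hp : p ∈ J) (hΓ : Γ ⊆ insert p (inside J))
    (hB : Bornology.IsBounded (connectedComponentIn Γᶜ a)) (hq : q ∈ J) (hqp : q ≠ p) :
    q ∉ connectedComponentIn Γᶜ a := by
  intro hqB
  obtain ⟨q₀, hq₀, hq₀p, hq₀c⟩ := hJ.exists_mem_closure_outside_ne hp
  have h1 : IsPreconnected (insert q₀ (outside J)) :=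
    hJ.isPreconnected_outside.subset_closure (subset_insert _ _)
      (insert_subset hq₀c subset_closure)
  have h2 : IsPreconnected (insert q₀ (outside J) ∪ J \ {p}) :=
    IsPreconnected.union q₀ (mem_insert _ _) ⟨hq₀, hq₀p⟩ h1 (hJ.isPreconnected_diff_singleton hp)
  have h3 : insert q₀ (outside J) ∪ J \ {p} ⊆ Γᶜ := by
    rintro z hz hzΓ
    rcases hΓ hzΓ with rfl | hzi
    · rcases hz with (rfl | h) | h
      · exact hq₀p rfl
      · exact h.1 hp
      · exact h.2 rfl
    · rcases hz with (rfl | h) | h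
      · exact hzi.1 hq₀
      · exact disjoint_left.mp disjoint_inside_outside hzi h
      · exact hzi.1 h.1
  refine hJ.not_isBounded_outside (hB.subset ?_)
  rw [connectedComponentIn_eq hqB]
  have h4 := h2.subset_connectedComponentIn (Or.inr ⟨hq, hqp⟩) h3
  exact fun z hz => h4 (Or.inl (mem_insert_of_mem _ hz))

theorem eq_of_eqOn_arc {G : ℂ → ℂ} (hG : ContinuousOn G (Metric.closedBall 0 1))
    (hGd : DifferentiableOn ℂ G (Metric.ball 0 1)) {O : Set ℂ} (hO : IsOpen O) {u₀ : Circle}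
    (hu₀ : (u₀ : ℂ) ∈ O) {p : ℂ} (hp : ∀ u : Circle, (u : ℂ) ∈ O → G u = p) : G 0 = p := by
  obtain ⟨t, ht⟩ := isCompact_univ.elim_finite_subcover
    (fun c : Circle => (fun u : Circle => ((c * u : Circle) : ℂ)) ⁻¹' O)
    (fun c => hO.preimage (by fun_prop)) (fun u _ => mem_iUnion.mpr ⟨u₀ * u⁻¹, by simpa using hu₀⟩)
  have hrot : ∀ c : Circle, ∀ z : ℂ, ‖(c : ℂ) * z‖ = ‖z‖ := fun c z => by
    rw [norm_mul, Circle.norm_coe, one_mul]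
  have hdiff : DiffContOnCl ℂ (fun z => ∏ c ∈ t, (G (c * z) - p)) (Metric.ball 0 1) := by
    refine ⟨?_, ?_⟩
    · refine DifferentiableOn.fun_finsetProd fun c _ => DifferentiableOn.sub_const ?_ _
      refine hGd.comp (by fun_prop) fun z hz => ?_
      rwa [mem_ball_zero_iff, hrot, ← mem_ball_zero_iff]
    · rw [closure_ball _ one_ne_zero]
      refine continuousOn_finsetProd _ fun c _ => ContinuousOn.sub ?_ continuousOn_const
      refine hG.comp (by fun_prop) fun z hz => ?_
      rwa [mem_closedBall_zero_iff, hrot, ← mem_closedBall_zero_iff]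
  have h0 := Complex.norm_le_of_forall_mem_frontier_norm_le Metric.isBounded_ball hdiff (C := 0)
    (fun z hz => by
      rw [frontier_ball _ one_ne_zero, mem_sphere_zero_iff_norm] at hz
      obtain ⟨u, rfl⟩ : ∃ u : Circle, (u : ℂ) = z := ⟨⟨z, mem_sphere_zero_iff_norm.mpr hz⟩, rfl⟩
      obtain ⟨c, hct, hc⟩ := mem_iUnion₂.mp (ht (mem_univ u))
      rw [Finset.prod_eq_zero hct (sub_eq_zero.mpr (hp (c * u) hc)), norm_zero]) (subset_closure (Metric.mem_ball_self one_pos))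
  have h1 := norm_le_zero_iff.mp h0
  rw [Finset.prod_eq_zero_iff] at h1
  obtain ⟨c, -, hc⟩ := h1
  rw [mul_zero] at hc
  exact sub_eq_zero.mp hc

/-- A continuous extension of a Riemann map to the closed disc. -/
structure IsRiemannExtension (J : Set ℂ) (f G : ℂ → ℂ) : Prop extends IsRiemannMap J f G where
  continuousOn : ContinuousOn G (Metric.closedBall 0 1)
  mapsTo_circle : ∀ u : Circle, G u ∈ J

theorem IsRiemannMap.exists_isRiemannExtension {J : Set ℂ} (hJ : IsJordanCurve J) {f g : ℂ → ℂ}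
    (h : IsRiemannMap J f g) :
    ∃ G, EqOn G g (Metric.ball 0 1) ∧ IsRiemannExtension J f G := by
  have hcl : closure (Metric.ball (0 : ℂ) 1) = Metric.closedBall 0 1 := closure_ball _ one_ne_zero
  have hlim : ∀ x ∈ Metric.closedBall (0 : ℂ) 1,
      ∃ y, Filter.Tendsto g (𝓝[Metric.ball 0 1] x) (𝓝 y) := by
    intro x hx
    rcases (mem_closedBall_zero_iff.mp hx).lt_or_eq with hlt | heq
    · exact ⟨g x, h.differentiableOn.continuousOn x (mem_ball_zero_iff.mpr hlt)⟩
    · have hne : (𝓝[Metric.ball 0 1] x).NeBot := mem_closure_iff_nhdsWithin_neBot.mp (hcl ▸ hx)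
      refine cauchy_map_iff_exists_tendsto.mp (Metric.cauchy_iff.mpr ⟨hne.map g, fun ε hε => ?_⟩)
      obtain ⟨r, hr, c, hc⟩ := h.exists_dist_le hJ heq (η := ε / 3) (by positivity)
      refine ⟨g '' (Metric.ball 0 1 ∩ Metric.ball x r), Filter.image_mem_map
        (Filter.inter_mem self_mem_nhdsWithin (mem_nhdsWithin_of_mem_nhds (Metric.ball_mem_nhds x hr))),
        ?_⟩
      rintro _ ⟨z, hz, rfl⟩ _ ⟨w, hw, rfl⟩
      linarith [dist_triangle_right (g z) (g w) c, hc z hz.1 hz.2, hc w hw.1 hw.2]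
  have hcont := continuousOn_extendFrom hcl.ge hlim
  have heq : EqOn (extendFrom (Metric.ball 0 1) g) g (Metric.ball 0 1) := fun z hz =>
    extendFrom_eq (subset_closure hz) (h.differentiableOn.continuousOn z hz)
  refine ⟨_, heq, ⟨h.continuousOn_inv, h.differentiableOn.congr heq, h.mapsTo_inv,
    h.mapsTo.congr heq.symm, fun z hz => ?_, fun w hw => ?_⟩, hcont, fun u => ?_⟩
  · rw [heq (h.mapsTo_inv hz), h.right_inv z hz]
  · rw [heq hw, h.left_inv w hw]
  · set G := extendFrom (Metric.ball 0 1) g with hG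
    have huc : (u : ℂ) ∈ Metric.closedBall (0 : ℂ) 1 := by
      rw [mem_closedBall_zero_iff, Circle.norm_coe]
    have hmem : G u ∈ closure (inside J) := by
      refine ((hcont u huc).mono Metric.ball_subset_closedBall).mem_closure (hcl ▸ huc) ?_
      exact h.mapsTo.congr heq.symm
    refine (hJ.closure_inside_subset hmem).resolve_left fun hin => ?_
    have hne : (𝓝[Metric.ball 0 1] (u : ℂ)).NeBot := mem_closure_iff_nhdsWithin_neBot.mp (hcl ▸ huc)
    have h1 : Filter.Tendsto G (𝓝[Metric.ball 0 1] (u : ℂ)) (𝓝 (G u)) :=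
      (hcont u huc).mono_left (nhdsWithin_mono _ Metric.ball_subset_closedBall)
    have h2 := ((h.continuousOn_inv.continuousAt (hJ.isOpen_inside.mem_nhds hin)).tendsto.comp h1)
    have h3 : Filter.Tendsto (f ∘ G) (𝓝[Metric.ball 0 1] (u : ℂ)) (𝓝 (u : ℂ)) := by
      refine (Filter.tendsto_id.mono_left nhdsWithin_le_nhds).congr' ?_
      filter_upwards [self_mem_nhdsWithin] with z hz
      rw [Function.comp_apply, heq hz, h.left_inv z hz, id]
    have h4 := h.mapsTo_inv hin
    rw [tendsto_nhds_unique h2 h3, mem_ball_zero_iff, Circle.norm_coe] at h4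
    exact lt_irrefl _ h4

/-- A domain adjacent to an arc of the circle is not mapped into a bounded component of the
complement of a set touching the Jordan curve in at most one point. -/
theorem IsRiemannExtension.not_isBounded_connectedComponentIn {J : Set ℂ} (hJ : IsJordanCurve J)
    {f G : ℂ → ℂ} (h : IsRiemannExtension J f G) {H : Set ℂ} (hHo : IsOpen H)
    (hHc : Convex ℝ H) {p : ℂ} (hp : p ∈ J) {Γ : Set ℂ} (hΓ : Γ ⊆ insert p (inside J))
    (hΓc : IsClosed Γ) (hΓH : ∀ z ∈ Metric.ball 0 1 ∩ H, G z ∉ Γ) {u₀ : Circle}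
    (hu₀ : (u₀ : ℂ) ∈ H) {a : ℂ} (ha : a ∈ Metric.ball 0 1 ∩ H) :
    ¬ Bornology.IsBounded (connectedComponentIn Γᶜ (G a)) := by
  intro hB
  have hcl : closure (Metric.ball (0 : ℂ) 1) = Metric.closedBall 0 1 := closure_ball _ one_ne_zero
  have hpre : IsPreconnected (G '' (Metric.ball 0 1 ∩ H)) :=
    ((convex_ball 0 1).inter hHc).isPreconnected.image _
      (h.differentiableOn.continuousOn.mono inter_subset_left)
  have hsub : G '' (Metric.ball 0 1 ∩ H) ⊆ connectedComponentIn Γᶜ (G a) :=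
    hpre.subset_connectedComponentIn (mem_image_of_mem _ ha)
      (by rintro _ ⟨z, hz, rfl⟩; exact hΓH z hz)
  have hG0 : G 0 = p := by
    refine eq_of_eqOn_arc h.continuousOn h.differentiableOn hHo hu₀ fun u hu => ?_
    have huc : (u : ℂ) ∈ Metric.closedBall (0 : ℂ) 1 := by
      rw [mem_closedBall_zero_iff, Circle.norm_coe]
    have h1 : (u : ℂ) ∈ closure (Metric.ball 0 1 ∩ H) := by
      rw [inter_comm]
      exact hHo.inter_closure ⟨hu, hcl ▸ huc⟩
    have h2 : G u ∈ closure (connectedComponentIn Γᶜ (G a)) :=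
      ((h.continuousOn u huc).mono
        (inter_subset_left.trans Metric.ball_subset_closedBall)).mem_closure h1
        (mapsTo_iff_image_subset.mpr hsub)
    have hGu := h.mapsTo_circle u
    rcases closure_connectedComponentIn_subset hΓc _ h2 with h3 | h3
    · by_contra hne
      exact hJ.notMem_of_isBounded hp hΓ hB hGu hne h3
    · exact (hΓ h3).resolve_right fun h4 => h4.1 hGu
  exact (h.mapsTo (Metric.mem_ball_self one_pos)).1 (hG0 ▸ hp)

theorem eq_or_eq_of_im_eq_zero {ζ ξ u : ℂ} (hζ : ‖ζ‖ = 1) (hξ : ‖ξ‖ = 1) (hu : ‖u‖ = 1)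
    (hne : ζ ≠ ξ) (h : ((u - ζ) * (starRingEnd ℂ) (ξ - ζ)).im = 0) : u = ζ ∨ u = ξ := by
  have hsq : ∀ z : ℂ, ‖z‖ = 1 → z.re * z.re + z.im * z.im = 1 := fun z hz => by
    rw [← Complex.normSq_apply, Complex.normSq_eq_norm_sq, hz, one_pow]
  have h1 := hsq ζ hζ
  have h2 := hsq ξ hξ
  have h3 := hsq u hu
  simp only [Complex.mul_im, Complex.sub_re, Complex.sub_im, Complex.conj_re, Complex.conj_im,
    map_sub] at h
  set m := (ξ.re - ζ.re) * (ξ.re - ζ.re) + (ξ.im - ζ.im) * (ξ.im - ζ.im) with hm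
  have hm0 : m ≠ 0 := by
    intro h0
    refine hne (Complex.ext ?_ ?_) <;>
      nlinarith [mul_self_nonneg (ξ.re - ζ.re), mul_self_nonneg (ξ.im - ζ.im)]
  set r := ((u.re - ζ.re) * (ξ.re - ζ.re) + (u.im - ζ.im) * (ξ.im - ζ.im)) / m with hr
  have hrm : r * m = (u.re - ζ.re) * (ξ.re - ζ.re) + (u.im - ζ.im) * (ξ.im - ζ.im) :=
    div_mul_cancel₀ _ hm0
  have hre : u.re = ζ.re + r * (ξ.re - ζ.re) := by
    refine mul_right_cancel₀ hm0 ?_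
    linear_combination (ξ.re - ζ.re) * (-hrm) + (-(ξ.im - ζ.im)) * h + 0 * hm
  have him : u.im = ζ.im + r * (ξ.im - ζ.im) := by
    refine mul_right_cancel₀ hm0 ?_
    linear_combination (ξ.im - ζ.im) * (-hrm) + (ξ.re - ζ.re) * h + 0 * hm
  have hrr : r * (r - 1) * m = 0 := by
    rw [hre, him] at h3
    linear_combination h3 - h1 + r * (h1 - h2)
  rcases mul_eq_zero.mp ((mul_eq_zero.mp hrr).resolve_right hm0) with h0 | h0
  · left
    rw [h0, zero_mul, add_zero] at hre him
    exact Complex.ext hre him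
  · right
    rw [sub_eq_zero.mp h0, one_mul, add_sub_cancel] at hre him
    exact Complex.ext hre him

theorem exists_circle_im_pos_neg {ζ ξ : ℂ} (hζ : ‖ζ‖ = 1) (hξ : ‖ξ‖ = 1) (hne : ζ ≠ ξ) :
    (∃ u : Circle, 0 < (((u : ℂ) - ζ) * (starRingEnd ℂ) (ξ - ζ)).im) ∧
      ∃ u : Circle, (((u : ℂ) - ζ) * (starRingEnd ℂ) (ξ - ζ)).im < 0 := by
  have hsq : ∀ z : ℂ, ‖z‖ = 1 → z.re * z.re + z.im * z.im = 1 := fun z hz => by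
    rw [← Complex.normSq_apply, Complex.normSq_eq_norm_sq, hz, one_pow]
  have h1 := hsq ζ hζ
  have h2 := hsq ξ hξ
  set m := ξ - ζ with hm
  have hm0 : m ≠ 0 := sub_ne_zero.mpr hne.symm
  have hn0 : 0 < ‖m‖ := norm_pos_iff.mpr hm0
  have hnsq : ‖m‖ ^ 2 = m.re * m.re + m.im * m.im := by
    rw [← Complex.normSq_apply, Complex.normSq_eq_norm_sq]
  have hlt : (ζ * (starRingEnd ℂ) m).im ^ 2 < ‖m‖ ^ 2 := by
    have h3 : (ζ * (starRingEnd ℂ) m).im ^ 2 + (ζ * (starRingEnd ℂ) m).re ^ 2 = ‖m‖ ^ 2 := by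
      rw [hnsq]
      simp only [Complex.mul_im, Complex.mul_re, Complex.conj_re, Complex.conj_im]
      linear_combination (m.re * m.re + m.im * m.im) * h1
    have h4 : 2 * (ζ * (starRingEnd ℂ) m).re = -‖m‖ ^ 2 := by
      rw [hnsq, hm]
      simp only [Complex.mul_re, Complex.sub_re, Complex.sub_im, Complex.conj_re, Complex.conj_im]
      linear_combination h2 - h1
    have h5 : (ζ * (starRingEnd ℂ) m).re ≠ 0 := fun h0 => by
      rw [h0] at h4
      nlinarith
    have h6 := sq_pos_of_ne_zero h5
    linarith
  obtain ⟨h3, h4⟩ := abs_lt.mp (abs_lt_of_sq_lt_sq hlt hn0.le)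
  have hun : ‖Complex.I * (m / ‖m‖)‖ = 1 := by
    rw [norm_mul, Complex.norm_I, one_mul, norm_div, Complex.norm_real, norm_norm,
      div_self hn0.ne']
  have hval : Complex.I * (m / ‖m‖) * (starRingEnd ℂ) m = Complex.I * (‖m‖ : ℂ) := by
    have : (‖m‖ : ℂ) ≠ 0 := by exact_mod_cast hn0.ne'
    field_simp
    rw [Complex.mul_conj, Complex.normSq_eq_norm_sq]
    push_cast
    ring
  obtain ⟨v, hv⟩ : ∃ v : Circle, (v : ℂ) = Complex.I * (m / ‖m‖) :=
    ⟨⟨_, mem_sphere_zero_iff_norm.mpr hun⟩, rfl⟩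
  refine ⟨⟨v, ?_⟩, ⟨Circle.exp Real.pi * v, ?_⟩⟩
  · rw [sub_mul, hv, hval, Complex.sub_im, Complex.I_mul_im, Complex.ofReal_re]
    linarith
  · rw [sub_mul, Circle.coe_mul, Circle.coe_exp, Complex.exp_pi_mul_I, neg_one_mul, neg_mul, hv,
      hval, Complex.sub_im, Complex.neg_im, Complex.I_mul_im, Complex.ofReal_re]
    linarith

theorem IsRiemannExtension.injective_circle {J : Set ℂ} (hJ : IsJordanCurve J) {f G : ℂ → ℂ}
    (h : IsRiemannExtension J f G) : Function.Injective fun u : Circle => G u := by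
  intro ζ ξ hpq
  by_contra hne
  have hne' : (ζ : ℂ) ≠ ξ := fun h0 => hne (Circle.ext h0)
  have hcl : closure (Metric.ball (0 : ℂ) 1) = Metric.closedBall 0 1 := closure_ball _ one_ne_zero
  set l : ℂ → ℝ := fun z => ((z - ζ) * (starRingEnd ℂ) ((ξ : ℂ) - ζ)).im with hl
  have hlc : Continuous l := by fun_prop
  have hlm : ∀ z w : ℂ, ∀ a b : ℝ, a + b = 1 → l (a • z + b • w) = a * l z + b * l w := by
    intro z w a b hab
    obtain rfl : b = 1 - a := by linarith
    simp only [hl, Complex.mul_im, Complex.sub_re, Complex.sub_im, Complex.add_re, Complex.add_im,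
      Complex.real_smul, Complex.re_ofReal_mul, Complex.ofReal_re, Complex.ofReal_im, zero_mul,
      add_zero]
    ring
  set Γ := G '' (Metric.closedBall 0 1 ∩ {z | l z = 0}) with hΓdef
  have hK : IsCompact Γ :=
    ((isCompact_closedBall 0 1).inter_right (isClosed_eq hlc continuous_const)).image_of_continuousOn
      (h.continuousOn.mono inter_subset_left)
  have hp : G ζ ∈ J := h.mapsTo_circle ζ
  have hΓ : Γ ⊆ insert (G ζ) (inside J) := by
    rintro _ ⟨z, ⟨hz, hz0⟩, rfl⟩
    rcases (mem_closedBall_zero_iff.mp hz).lt_or_eq with hlt | heq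
    · exact Or.inr (h.mapsTo (mem_ball_zero_iff.mpr hlt))
    · rcases eq_or_eq_of_im_eq_zero ζ.norm_coe ξ.norm_coe heq hne' hz0 with rfl | rfl
      · exact Or.inl rfl
      · exact Or.inl hpq.symm
  have hΓJ : IsPreconnected (Γ ∩ J) := by
    refine Set.Subsingleton.isPreconnected fun x hx y hy => ?_
    have : ∀ x ∈ Γ ∩ J, x = G ζ := fun x hx => (hΓ hx.1).resolve_right fun h1 => h1.1 hx.2
    rw [this x hx, this y hy]
  have hnot : ∀ z ∈ Metric.ball (0 : ℂ) 1, l z ≠ 0 → G z ∉ Γ := by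
    rintro z hz hz0 ⟨w, ⟨hw, hw0⟩, hwz⟩
    rcases (mem_closedBall_zero_iff.mp hw).lt_or_eq with hlt | heq
    · exact hz0 (h.toIsRiemannMap.injOn (mem_ball_zero_iff.mpr hlt) hz hwz ▸ hw0)
    · obtain ⟨u, rfl⟩ : ∃ u : Circle, (u : ℂ) = w := ⟨⟨w, mem_sphere_zero_iff_norm.mpr heq⟩, rfl⟩
      exact (h.mapsTo hz).1 (hwz ▸ h.mapsTo_circle u)
  obtain ⟨⟨u₁, hu₁⟩, ⟨u₂, hu₂⟩⟩ := exists_circle_im_pos_neg ζ.norm_coe ξ.norm_coe hne'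
  have hmem : ∀ u : Circle, (u : ℂ) ∈ closure (Metric.ball (0 : ℂ) 1) := fun u => by
    rw [hcl, mem_closedBall_zero_iff, Circle.norm_coe]
  have hpo : IsOpen {z | 0 < l z} := isOpen_lt continuous_const hlc
  have hno : IsOpen {z | l z < 0} := isOpen_lt hlc continuous_const
  have hpc : Convex ℝ {z | 0 < l z} := by
    intro z hz w hw a b ha hb hab
    change 0 < l _
    rw [hlm z w a b hab]
    rcases ha.eq_or_lt with rfl | ha'
    · have : b = 1 := by linarith
      simpa [this] using hw
    · exact add_pos_of_pos_of_nonneg (mul_pos ha' hz) (mul_nonneg hb (le_of_lt hw))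
  have hnc : Convex ℝ {z | l z < 0} := by
    intro z hz w hw a b ha hb hab
    change l _ < 0
    rw [hlm z w a b hab]
    rcases ha.eq_or_lt with rfl | ha'
    · have : b = 1 := by linarith
      simpa [this] using hw
    · exact add_neg_of_neg_of_nonpos (mul_neg_of_pos_of_neg ha' hz)
        (mul_nonpos_of_nonneg_of_nonpos hb (le_of_lt hw))
  obtain ⟨a, ha, haB⟩ := mem_closure_iff.mp (hmem u₁) _ hpo hu₁
  obtain ⟨b, hb, hbB⟩ := mem_closure_iff.mp (hmem u₂) _ hno hu₂
  have haΓ : G a ∉ Γ := hnot a haB (ne_of_gt ha)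
  have hbΓ : G b ∉ Γ := hnot b hbB (ne_of_lt hb)
  have hA := h.not_isBounded_connectedComponentIn hJ hpo hpc hp hΓ hK.isClosed
    (fun z hz => hnot z hz.1 (ne_of_gt hz.2)) hu₁ ⟨haB, ha⟩
  have hB := h.not_isBounded_connectedComponentIn hJ hno hnc hp hΓ hK.isClosed
    (fun z hz => hnot z hz.1 (ne_of_lt hz.2)) hu₂ ⟨hbB, hb⟩
  have hab : G b ∈ connectedComponentIn Γᶜ (G a) := by
    rw [connectedComponentIn_eq_of_not_isBounded hK hA hB]
    exact mem_connectedComponentIn hbΓ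
  have hcon := hJ.connectedComponentIn_diff_eq hK hΓJ (h.mapsTo haB) (h.mapsTo hbB) haΓ hbΓ
    (hasLogOn_sub_div_sub hK.isClosed haΓ hab)
  set W := connectedComponentIn (inside J \ Γ) (G a) with hW
  have hWsub : W ⊆ inside J \ Γ := connectedComponentIn_subset _ _
  have himg : IsPreconnected ((l ∘ f) '' W) :=
    isPreconnected_connectedComponentIn.image _
      (hlc.comp_continuousOn (h.continuousOn_inv.mono (hWsub.trans sdiff_subset)))
  obtain ⟨w, hw, hw0⟩ := himg.ordConnected.out (mem_image_of_mem _ hcon)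
    (mem_image_of_mem _ (mem_connectedComponentIn ⟨h.mapsTo haB, haΓ⟩))
    (show (0 : ℝ) ∈ Icc _ _ by
      rw [Function.comp_apply, Function.comp_apply, h.left_inv b hbB, h.left_inv a haB]
      exact ⟨le_of_lt hb, le_of_lt ha⟩)
  refine (hWsub hw).2 ⟨f w, ⟨Metric.ball_subset_closedBall (h.mapsTo_inv (hWsub hw).1), hw0⟩, ?_⟩
  exact h.right_inv w (hWsub hw).1

theorem IsRiemannExtension.injOn_closedBall {J : Set ℂ} (hJ : IsJordanCurve J) {f G : ℂ → ℂ}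
    (h : IsRiemannExtension J f G) : InjOn G (Metric.closedBall 0 1) := by
  have hcirc : ∀ z : ℂ, ‖z‖ = 1 → ∃ u : Circle, (u : ℂ) = z := fun z hz =>
    ⟨⟨z, mem_sphere_zero_iff_norm.mpr hz⟩, rfl⟩
  intro z hz w hw hzw
  rcases (mem_closedBall_zero_iff.mp hz).lt_or_eq with hz1 | hz1 <;>
    rcases (mem_closedBall_zero_iff.mp hw).lt_or_eq with hw1 | hw1
  · exact h.toIsRiemannMap.injOn (mem_ball_zero_iff.mpr hz1) (mem_ball_zero_iff.mpr hw1) hzw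
  · obtain ⟨u, rfl⟩ := hcirc w hw1
    exact absurd (hzw ▸ h.mapsTo_circle u) (h.mapsTo (mem_ball_zero_iff.mpr hz1)).1
  · obtain ⟨u, rfl⟩ := hcirc z hz1
    exact absurd (hzw ▸ h.mapsTo_circle u) (h.mapsTo (mem_ball_zero_iff.mpr hw1)).1
  · obtain ⟨u, rfl⟩ := hcirc z hz1
    obtain ⟨v, rfl⟩ := hcirc w hw1
    rw [h.injective_circle hJ hzw]

theorem IsRiemannExtension.image_closedBall {J : Set ℂ} {f G : ℂ → ℂ}
    (h : IsRiemannExtension J f G) :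
    G '' Metric.closedBall 0 1 = closure (inside J) := by
  have hball : G '' Metric.ball 0 1 = inside J := by
    refine subset_antisymm (mapsTo_iff_image_subset.mp h.mapsTo) fun z hz => ?_
    exact ⟨f z, h.mapsTo_inv hz, h.right_inv z hz⟩
  rw [← closure_ball _ one_ne_zero]
  refine subset_antisymm ?_ ?_
  · rw [← hball]
    exact ContinuousOn.image_closure (by rw [closure_ball _ one_ne_zero]; exact h.continuousOn)
  · rw [closure_ball _ one_ne_zero]
    refine closure_minimal ?_ ((isCompact_closedBall 0 1).image_of_continuousOn
      h.continuousOn).isClosed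
    rw [← hball]
    exact image_mono Metric.ball_subset_closedBall

/-- A Riemann map onto the inside of a Jordan curve extends continuously to the closed disc. -/
theorem IsJordanCurve.exists_isRiemannExtension {J : Set ℂ} (hJ : IsJordanCurve J)
    (h0 : (0 : ℂ) ∈ inside J) :
    ∃ f G, IsRiemannExtension J f G ∧ G 0 = 0 ∧ deriv G 0 ≠ 0 := by
  obtain ⟨f, g, hf, hg, hfm, hgm, hgf, hfg, hg0⟩ := exists_riemann_map hJ.isOpen_inside
    hJ.isPreconnected_inside hJ.isBounded_inside h0 fun _ => hJ.hasLogOn_inside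
  obtain ⟨G, hGg, hG⟩ := IsRiemannMap.exists_isRiemannExtension hJ
    ⟨hf.continuousOn, hg, hfm, hgm, hgf, hfg⟩
  have hmem : (0 : ℂ) ∈ Metric.ball (0 : ℂ) 1 := Metric.mem_ball_self one_pos
  have hG0 : G 0 = 0 := by rw [hGg hmem, hg0]
  refine ⟨f, G, hG, hG0, fun hd => ?_⟩
  have h1 := (hG.differentiableOn.differentiableAt (Metric.isOpen_ball.mem_nhds hmem)).hasDerivAt
  have h2 : HasDerivAt f (deriv f (G 0)) (G 0) :=
    (hf.differentiableAt (hJ.isOpen_inside.mem_nhds (hG.mapsTo hmem))).hasDerivAt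
  have h3 := h2.comp 0 h1
  have h4 : HasDerivAt (f ∘ G) 1 0 := by
    refine (hasDerivAt_id _).congr_of_eventuallyEq ?_
    filter_upwards [Metric.isOpen_ball.mem_nhds hmem] with w hw using hG.left_inv w hw
  rw [hd, mul_zero] at h3
  exact zero_ne_one (h3.unique h4)

theorem exists_strictMonoOn_norm {G : ℂ → ℂ} {c : ℂ} (hG : HasStrictDerivAt G c 0) (hc : c ≠ 0)
    (h0 : G 0 = 0) :
    ∃ r > 0, ∀ u : ℂ, ‖u‖ = 1 → StrictMonoOn (fun t : ℝ => ‖G (t * u)‖) (Icc 0 r) := by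
  have hcn : 0 < ‖c‖ := norm_pos_iff.mpr hc
  have h1 := (hasStrictDerivAt_iff_hasStrictFDerivAt.mp hG).isLittleO.bound
    (c := ‖c‖ / 4) (by positivity)
  obtain ⟨r, hr, hball⟩ := Metric.eventually_nhds_iff_ball.mp h1
  refine ⟨r / 2, by positivity, fun u hu s hs t ht hst => ?_⟩
  have hmem : ∀ x ∈ Icc 0 (r / 2), ((x : ℂ) * u) ∈ Metric.ball (0 : ℂ) r := fun x hx => by
    rw [mem_ball_zero_iff, norm_mul, hu, mul_one, Complex.norm_real, Real.norm_of_nonneg hx.1]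
    linarith [hx.2]
  have hdiff : ∀ x ∈ Icc 0 (r / 2), ∀ y ∈ Icc 0 (r / 2), x < y → ∃ e : ℂ, ‖e‖ ≤ ‖c‖ / 4 ∧
      G (y * u) - G (x * u) = ((y - x : ℝ) : ℂ) * (c * u + e) := by
    intro x hx y hy hxy
    have hne : ((y - x : ℝ) : ℂ) ≠ 0 := by exact_mod_cast (sub_pos.mpr hxy).ne'
    have h2 := hball ((y : ℂ) * u, (x : ℂ) * u) (by
      rw [← ball_prod_same]
      exact ⟨hmem y hy, hmem x hx⟩)
    refine ⟨(G (y * u) - G (x * u)) / ((y - x : ℝ) : ℂ) - c * u, ?_, ?_⟩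
    · have h3 : (y : ℂ) * u - x * u = ((y - x : ℝ) : ℂ) * u := by push_cast; ring
      have h4 : ‖(y : ℂ) * u - x * u‖ = y - x := by
        rw [h3, norm_mul, hu, mul_one, Complex.norm_real, Real.norm_of_nonneg (by linarith)]
      simp only [ContinuousLinearMap.toSpanSingleton_apply, smul_eq_mul, h4] at h2
      have h5 : (G (y * u) - G (x * u)) / ((y - x : ℝ) : ℂ) - c * u
          = (G (y * u) - G (x * u) - ((y : ℂ) * u - x * u) * c) / ((y - x : ℝ) : ℂ) := by
        rw [h3]
        field_simp
      rw [h5, norm_div, Complex.norm_real, Real.norm_of_nonneg (by linarith),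
        div_le_iff₀ (by linarith)]
      exact h2
    · rw [add_sub_cancel, mul_div_cancel₀ _ hne]
  obtain ⟨e₂, he₂, h2⟩ := hdiff s hs t ht hst
  have hcu : ‖c * u‖ = ‖c‖ := by rw [norm_mul, hu, mul_one]
  have hB : ‖c‖ / 2 < ‖c * u + e₂‖ := by
    have := norm_sub_le (c * u + e₂) e₂
    rw [add_sub_cancel_right, hcu] at this
    linarith
  rcases hs.1.eq_or_lt with rfl | hs0
  · have h3 : G (t * u) = ((t - 0 : ℝ) : ℂ) * (c * u + e₂) := by
      rw [← h2, Complex.ofReal_zero, zero_mul, h0, sub_zero]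
    simp only [Complex.ofReal_zero, zero_mul, h0, norm_zero]
    rw [h3, norm_mul, Complex.norm_real]
    have : 0 < ‖t - 0‖ := norm_pos_iff.mpr (sub_pos.mpr hst).ne'
    exact mul_pos this (by linarith)
  · obtain ⟨e₁, he₁, h3⟩ := hdiff 0 ⟨le_rfl, by linarith⟩ s hs hs0
    rw [Complex.ofReal_zero, zero_mul, h0, sub_zero, sub_zero] at h3
    have h4 : G (t * u) = s * (c * u + e₁) + ((t - s : ℝ) : ℂ) * (c * u + e₂) := by
      rw [← h3, ← h2, add_sub_cancel]
    have h5 : 0 < ((c * u + e₁) * (starRingEnd ℂ) (c * u + e₂)).re := by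
      have h6 : (c * u + e₁) * (starRingEnd ℂ) (c * u + e₂) = (c * u) * (starRingEnd ℂ) (c * u)
          + (c * u * (starRingEnd ℂ) e₂ + e₁ * (starRingEnd ℂ) (c * u + e₂)) := by
        rw [map_add]
        ring
      have h7 := (abs_le.mp (Complex.abs_re_le_norm
        (c * u * (starRingEnd ℂ) e₂ + e₁ * (starRingEnd ℂ) (c * u + e₂)))).1
      have h8 := norm_add_le (c * u * (starRingEnd ℂ) e₂) (e₁ * (starRingEnd ℂ) (c * u + e₂))
      have h9 := norm_add_le (c * u) e₂
      rw [norm_mul (c * u), norm_mul e₁, RCLike.norm_conj, RCLike.norm_conj, hcu] at h8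
      rw [hcu] at h9
      rw [h6, Complex.add_re, Complex.mul_conj, Complex.ofReal_re, Complex.normSq_eq_norm_sq, hcu]
      nlinarith [norm_nonneg e₁, norm_nonneg e₂, norm_nonneg (c * u + e₂)]
    simp only
    rw [h4, h3]
    refine lt_of_pow_lt_pow_left₀ 2 (norm_nonneg _) ?_
    have h10 : Complex.normSq (s * (c * u + e₁) + ((t - s : ℝ) : ℂ) * (c * u + e₂))
        = Complex.normSq (s * (c * u + e₁)) + Complex.normSq (((t - s : ℝ) : ℂ) * (c * u + e₂))
          + 2 * (s * (t - s) * ((c * u + e₁) * (starRingEnd ℂ) (c * u + e₂)).re) := by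
      have h11 : s * (c * u + e₁) * (starRingEnd ℂ) (((t - s : ℝ) : ℂ) * (c * u + e₂))
          = ((s * (t - s) : ℝ) : ℂ) * ((c * u + e₁) * (starRingEnd ℂ) (c * u + e₂)) := by
        rw [map_mul, Complex.conj_ofReal]
        push_cast
        ring
      rw [Complex.normSq_add, h11, Complex.re_ofReal_mul]
    rw [← Complex.normSq_eq_norm_sq, ← Complex.normSq_eq_norm_sq, h10]
    have h11 := mul_pos (mul_pos hs0 (sub_pos.mpr hst)) h5
    linarith [Complex.normSq_nonneg (((t - s : ℝ) : ℂ) * (c * u + e₂))]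

theorem IsCompact.nonempty_homeomorph_image {X Y : Type*} [TopologicalSpace X] [TopologicalSpace Y]
    [T2Space Y] {K : Set X} (hK : IsCompact K) {f : X → Y} (hf : ContinuousOn f K)
    (hi : InjOn f K) : Nonempty (K ≃ₜ f '' K) := by
  have := isCompact_iff_compactSpace.mp hK
  have hc : Continuous (Equiv.Set.imageOfInjOn f K hi) :=
    Continuous.subtype_mk hf.domRestrict _
  exact ⟨hc.homeoOfEquivCompactToT2⟩

/-- Removing the preimage of a small disc from the disc leaves an annulus. -/
theorem exists_homeomorph_annulus {G : ℂ → ℂ} (hG : ContinuousOn G (Metric.closedBall 0 1))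
    (hinj : InjOn G (Metric.closedBall 0 1)) (h0 : G 0 = 0) {c : ℂ} (hGc : HasStrictDerivAt G c 0)
    (hc : c ≠ 0) :
    ∃ m > 0, ∀ δ ∈ Ioo 0 m, Nonempty
      ({w | w ∈ Metric.closedBall (0 : ℂ) 1 ∧ δ ≤ ‖G w‖} ≃ₜ {z : ℂ | 1 ≤ ‖z‖ ∧ ‖z‖ ≤ 2}) := by
  obtain ⟨r, hr, hmono⟩ := exists_strictMonoOn_norm hGc hc h0
  wlog hr1 : r ≤ 1 generalizing r
  · exact this 1 one_pos (fun u hu => (hmono u hu).mono (Icc_subset_Icc_right (by linarith))) le_rfl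
  have hcirc : ∀ z : ℂ, z ≠ 0 → ‖z / (‖z‖ : ℂ)‖ = 1 := fun z hz => by
    rw [norm_div, Complex.norm_real, norm_norm, div_self (norm_ne_zero_iff.mpr hz)]
  have hpolar : ∀ z : ℂ, z ≠ 0 → (‖z‖ : ℂ) * (z / (‖z‖ : ℂ)) = z := fun z hz =>
    mul_div_cancel₀ _ (by exact_mod_cast norm_ne_zero_iff.mpr hz)
  have hnorm : ∀ t : ℝ, 0 ≤ t → ∀ u : ℂ, ‖u‖ = 1 → ‖(t : ℂ) * u‖ = t := fun t ht u hu => by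
    rw [norm_mul, hu, mul_one, Complex.norm_real, Real.norm_of_nonneg ht]
  obtain ⟨m, hm, hmG⟩ : ∃ m > 0, ∀ w : ℂ, r ≤ ‖w‖ → ‖w‖ ≤ 1 → m ≤ ‖G w‖ := by
    have hK : IsCompact {w : ℂ | w ∈ Metric.closedBall (0 : ℂ) 1 ∧ r ≤ ‖w‖} :=
      (isCompact_closedBall 0 1).inter_right (isClosed_le continuous_const continuous_norm)
    have hne : {w : ℂ | w ∈ Metric.closedBall (0 : ℂ) 1 ∧ r ≤ ‖w‖}.Nonempty :=
      ⟨1, by rw [mem_closedBall_zero_iff, norm_one], by rwa [norm_one]⟩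
    obtain ⟨w, hw, hmin⟩ := hK.exists_isMinOn hne (hG.norm.mono fun _ h => h.1)
    refine ⟨‖G w‖, norm_pos_iff.mpr fun h => ?_, fun z hz hz1 => hmin ⟨by simpa using hz1, hz⟩⟩
    have := hinj hw.1 (Metric.mem_closedBall_self zero_le_one) (h.trans h0.symm)
    have hw2 := hw.2
    rw [this, norm_zero] at hw2
    exact hr.not_ge hw2
  refine ⟨m, hm, fun δ hδ => ?_⟩
  set S : ℝ → ℂ → ℝ := fun t u => ‖G ((min t r : ℝ) * u)‖ + max (t - r) 0 with hS
  have hSmono : ∀ u : ℂ, ‖u‖ = 1 → StrictMonoOn (fun t => S t u) (Ici 0) := by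
    intro u hu s hs t ht hst
    have hs' : min s r ∈ Icc 0 r := ⟨le_min hs hr.le, min_le_right _ _⟩
    have ht' : min t r ∈ Icc 0 r := ⟨le_min ht hr.le, min_le_right _ _⟩
    rcases le_or_gt r s with h | h
    · simp only [hS]
      rw [min_eq_right h, min_eq_right (h.trans hst.le), max_eq_left (by linarith),
        max_eq_left (by linarith)]
      linarith
    · refine add_lt_add_of_lt_of_le (hmono u hu hs' ht' ?_)
        (max_le_max (by linarith) le_rfl)
      rw [min_eq_left h.le]
      exact lt_min hst h
  have hS0 : ∀ u, S 0 u = 0 := fun u => by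
    simp only [hS]
    rw [min_eq_left hr.le, max_eq_right (by linarith), Complex.ofReal_zero, zero_mul, h0, norm_zero,
      add_zero]
  have hScont : ContinuousOn (fun p : ℝ × ℂ => S p.1 p.2) (Ici 0 ×ˢ {u | ‖u‖ = 1}) := by
    refine ContinuousOn.add (ContinuousOn.norm (hG.comp (by fun_prop) ?_)) (by fun_prop)
    rintro ⟨t, u⟩ ⟨ht, hu⟩
    rw [mem_closedBall_zero_iff, hnorm _ (le_min ht hr.le) u hu]
    exact (min_le_right _ _).trans hr1
  have hmS : ∀ t, r ≤ t → ∀ u : ℂ, ‖u‖ = 1 → m ≤ S t u := by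
    intro t ht u hu
    have h1 := hmG ((r : ℂ) * u) (hnorm r hr.le u hu).ge ((hnorm r hr.le u hu).le.trans hr1)
    simp only [hS]
    rw [min_eq_right ht]
    linarith [le_max_right (t - r) 0]
  have hSiff : ∀ t : ℝ, 0 ≤ t → t ≤ 1 → ∀ u : ℂ, ‖u‖ = 1 → (δ ≤ ‖G (t * u)‖ ↔ δ ≤ S t u) := by
    intro t ht ht1 u hu
    rcases le_or_gt r t with h | h
    · have h1 := hmG ((t : ℂ) * u) ((hnorm t ht u hu).ge.trans' h) ((hnorm t ht u hu).le.trans ht1)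
      exact iff_of_true (hδ.2.le.trans h1) (hδ.2.le.trans (hmS t h u hu))
    · simp only [hS]
      rw [min_eq_left h.le, max_eq_right (by linarith), add_zero]
  set E := {w | w ∈ Metric.closedBall (0 : ℂ) 1 ∧ δ ≤ ‖G w‖} with hE
  have hE0 : ∀ w ∈ E, w ≠ 0 := by
    rintro w hw rfl
    rw [hE, mem_ofPred_eq, h0, norm_zero] at hw
    exact hδ.1.not_ge hw.2
  have hE1 : ∀ w ∈ E, ‖w‖ ≤ 1 := fun w hw => mem_closedBall_zero_iff.mp hw.1
  have hES : ∀ w ∈ E, δ ≤ S ‖w‖ (w / (‖w‖ : ℂ)) := fun w hw => by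
    rw [← hSiff _ (norm_nonneg w) (hE1 w hw) _ (hcirc w (hE0 w hw)), hpolar w (hE0 w hw)]
    exact hw.2
  have hS1 : ∀ u : ℂ, ‖u‖ = 1 → 0 < S 1 u - δ := fun u hu => by linarith [hmS 1 hr1 u hu, hδ.2]
  have hEc : IsCompact E := by
    rw [Metric.isCompact_iff_isClosed_bounded]
    exact ⟨hG.norm.preimage_isClosed_of_isClosed Metric.isClosed_closedBall isClosed_Ici,
      Metric.isBounded_closedBall.subset fun _ h => h.1⟩
  set T : ℂ → ℝ := fun w => (S ‖w‖ (w / (‖w‖ : ℂ)) - δ) / (S 1 (w / (‖w‖ : ℂ)) - δ) with hT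
  have hT0 : ∀ w ∈ E, 0 ≤ T w := fun w hw =>
    div_nonneg (sub_nonneg.mpr (hES w hw)) (hS1 _ (hcirc w (hE0 w hw))).le
  have hT1 : ∀ w ∈ E, T w ≤ 1 := fun w hw => by
    refine (div_le_one (hS1 _ (hcirc w (hE0 w hw)))).mpr (sub_le_sub_right ?_ _)
    exact (hSmono _ (hcirc w (hE0 w hw))).monotoneOn (norm_nonneg w) (zero_le_one' ℝ) (hE1 w hw)
  have hdir : ContinuousOn (fun w : ℂ => w / (‖w‖ : ℂ)) E :=
    ContinuousOn.div (by fun_prop) (by fun_prop) fun w hw => by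
      exact_mod_cast norm_ne_zero_iff.mpr (hE0 w hw)
  have hTc : ContinuousOn T E := by
    refine ContinuousOn.div (ContinuousOn.sub ?_ continuousOn_const)
      (ContinuousOn.sub ?_ continuousOn_const) fun w hw => (hS1 _ (hcirc w (hE0 w hw))).ne'
    · exact hScont.comp (f := fun w : ℂ => (‖w‖, w / (‖w‖ : ℂ)))
        (continuous_norm.continuousOn.prodMk hdir) fun w hw => ⟨norm_nonneg w, hcirc w (hE0 w hw)⟩
    · exact hScont.comp (f := fun w : ℂ => ((1 : ℝ), w / (‖w‖ : ℂ)))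
        (continuousOn_const.prodMk hdir) fun w hw => ⟨zero_le_one' ℝ, hcirc w (hE0 w hw)⟩
  set Θ : ℂ → ℂ := fun w => ((1 + T w : ℝ) : ℂ) * (w / (‖w‖ : ℂ)) with hΘ
  have hΘc : ContinuousOn Θ E :=
    (Complex.continuous_ofReal.comp_continuousOn (continuousOn_const.add hTc)).mul hdir
  have hΘn : ∀ w ∈ E, ‖Θ w‖ = 1 + T w := fun w hw =>
    hnorm _ (by linarith [hT0 w hw]) _ (hcirc w (hE0 w hw))
  have hΘi : InjOn Θ E := by
    intro w hw z hz hwz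
    have h1 : T w = T z := by
      have := congrArg norm hwz
      rw [hΘn w hw, hΘn z hz] at this
      linarith
    have h2 : w / (‖w‖ : ℂ) = z / (‖z‖ : ℂ) := by
      simp only [hΘ, h1] at hwz
      refine mul_left_cancel₀ ?_ hwz
      exact_mod_cast (by linarith [hT0 z hz] : (0 : ℝ) < 1 + T z).ne'
    have h3 : ‖w‖ = ‖z‖ := by
      simp only [hT, h2] at h1
      rw [div_left_inj' (hS1 _ (hcirc z (hE0 z hz))).ne', sub_left_inj] at h1
      exact (hSmono _ (hcirc z (hE0 z hz))).injOn (norm_nonneg w) (norm_nonneg z) h1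
    rw [← hpolar w (hE0 w hw), h2, h3, hpolar z (hE0 z hz)]
  have himg : Θ '' E = {z : ℂ | 1 ≤ ‖z‖ ∧ ‖z‖ ≤ 2} := by
    ext z
    constructor
    · rintro ⟨w, hw, rfl⟩
      rw [mem_ofPred_eq, hΘn w hw]
      exact ⟨by linarith [hT0 w hw], by linarith [hT1 w hw]⟩
    · rintro ⟨hz1, hz2⟩
      have hz0 : z ≠ 0 := norm_pos_iff.mp (by linarith)
      set v := z / (‖z‖ : ℂ) with hv
      have hv1 : ‖v‖ = 1 := hcirc z hz0
      have hpos := hS1 v hv1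
      have hcont : ContinuousOn (fun t => S t v) (Icc 0 1) :=
        hScont.comp (f := fun t : ℝ => (t, v)) (by fun_prop) fun t ht => ⟨ht.1, hv1⟩
      obtain ⟨t, ht, hty⟩ := intermediate_value_Icc (zero_le_one' ℝ) hcont
        (show δ + (‖z‖ - 1) * (S 1 v - δ) ∈ _ by
          refine ⟨?_, by nlinarith⟩
          change S 0 v ≤ _
          rw [hS0]
          have := mul_nonneg (sub_nonneg.mpr hz1) hpos.le
          linarith [hδ.1])
      change S t v = _ at hty
      have hSt : δ ≤ S t v := by
        rw [hty]
        have := mul_nonneg (sub_nonneg.mpr hz1) hpos.le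
        linarith
      have ht0 : 0 < t := by
        refine ht.1.lt_of_ne fun h => ?_
        rw [← h, hS0] at hSt
        exact hδ.1.not_ge hSt
      have hn := hnorm t ht.1 v hv1
      have hdirv : (t : ℂ) * v / (t : ℂ) = v :=
        mul_div_cancel_left₀ _ (by exact_mod_cast ht0.ne')
      refine ⟨(t : ℂ) * v, ⟨mem_closedBall_zero_iff.mpr (hn.le.trans ht.2),
        (hSiff t ht.1 ht.2 v hv1).mpr hSt⟩, ?_⟩
      simp only [hΘ, hT]
      rw [hn, hdirv, hty, add_sub_cancel_left, mul_div_cancel_right₀ _ hpos.ne', add_sub_cancel,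
        hv, hpolar z hz0]
  rw [← himg]
  exact hEc.nonempty_homeomorph_image hΘc hΘi

theorem IsJordanCurve.inside_union_subset {J K : Set ℂ} (hJ : IsJordanCurve J)
    (hKJ : K ⊆ inside J) : inside K ∪ K ⊆ inside J := by
  refine union_subset (fun z hz => ?_) hKJ
  by_contra hzJ
  refine hJ.not_isBounded_outside (hz.2.subset ?_)
  have h1 : (inside J)ᶜ ⊆ connectedComponentIn Kᶜ z :=
    hJ.isPreconnected_compl_inside.subset_connectedComponentIn hzJ (compl_subset_compl.mpr hKJ)
  exact fun w hw => h1 fun hwi => disjoint_left.mp disjoint_inside_outside hwi hw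

theorem IsJordanCurve.subset_inside {J K : Set ℂ} (hJ : IsJordanCurve J) (hK : IsPreconnected K)
    (hd : Disjoint K J) (hi : (K ∩ inside J).Nonempty) : K ⊆ inside J := by
  refine hK.subset_left_of_subset_union hJ.isOpen_inside hJ.isOpen_outside
    disjoint_inside_outside ?_ hi
  rw [IsJordanCurve.inside_union_outside]
  exact disjoint_left.mp hd

/-- Disjoint Jordan curves do not cover the inside of one of them. -/
theorem not_inside_subset_sUnion {𝒟 : Set (Set ℂ)} (hJ𝒟 : ∀ K ∈ 𝒟, IsJordanCurve K)
    (hd : ∀ K ∈ 𝒟, ∀ L ∈ 𝒟, K ≠ L → Disjoint K L) {J : Set ℂ} (hJ : J ∈ 𝒟) :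
    ¬ inside J ⊆ ⋃₀ 𝒟 := by
  intro hcov
  have hcov' : inside J ∪ J ⊆ ⋃₀ 𝒟 := union_subset hcov (subset_sUnion_of_mem hJ)
  have hcpt : ∀ K ∈ 𝒟, IsCompact (inside K ∪ K) := by
    intro K hK
    have hKJ := hJ𝒟 K hK
    rw [Metric.isCompact_iff_isClosed_bounded]
    refine ⟨?_, hKJ.isBounded_inside.union hKJ.isCompact.isBounded⟩
    refine isClosed_of_closure_subset ?_
    rw [closure_union, hKJ.isCompact.isClosed.closure_eq]
    exact union_subset hKJ.closure_inside_subset subset_union_right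
  have hsub : ∀ K ∈ 𝒟, ∀ L ∈ 𝒟, ∀ z ∈ L, z ∈ inside K ∪ K →
      L = K ∨ inside L ∪ L ⊆ inside K := by
    intro K hK L hL z hzL hz
    by_cases hne : L = K
    · exact Or.inl hne
    · have hdis := hd L hL K hK hne
      refine Or.inr ((hJ𝒟 K hK).inside_union_subset ((hJ𝒟 K hK).subset_inside
        (hJ𝒟 L hL).isConnected.isPreconnected hdis ⟨z, hzL, ?_⟩))
      exact hz.resolve_right (disjoint_left.mp hdis hzL)
  obtain ⟨_, ⟨⟨M, hM, rfl⟩, hMJ⟩, hmin⟩ := zorn_superset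
      {D | (∃ K ∈ 𝒟, inside K ∪ K = D) ∧ D ⊆ inside J ∪ J} (by
    intro c hc hchain
    rcases c.eq_empty_or_nonempty with rfl | hne
    · exact ⟨_, ⟨⟨J, hJ, rfl⟩, subset_rfl⟩, by simp⟩
    have hcc : ∀ D ∈ c, IsCompact D := by
      intro D hD
      obtain ⟨⟨K, hK, rfl⟩, -⟩ := hc hD
      exact hcpt K hK
    have := hne.to_subtype
    obtain ⟨z, hz⟩ := IsCompact.nonempty_sInter_of_directed_nonempty_isCompact_isClosed
      (fun D hD E hE => (hchain.total hD hE).elim (fun h => ⟨D, hD, subset_rfl, h⟩)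
        fun h => ⟨E, hE, h, subset_rfl⟩) (by
        intro D hD
        obtain ⟨⟨K, hK, rfl⟩, -⟩ := hc hD
        exact (hJ𝒟 K hK).inside_nonempty.inl) hcc fun D hD => (hcc D hD).isClosed
    obtain ⟨D₀, hD₀⟩ := hne
    obtain ⟨L, hL, hzL⟩ := hcov' ((hc hD₀).2 (hz D₀ hD₀))
    have hle : ∀ D ∈ c, inside L ∪ L ⊆ D := by
      intro D hD
      obtain ⟨⟨K, hK, rfl⟩, -⟩ := hc hD
      rcases hsub K hK L hL z hzL (hz _ hD) with rfl | h
      · exact subset_rfl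
      · exact h.trans subset_union_left
    exact ⟨_, ⟨⟨L, hL, rfl⟩, (hle D₀ hD₀).trans (hc hD₀).2⟩, hle⟩)
  obtain ⟨w, hw⟩ := (hJ𝒟 M hM).inside_nonempty
  obtain ⟨L, hL, hwL⟩ := hcov' (hMJ (Or.inl hw))
  rcases hsub M hM L hL w hwL (Or.inl hw) with rfl | h
  · exact hw.1 hwL
  · obtain ⟨y, hy⟩ := (hJ𝒟 M hM).isConnected.nonempty
    have h1 := hmin ⟨⟨L, hL, rfl⟩, (h.trans subset_union_left).trans hMJ⟩
      (h.trans subset_union_left)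
    exact (h (h1 (Or.inr hy))).1 hy

/-- A rescaling of the radial coordinate that keeps the unit interval away from zero. -/
structure IsRadialProfile (φ : ℝ → ℝ) : Prop where
  continuous : Continuous φ
  strictMono : StrictMono φ
  pos : 0 < φ 0

/-- The embedding of the annulus in the plane with radial coordinate rescaled by `φ`. -/
noncomputable def annulusMap (φ : ℝ → ℝ) (p : Circle × Icc (0 : ℝ) 1) : ℂ :=
  (φ p.2 : ℂ) * (p.1 : ℂ)

namespace IsRadialProfile

variable {φ : ℝ → ℝ} {C : Set (Circle × Icc (0 : ℝ) 1)}

theorem norm_annulusMap (hφ : IsRadialProfile φ) (p : Circle × Icc (0 : ℝ) 1) :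
    ‖annulusMap φ p‖ = φ p.2 := by
  rw [annulusMap, norm_mul, Circle.norm_coe, mul_one, Complex.norm_real, Real.norm_of_nonneg]
  exact (hφ.pos.trans_le (hφ.strictMono.monotone p.2.2.1)).le

theorem continuous_annulusMap (hφ : IsRadialProfile φ) : Continuous (annulusMap φ) := by
  have := hφ.continuous
  unfold annulusMap
  fun_prop

theorem injective_annulusMap (hφ : IsRadialProfile φ) : Function.Injective (annulusMap φ) := by
  intro p q hpq
  have h1 : φ p.2 = φ q.2 := by rw [← hφ.norm_annulusMap p, hpq, hφ.norm_annulusMap q]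
  have h2 : p.2 = q.2 := Subtype.ext (hφ.strictMono.injective h1)
  refine Prod.ext (Circle.ext ?_) h2
  unfold annulusMap at hpq
  rw [h1] at hpq
  refine mul_left_cancel₀ ?_ hpq
  exact_mod_cast (hφ.pos.trans_le (hφ.strictMono.monotone q.2.2.1)).ne'

theorem isClosedEmbedding (hφ : IsRadialProfile φ) : IsClosedEmbedding (annulusMap φ) :=
  hφ.continuous_annulusMap.isClosedEmbedding hφ.injective_annulusMap

theorem range_annulusMap (hφ : IsRadialProfile φ) :
    range (annulusMap φ) = {z | φ 0 ≤ ‖z‖ ∧ ‖z‖ ≤ φ 1} := by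
  ext z
  constructor
  · rintro ⟨p, rfl⟩
    rw [mem_ofPred_eq, hφ.norm_annulusMap]
    exact ⟨hφ.strictMono.monotone p.2.2.1, hφ.strictMono.monotone p.2.2.2⟩
  · intro hz
    obtain ⟨t, ht, htz⟩ := intermediate_value_Icc (zero_le_one' ℝ) hφ.continuous.continuousOn hz
    have hz0 : ‖z‖ ≠ 0 := (hφ.pos.trans_le hz.1).ne'
    have hz1 : ‖z / (‖z‖ : ℂ)‖ = 1 := by
      rw [norm_div, Complex.norm_real, norm_norm, div_self hz0]
    refine ⟨(⟨_, mem_sphere_zero_iff_norm.mpr hz1⟩, ⟨t, ht⟩), ?_⟩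
    change (φ t : ℂ) * (z / (‖z‖ : ℂ)) = z
    rw [htz]
    exact mul_div_cancel₀ _ (by exact_mod_cast hz0)

theorem isJordanCurve (hφ : IsRadialProfile φ) (hC : IsCircle C) :
    IsJordanCurve (annulusMap φ '' C) := by
  obtain ⟨e⟩ := hC
  refine ⟨fun u => annulusMap φ (e.symm u),
    hφ.continuous_annulusMap.comp (continuous_subtype_val.comp e.symm.continuous),
    hφ.injective_annulusMap.comp (Subtype.val_injective.comp e.symm.injective), ?_⟩
  ext z
  constructor
  · rintro ⟨u, rfl⟩
    exact ⟨_, (e.symm u).2, rfl⟩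
  · rintro ⟨p, hp, rfl⟩
    exact ⟨e ⟨p, hp⟩, congrArg (fun x : C => annulusMap φ x) (e.symm_apply_apply ⟨p, hp⟩)⟩

theorem norm_mem_Ioo (hφ : IsRadialProfile φ) (hint : C ⊆ {p | 0 < (p.2 : ℝ) ∧ (p.2 : ℝ) < 1})
    {z : ℂ} (hz : z ∈ annulusMap φ '' C) : ‖z‖ ∈ Ioo (φ 0) (φ 1) := by
  obtain ⟨p, hp, rfl⟩ := hz
  rw [hφ.norm_annulusMap]
  exact ⟨hφ.strictMono (hint hp).1, hφ.strictMono (hint hp).2⟩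

theorem mem_outside (hφ : IsRadialProfile φ) (hC : IsCircle C)
    (hint : C ⊆ {p | 0 < (p.2 : ℝ) ∧ (p.2 : ℝ) < 1}) {z : ℂ} (hz : φ 1 ≤ ‖z‖) :
    z ∈ outside (annulusMap φ '' C) := by
  have hJ := hφ.isJordanCurve hC
  obtain ⟨w, hw, hmax⟩ := hJ.isCompact.exists_isMaxOn hJ.isConnected.nonempty
    continuous_norm.continuousOn
  refine hJ.mem_outside_of_closedBall (c := 0) (R := ‖w‖)
    (fun x hx => mem_closedBall_zero_iff.mpr (hmax hx)) fun h => ?_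
  exact ((hφ.norm_mem_Ioo hint hw).2.trans_le hz).not_ge (mem_closedBall_zero_iff.mp h)

theorem closedBall_disjoint (hφ : IsRadialProfile φ)
    (hint : C ⊆ {p | 0 < (p.2 : ℝ) ∧ (p.2 : ℝ) < 1}) :
    Disjoint (Metric.closedBall 0 (φ 0)) (annulusMap φ '' C) :=
  disjoint_left.mpr fun _ h1 h2 =>
    (hφ.norm_mem_Ioo hint h2).1.not_ge (mem_closedBall_zero_iff.mp h1)

theorem closedBall_subset_inside (hφ : IsRadialProfile φ) (hC : IsCircle C)
    (hint : C ⊆ {p | 0 < (p.2 : ℝ) ∧ (p.2 : ℝ) < 1}) (h0 : 0 ∈ inside (annulusMap φ '' C)) :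
    Metric.closedBall 0 (φ 0) ⊆ inside (annulusMap φ '' C) :=
  (hφ.isJordanCurve hC).subset_inside (convex_closedBall 0 _).isPreconnected
    (hφ.closedBall_disjoint hint) ⟨0, Metric.mem_closedBall_self hφ.pos.le, h0⟩

/-- An interior circle of a circle decomposition separates the boundary circles. -/
theorem zero_mem_inside (hφ : IsRadialProfile φ) {𝒞 : Set (Set (Circle × Icc (0 : ℝ) 1))}
    (h𝒞 : IsCircleDecomposition 𝒞) (hC : C ∈ 𝒞)
    (hint : C ⊆ {p | 0 < (p.2 : ℝ) ∧ (p.2 : ℝ) < 1}) : 0 ∈ inside (annulusMap φ '' C) := by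
  have hJ := hφ.isJordanCurve (h𝒞.1 C hC)
  by_contra h0
  have hball : Disjoint (Metric.closedBall 0 (φ 0)) (inside (annulusMap φ '' C)) := by
    refine disjoint_left.mpr fun z hz hzi => h0 ?_
    exact hJ.subset_inside (convex_closedBall 0 _).isPreconnected (hφ.closedBall_disjoint hint)
      ⟨z, hz, hzi⟩ (Metric.mem_closedBall_self hφ.pos.le)
  refine not_inside_subset_sUnion (𝒟 := image (annulusMap φ) '' 𝒞) ?_ ?_
    (mem_image_of_mem _ hC) ?_
  · rintro _ ⟨D, hD, rfl⟩
    exact hφ.isJordanCurve (h𝒞.1 D hD)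
  · rintro _ ⟨D, hD, rfl⟩ _ ⟨E, hE, rfl⟩ hne
    exact (disjoint_image_iff hφ.injective_annulusMap).mpr
      (h𝒞.2.1 D hD E hE fun h => hne (by rw [h]))
  · rw [← image_sUnion, h𝒞.2.2, image_univ, hφ.range_annulusMap]
    intro z hz
    constructor
    · by_contra! h
      exact disjoint_left.mp hball (mem_closedBall_zero_iff.mpr h.le) hz
    · by_contra! h
      exact disjoint_left.mp IsJordanCurve.disjoint_inside_outside hz (hφ.mem_outside (h𝒞.1 C hC) hint h.le)

end IsRadialProfile

theorem isPreconnected_ball_diff_zero : IsPreconnected (Metric.ball (0 : ℂ) 1 \ {0}) := by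
  have h1 : Metric.ball (0 : ℂ) 1 \ {0}
      = (fun p : ℝ × Circle => (p.1 : ℂ) * (p.2 : ℂ)) '' (Ioo 0 1 ×ˢ univ) := by
    ext z
    constructor
    · rintro ⟨hz, hz0⟩
      have hn : ‖z‖ ≠ 0 := norm_ne_zero_iff.mpr hz0
      have hz1 : ‖z / (‖z‖ : ℂ)‖ = 1 := by
        rw [norm_div, Complex.norm_real, norm_norm, div_self hn]
      refine ⟨(‖z‖, ⟨_, mem_sphere_zero_iff_norm.mpr hz1⟩),
        ⟨⟨norm_pos_iff.mpr hz0, mem_ball_zero_iff.mp hz⟩, mem_univ _⟩, ?_⟩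
      exact mul_div_cancel₀ _ (by exact_mod_cast hn)
    · rintro ⟨⟨t, u⟩, ⟨ht, -⟩, rfl⟩
      have hn : ‖(t : ℂ) * (u : ℂ)‖ = t := by
        rw [norm_mul, Circle.norm_coe, mul_one, Complex.norm_real, Real.norm_of_nonneg ht.1.le]
      exact ⟨mem_ball_zero_iff.mpr (hn.trans_lt ht.2), norm_pos_iff.mp (ht.1.trans_eq hn.symm)⟩
  have h2 : IsPreconnected (univ : Set Circle) := by
    have : (univ : Set Circle) = range Circle.exp := by
      refine (range_eq_univ.mpr fun u => ?_).symm
      exact ⟨_, Circle.exp_arg u⟩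
    rw [this]
    exact isPreconnected_range (by fun_prop)
  rw [h1]
  exact (isPreconnected_Ioo.prod h2).image _ (by fun_prop)

theorem IsJordanCurve.isPreconnected_inside_diff_zero {J : Set ℂ} (hJ : IsJordanCurve J)
    (h0 : (0 : ℂ) ∈ inside J) : IsPreconnected (inside J \ {0}) := by
  obtain ⟨f, G, hG, hG0, -⟩ := hJ.exists_isRiemannExtension h0
  have h1 : inside J \ {0} = G '' (Metric.ball 0 1 \ {0}) := by
    ext z
    constructor
    · rintro ⟨hz, hz0⟩
      refine ⟨f z, ⟨hG.mapsTo_inv hz, fun h => hz0 ?_⟩, hG.right_inv z hz⟩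
      rw [mem_singleton_iff, ← hG.right_inv z hz, mem_singleton_iff.mp h, hG0]
    · rintro ⟨w, ⟨hw, hw0⟩, rfl⟩
      refine ⟨hG.mapsTo hw, fun h => hw0 ?_⟩
      exact hG.toIsRiemannMap.injOn hw (Metric.mem_ball_self one_pos)
        ((mem_singleton_iff.mp h).trans hG0.symm)
  rw [h1]
  exact isPreconnected_ball_diff_zero.image _
    (hG.differentiableOn.continuousOn.mono sdiff_subset)

theorem connectedComponentIn_eq_of_union {X : Type*} [TopologicalSpace X] {S U V : Set X}
    (hU : IsOpen U) (hV : IsOpen V) (hd : Disjoint U V) (hS : U ∪ V = S) (hUc : IsPreconnected U)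
    {x : X} (hx : x ∈ U) : connectedComponentIn S x = U := by
  have hUS : U ⊆ S := hS ▸ subset_union_left
  refine subset_antisymm ?_ (hUc.subset_connectedComponentIn hx hUS)
  exact isPreconnected_connectedComponentIn.subset_left_of_subset_union hU hV hd
    (hS ▸ connectedComponentIn_subset _ _) ⟨x, mem_connectedComponentIn (hUS hx), hx⟩

namespace IsRadialProfile

variable {φ : ℝ → ℝ} {C : Set (Circle × Icc (0 : ℝ) 1)}

theorem isPreconnected_preimage_inside (hφ : IsRadialProfile φ) (hC : IsCircle C)
    (hint : C ⊆ {p | 0 < (p.2 : ℝ) ∧ (p.2 : ℝ) < 1}) (h0 : 0 ∈ inside (annulusMap φ '' C)) :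
    IsPreconnected (annulusMap φ ⁻¹' inside (annulusMap φ '' C)) := by
  have hJ := hφ.isJordanCurve hC
  rw [← hφ.isClosedEmbedding.isInducing.isPreconnected_image, image_preimage_eq_inter_range,
    hφ.range_annulusMap]
  have h1 : inside (annulusMap φ '' C) ∩ {z | φ 0 ≤ ‖z‖ ∧ ‖z‖ ≤ φ 1}
      = (fun z : ℂ => ((max 1 (φ 0 / ‖z‖) : ℝ) : ℂ) * z) '' (inside (annulusMap φ '' C) \ {0}) := by
    ext z
    constructor
    · rintro ⟨hz, hz1, -⟩
      refine ⟨z, ⟨hz, norm_pos_iff.mp (hφ.pos.trans_le hz1)⟩, ?_⟩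
      simp only
      rw [max_eq_left ((div_le_one (hφ.pos.trans_le hz1)).mpr hz1), Complex.ofReal_one, one_mul]
    · rintro ⟨w, ⟨hw, hw0⟩, rfl⟩
      have hn : 0 < ‖w‖ := norm_pos_iff.mpr hw0
      simp only
      rcases le_total (φ 0) ‖w‖ with h | h
      · rw [max_eq_left ((div_le_one hn).mpr h), Complex.ofReal_one, one_mul]
        refine ⟨hw, h, ?_⟩
        by_contra! h2
        exact disjoint_left.mp IsJordanCurve.disjoint_inside_outside hw (hφ.mem_outside hC hint h2.le)
      · rw [max_eq_right ((one_le_div hn).mpr h)]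
        have h2 : ‖((φ 0 / ‖w‖ : ℝ) : ℂ) * w‖ = φ 0 := by
          rw [norm_mul, Complex.norm_real, Real.norm_of_nonneg (div_nonneg hφ.pos.le hn.le),
            div_mul_cancel₀ _ hn.ne']
        exact ⟨hφ.closedBall_subset_inside hC hint h0 (mem_closedBall_zero_iff.mpr h2.le), h2.ge,
          h2.le.trans (hφ.strictMono.monotone zero_le_one)⟩
  rw [h1]
  refine (hJ.isPreconnected_inside_diff_zero h0).image _ (ContinuousOn.mul ?_ continuousOn_id)
  refine Complex.continuous_ofReal.comp_continuousOn (continuousOn_const.sup ?_)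
  exact ContinuousOn.div continuousOn_const (by fun_prop) fun w hw => norm_ne_zero_iff.mpr hw.2

theorem isPreconnected_preimage_outside (hφ : IsRadialProfile φ) (hC : IsCircle C)
    (hint : C ⊆ {p | 0 < (p.2 : ℝ) ∧ (p.2 : ℝ) < 1}) (h0 : 0 ∈ inside (annulusMap φ '' C)) :
    IsPreconnected (annulusMap φ ⁻¹' outside (annulusMap φ '' C)) := by
  have hJ := hφ.isJordanCurve hC
  have hpos : ∀ w ∈ outside (annulusMap φ '' C), φ 0 < ‖w‖ := fun w hw => by
    by_contra! h
    exact disjoint_left.mp IsJordanCurve.disjoint_inside_outside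
      (hφ.closedBall_subset_inside hC hint h0 (mem_closedBall_zero_iff.mpr h)) hw
  have hφ1 : 0 < φ 1 := hφ.pos.trans (hφ.strictMono one_pos)
  rw [← hφ.isClosedEmbedding.isInducing.isPreconnected_image, image_preimage_eq_inter_range,
    hφ.range_annulusMap]
  have h1 : outside (annulusMap φ '' C) ∩ {z | φ 0 ≤ ‖z‖ ∧ ‖z‖ ≤ φ 1}
      = (fun z : ℂ => ((min 1 (φ 1 / ‖z‖) : ℝ) : ℂ) * z) '' outside (annulusMap φ '' C) := by
    ext z
    constructor
    · rintro ⟨hz, hz1, hz2⟩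
      refine ⟨z, hz, ?_⟩
      simp only
      rw [min_eq_left ((one_le_div (hφ.pos.trans_le hz1)).mpr hz2), Complex.ofReal_one, one_mul]
    · rintro ⟨w, hw, rfl⟩
      have hn : 0 < ‖w‖ := hφ.pos.trans (hpos w hw)
      simp only
      rcases le_total ‖w‖ (φ 1) with h | h
      · rw [min_eq_left ((one_le_div hn).mpr h), Complex.ofReal_one, one_mul]
        exact ⟨hw, (hpos w hw).le, h⟩
      · rw [min_eq_right ((div_le_one hn).mpr h)]
        have h2 : ‖((φ 1 / ‖w‖ : ℝ) : ℂ) * w‖ = φ 1 := by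
          rw [norm_mul, Complex.norm_real, Real.norm_of_nonneg (div_nonneg hφ1.le hn.le),
            div_mul_cancel₀ _ hn.ne']
        exact ⟨hφ.mem_outside hC hint h2.ge, h2.ge.trans' (hφ.strictMono.monotone zero_le_one),
          h2.le⟩
  rw [h1]
  refine hJ.isPreconnected_outside.image _ (ContinuousOn.mul ?_ continuousOn_id)
  refine Complex.continuous_ofReal.comp_continuousOn (continuousOn_const.inf ?_)
  exact ContinuousOn.div continuousOn_const (by fun_prop) fun w hw =>
    (hφ.pos.trans (hpos w hw)).ne'

theorem preimage_inside_union_preimage_outside (hφ : IsRadialProfile φ) :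
    annulusMap φ ⁻¹' inside (annulusMap φ '' C) ∪ annulusMap φ ⁻¹' outside (annulusMap φ '' C)
      = Cᶜ := by
  rw [← preimage_union, IsJordanCurve.inside_union_outside, preimage_compl,
    preimage_image_eq _ hφ.injective_annulusMap]

theorem connectedComponentIn_eq_preimage_inside (hφ : IsRadialProfile φ) (hC : IsCircle C)
    (hint : C ⊆ {p | 0 < (p.2 : ℝ) ∧ (p.2 : ℝ) < 1}) (h0 : 0 ∈ inside (annulusMap φ '' C))
    {p : Circle × Icc (0 : ℝ) 1} (hp : annulusMap φ p ∈ inside (annulusMap φ '' C)) :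
    connectedComponentIn Cᶜ p = annulusMap φ ⁻¹' inside (annulusMap φ '' C) :=
  have hJ := hφ.isJordanCurve hC
  connectedComponentIn_eq_of_union (hJ.isOpen_inside.preimage hφ.continuous_annulusMap)
    (hJ.isOpen_outside.preimage hφ.continuous_annulusMap) (IsJordanCurve.disjoint_inside_outside.preimage _)
    hφ.preimage_inside_union_preimage_outside (hφ.isPreconnected_preimage_inside hC hint h0) hp

theorem connectedComponentIn_eq_preimage_outside (hφ : IsRadialProfile φ) (hC : IsCircle C)
    (hint : C ⊆ {p | 0 < (p.2 : ℝ) ∧ (p.2 : ℝ) < 1}) (h0 : 0 ∈ inside (annulusMap φ '' C))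
    {p : Circle × Icc (0 : ℝ) 1} (hp : annulusMap φ p ∈ outside (annulusMap φ '' C)) :
    connectedComponentIn Cᶜ p = annulusMap φ ⁻¹' outside (annulusMap φ '' C) :=
  have hJ := hφ.isJordanCurve hC
  connectedComponentIn_eq_of_union (hJ.isOpen_outside.preimage hφ.continuous_annulusMap)
    (hJ.isOpen_inside.preimage hφ.continuous_annulusMap) (IsJordanCurve.disjoint_inside_outside.symm.preimage _)
    (by rw [union_comm, hφ.preimage_inside_union_preimage_outside])
    (hφ.isPreconnected_preimage_outside hC hint h0) hp

theorem mem_inside_of_eq_zero (hφ : IsRadialProfile φ) (hC : IsCircle C)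
    (hint : C ⊆ {p | 0 < (p.2 : ℝ) ∧ (p.2 : ℝ) < 1}) (h0 : 0 ∈ inside (annulusMap φ '' C))
    {p : Circle × Icc (0 : ℝ) 1} (hp : p.2 = 0) : annulusMap φ p ∈ inside (annulusMap φ '' C) := by
  refine hφ.closedBall_subset_inside hC hint h0 (mem_closedBall_zero_iff.mpr ?_)
  rw [hφ.norm_annulusMap, hp, Icc.coe_zero]

theorem mem_outside_of_eq_one (hφ : IsRadialProfile φ) (hC : IsCircle C)
    (hint : C ⊆ {p | 0 < (p.2 : ℝ) ∧ (p.2 : ℝ) < 1})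
    {p : Circle × Icc (0 : ℝ) 1} (hp : p.2 = 1) : annulusMap φ p ∈ outside (annulusMap φ '' C) := by
  refine hφ.mem_outside hC hint ?_
  rw [hφ.norm_annulusMap, hp, Icc.coe_one]

theorem image_closure_preimage_inside (hφ : IsRadialProfile φ) (hC : IsCircle C)
    (hint : C ⊆ {p | 0 < (p.2 : ℝ) ∧ (p.2 : ℝ) < 1}) :
    annulusMap φ '' closure (annulusMap φ ⁻¹' inside (annulusMap φ '' C))
      = {z | z ∈ closure (inside (annulusMap φ '' C)) ∧ φ 0 ≤ ‖z‖} := by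
  have hJ := hφ.isJordanCurve hC
  rw [← hφ.isClosedEmbedding.closure_image_eq, image_preimage_eq_inter_range]
  refine subset_antisymm ?_ ?_
  · intro z hz
    refine ⟨closure_mono inter_subset_left hz, ?_⟩
    have h1 := closure_minimal inter_subset_right hφ.isClosedEmbedding.isClosed_range hz
    rw [hφ.range_annulusMap] at h1
    exact h1.1
  · rintro z ⟨hz, hz0⟩
    rcases hJ.closure_inside_subset hz with h | h
    · refine subset_closure ⟨h, ?_⟩
      rw [hφ.range_annulusMap]
      refine ⟨hz0, ?_⟩
      by_contra! h2
      exact disjoint_left.mp IsJordanCurve.disjoint_inside_outside h (hφ.mem_outside hC hint h2.le)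
    · have hO : IsOpen {w : ℂ | ‖w‖ ∈ Ioo (φ 0) (φ 1)} := isOpen_Ioo.preimage continuous_norm
      refine closure_mono (inter_subset_inter_right _ ?_)
        (hO.closure_inter ⟨hz, hφ.norm_mem_Ioo hint h⟩)
      rw [hφ.range_annulusMap]
      exact fun w hw => ⟨hw.1.le, hw.2.le⟩

end IsRadialProfile

theorem isRadialProfile_one_add : IsRadialProfile fun t => 1 + t :=
  ⟨by fun_prop, fun _ _ h => add_lt_add_right h 1, by norm_num⟩

/-- The radial coordinate can be stretched near one boundary circle of the annulus without moving
points further away. -/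
theorem exists_isRadialProfile {δ t₀ : ℝ} (hδ : δ ∈ Ioo 0 1) (ht₀ : 0 < t₀) :
    ∃ φ, IsRadialProfile φ ∧ φ 0 = δ ∧ ∀ t, t₀ ≤ t → φ t = 1 + t := by
  refine ⟨fun t => 1 + t - (1 - δ) * max 0 (1 - t / t₀), ⟨by fun_prop, fun s t hst => ?_, ?_⟩, ?_,
    fun t ht => ?_⟩
  · have h1 : max 0 (1 - t / t₀) ≤ max 0 (1 - s / t₀) :=
      max_le_max le_rfl (sub_le_sub_left (by gcongr) 1)
    have h2 := mul_le_mul_of_nonneg_left h1 (sub_nonneg.mpr hδ.2.le)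
    linarith
  · simpa using hδ.1
  · simp
  · simp only
    rw [max_eq_left (sub_nonpos.mpr ((one_le_div ht₀).mpr ht)), mul_zero, sub_zero]

/-- An interior circle of a circle decomposition cuts off an annulus at the boundary circle of
height zero. -/
theorem nonempty_homeomorph_closure_connectedComponentIn
    {𝒞 : Set (Set (Circle × Icc (0 : ℝ) 1))} (h𝒞 : IsCircleDecomposition 𝒞)
    {C : Set (Circle × Icc (0 : ℝ) 1)} (hC : C ∈ 𝒞)
    (hint : C ⊆ {p | 0 < (p.2 : ℝ) ∧ (p.2 : ℝ) < 1})
    {p : Circle × Icc (0 : ℝ) 1} (hp : p.2 = 0) :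
    Nonempty (closure (connectedComponentIn Cᶜ p) ≃ₜ Circle × Icc (0 : ℝ) 1) := by
  have hCc := h𝒞.1 C hC
  set ψ : ℝ → ℝ := fun t => 1 + t with hψdef
  have hψ : IsRadialProfile ψ := isRadialProfile_one_add
  set J := annulusMap ψ '' C with hJdef
  have hJ : IsJordanCurve J := hψ.isJordanCurve hCc
  have h0 : 0 ∈ inside J := hψ.zero_mem_inside h𝒞 hC hint
  obtain ⟨f, G, hG, hG0, hGd⟩ := hJ.exists_isRiemannExtension h0
  have hGs : HasStrictDerivAt G (deriv G 0) 0 :=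
    (hG.differentiableOn.analyticAt
      (Metric.isOpen_ball.mem_nhds (Metric.mem_ball_self one_pos))).hasStrictDerivAt
  have hGi := hG.injOn_closedBall hJ
  obtain ⟨m, hm, hann⟩ := exists_homeomorph_annulus hG.continuousOn hGi hG0 hGs hGd
  obtain ⟨t₀, ht₀, hCt⟩ : ∃ t₀ > 0, ∀ q ∈ C, t₀ ≤ (q.2 : ℝ) := by
    obtain ⟨z, hz, hmin⟩ := hJ.isCompact.exists_isMinOn hJ.isConnected.nonempty
      continuous_norm.continuousOn
    refine ⟨‖z‖ - 1, ?_, fun q hq => ?_⟩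
    · have := (hψ.norm_mem_Ioo hint hz).1
      simp only [hψdef] at this
      linarith
    · have h1 : ‖z‖ ≤ ‖annulusMap ψ q‖ := hmin (mem_image_of_mem _ hq)
      rw [hψ.norm_annulusMap] at h1
      simp only [hψdef] at h1
      linarith
  obtain ⟨φ, hφ, hφ0, hφt⟩ := exists_isRadialProfile (δ := min m 1 / 2) (t₀ := t₀)
    ⟨by positivity, by linarith [min_le_right m 1]⟩ ht₀
  have hJφ : annulusMap φ '' C = J := image_congr fun q hq => by
    unfold annulusMap
    rw [hφt _ (hCt q hq)]
  have h0φ : 0 ∈ inside (annulusMap φ '' C) := hJφ ▸ h0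
  rw [hφ.connectedComponentIn_eq_preimage_inside hCc hint h0φ
    (hφ.mem_inside_of_eq_zero hCc hint h0φ hp)]
  obtain ⟨e₁⟩ := (isClosed_closure (s := annulusMap φ ⁻¹' inside (annulusMap φ '' C))).isCompact
    |>.nonempty_homeomorph_image hφ.continuous_annulusMap.continuousOn
      hφ.injective_annulusMap.injOn
  set E := {w | w ∈ Metric.closedBall (0 : ℂ) 1 ∧ min m 1 / 2 ≤ ‖G w‖} with hE
  have hEc : IsCompact E := by
    rw [Metric.isCompact_iff_isClosed_bounded]
    exact ⟨hG.continuousOn.norm.preimage_isClosed_of_isClosed Metric.isClosed_closedBall isClosed_Ici,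
      Metric.isBounded_closedBall.subset fun _ h => h.1⟩
  obtain ⟨e₂⟩ := hEc.nonempty_homeomorph_image (hG.continuousOn.mono fun _ h => h.1)
    (hGi.mono fun _ h => h.1)
  have hGE : annulusMap φ '' closure (annulusMap φ ⁻¹' inside (annulusMap φ '' C)) = G '' E := by
    rw [hφ.image_closure_preimage_inside hCc hint, hJφ, hφ0, ← hG.image_closedBall]
    ext z
    constructor
    · rintro ⟨⟨w, hw, rfl⟩, hz⟩
      exact ⟨w, ⟨hw, hz⟩, rfl⟩
    · rintro ⟨w, ⟨hw, hz⟩, rfl⟩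
      exact ⟨⟨w, hw, rfl⟩, hz⟩
  obtain ⟨e₃⟩ := hann (min m 1 / 2) ⟨by positivity, by linarith [min_le_left m 1]⟩
  have hran : range (annulusMap ψ) = {z : ℂ | 1 ≤ ‖z‖ ∧ ‖z‖ ≤ 2} := by
    rw [hψ.range_annulusMap]
    norm_num [hψdef]
  exact ⟨e₁.trans <| (Homeomorph.setCongr hGE).trans <| e₂.symm.trans <| e₃.trans <|
    (Homeomorph.setCongr hran.symm).trans hψ.isClosedEmbedding.isEmbedding.toHomeomorph.symm⟩

theorem IsCircle.image {X Y : Type*} [TopologicalSpace X] [TopologicalSpace Y] {C : Set X}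
    (hC : IsCircle C) (e : X ≃ₜ Y) : IsCircle (e '' C) :=
  hC.map fun e' => (e.image C).symm.trans e'

theorem IsCircleDecomposition.image {X Y : Type*} [TopologicalSpace X] [TopologicalSpace Y]
    {𝒞 : Set (Set X)} (h : IsCircleDecomposition 𝒞) (e : X ≃ₜ Y) :
    IsCircleDecomposition (Set.image e '' 𝒞) := by
  refine ⟨?_, ?_, ?_⟩
  · rintro _ ⟨C, hC, rfl⟩
    exact (h.1 C hC).image e
  · rintro _ ⟨C, hC, rfl⟩ _ ⟨D, hD, rfl⟩ hne
    exact (disjoint_image_iff e.injective).mpr (h.2.1 C hC D hD fun h' => hne (by rw [h']))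
  · rw [← image_sUnion, h.2.2, image_univ, e.surjective.range_eq]

/-- The homeomorphism exchanging the boundary circles of the annulus. -/
noncomputable def annulusFlip : Circle × Icc (0 : ℝ) 1 ≃ₜ Circle × Icc (0 : ℝ) 1 :=
  (Homeomorph.refl Circle).prodCongr unitInterval.symmHomeomorph

/-- Let `𝒞` be a circle decomposition of the annulus `A = Circle × [0,1]` and let
`C ∈ 𝒞` be contained in the interior of `A`. Then `A \ C` has exactly two connected
components, and the closure of each of them is homeomorphic to the annulus. -/
theorem interior_circle_cuts_annulus_into_two_annuli
    (𝒞 : Set (Set (Circle × Set.Icc (0:ℝ) 1))) (h𝒞 : IsCircleDecomposition 𝒞)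
    (C : Set (Circle × Set.Icc (0:ℝ) 1)) (hC : C ∈ 𝒞)
    (hint : C ⊆ {p : Circle × Set.Icc (0:ℝ) 1 | 0 < (p.2 : ℝ) ∧ (p.2 : ℝ) < 1}) :
    ∃ U V : Set (Circle × Set.Icc (0:ℝ) 1), U ≠ V ∧
      {W : Set (Circle × Set.Icc (0:ℝ) 1) | ∃ x ∈ Cᶜ, W = connectedComponentIn Cᶜ x}
        = {U, V} ∧
      Nonempty ((closure U : Set (Circle × Set.Icc (0:ℝ) 1)) ≃ₜ Circle × Set.Icc (0:ℝ) 1) ∧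
      Nonempty ((closure V : Set (Circle × Set.Icc (0:ℝ) 1)) ≃ₜ Circle × Set.Icc (0:ℝ) 1) := by
  have hφ := isRadialProfile_one_add
  have hCc := h𝒞.1 C hC
  have h0 := hφ.zero_mem_inside h𝒞 hC hint
  set p : Circle × Icc (0 : ℝ) 1 := (1, 0) with hpdef
  set q : Circle × Icc (0 : ℝ) 1 := (1, 1) with hqdef
  have hp := hφ.mem_inside_of_eq_zero hCc hint h0 (p := p) rfl
  have hq := hφ.mem_outside_of_eq_one hCc hint (p := q) rfl
  have hU := hφ.connectedComponentIn_eq_preimage_inside hCc hint h0 hp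
  have hV := hφ.connectedComponentIn_eq_preimage_outside hCc hint h0 hq
  have hpC : p ∈ Cᶜ := fun h => lt_irrefl _ (hint h).1
  have hqC : q ∈ Cᶜ := fun h => lt_irrefl _ (hint h).2
  refine ⟨connectedComponentIn Cᶜ p, connectedComponentIn Cᶜ q, ?_, ?_,
    nonempty_homeomorph_closure_connectedComponentIn h𝒞 hC hint rfl, ?_⟩
  · rw [hU, hV]
    intro h
    have hp' : p ∈ annulusMap (fun t => 1 + t) ⁻¹'
        inside (annulusMap (fun t => 1 + t) '' C) := hp
    rw [h] at hp'
    exact disjoint_left.mp IsJordanCurve.disjoint_inside_outside hp hp'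
  · ext W
    constructor
    · rintro ⟨x, hx, rfl⟩
      rw [← hφ.preimage_inside_union_preimage_outside] at hx
      rcases hx with hx | hx
      · exact Or.inl ((hφ.connectedComponentIn_eq_preimage_inside hCc hint h0 hx).trans hU.symm)
      · exact Or.inr ((hφ.connectedComponentIn_eq_preimage_outside hCc hint h0 hx).trans hV.symm)
    · rintro (rfl | rfl)
      · exact ⟨p, hpC, rfl⟩
      · exact ⟨q, hqC, rfl⟩
  · have hint' : annulusFlip '' C ⊆ {p | 0 < (p.2 : ℝ) ∧ (p.2 : ℝ) < 1} := by
      rintro _ ⟨x, hx, rfl⟩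
      have h1 := hint hx
      have h2 : ((annulusFlip x).2 : ℝ) = 1 - x.2 := rfl
      rw [mem_ofPred_eq, h2]
      exact ⟨by linarith [h1.2], by linarith [h1.1]⟩
    obtain ⟨e⟩ := nonempty_homeomorph_closure_connectedComponentIn (h𝒞.image annulusFlip)
      (mem_image_of_mem _ hC) hint' (p := annulusFlip q) unitInterval.symm_one
    have himg : annulusFlip '' closure (connectedComponentIn Cᶜ q)
        = closure (connectedComponentIn (annulusFlip '' C)ᶜ (annulusFlip q)) := by
      rw [annulusFlip.image_closure, annulusFlip.image_connectedComponentIn hqC,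
        image_compl_eq annulusFlip.bijective]
    exact ⟨(annulusFlip.image _).trans ((Homeomorph.setCongr himg).trans e)⟩
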